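/- (Main trilinear estimate.) There is a constant C (depending only on the fixed cutoff ψ) such that for either choice of sign ± and all Schwartz functions v,u₁,u₂ on ℝ²×ℝ, |I(𝔉v, 𝔉u₁, 𝔉u₂)| ≤ C ‖u₁‖_{X^S_{0,5/12,1}} ‖u₂‖_{X^S_{0,5/12,1}} ‖v‖_{X^{W±}_{−1/2,5/12,1}}. -/

import Mathlib

noncomputable section

open MeasureTheory Real
open scoped FourierTransform ENNReal

/-- Space-time ℝ²×ℝ, modeled as ℝ³; the first two coordinates are the spatial
frequency ξ and the last one is the time frequency τ. -/
abbrev SpaceTime : Type := EuclideanSpace ℝ (Fin 3)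

/-- |ξ|, the norm of the spatial frequency. -/
def spFreq (ζ : SpaceTime) : ℝ := Real.sqrt (ζ 0 ^ 2 + ζ 1 ^ 2)

/-- τ, the time frequency. -/
def tFreq (ζ : SpaceTime) : ℝ := ζ 2

/-- The trilinear convolution form I(f,g₁,g₂) = ∫∫ f(ζ₁−ζ₂) g₁(ζ₁) g₂(ζ₂) dζ₁ dζ₂. -/
def trilinI (f g₁ g₂ : SpaceTime → ℂ) : ℂ :=
  ∫ ζ₁ : SpaceTime, ∫ ζ₂ : SpaceTime, f (ζ₁ - ζ₂) * g₁ ζ₁ * g₂ ζ₂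

/-- The dyadic bump ψ_L built from the cutoff ψ: ψ₁ = ψ and
ψ_L(r) = ψ(r/L) − ψ(2r/L) for L ≥ 2. -/
def psiDy (ψ : ℝ → ℝ) (L r : ℝ) : ℝ := if L = 1 then ψ r else ψ (r / L) - ψ (2 * r / L)

/-- Dyadic spatial frequency localization P_N, with symbol ψ_N(|ξ|). -/
def PN (ψ : ℝ → ℝ) (N : ℝ) (u : SpaceTime → ℂ) : SpaceTime → ℂ :=
  𝓕⁻ fun ζ => (psiDy ψ N (spFreq ζ) : ℂ) * 𝓕 u ζ

/-- Schrödinger modulation localization S_L, with symbol ψ_L(τ+|ξ|²). -/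
def SL (ψ : ℝ → ℝ) (L : ℝ) (u : SpaceTime → ℂ) : SpaceTime → ℂ :=
  𝓕⁻ fun ζ => (psiDy ψ L (tFreq ζ + spFreq ζ ^ 2) : ℂ) * 𝓕 u ζ

/-- Wave modulation localization W^±_L, with symbol ψ_L(τ±|ξ|); `s = ±1`. -/
def WL (ψ : ℝ → ℝ) (s L : ℝ) (u : SpaceTime → ℂ) : SpaceTime → ℂ :=
  𝓕⁻ fun ζ => (psiDy ψ L (tFreq ζ + s * spFreq ζ) : ℂ) * 𝓕 u ζ

/-- The Bourgain norm ‖u‖_{X^S_{σ,b,1}}. -/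
def XSnorm1 (ψ : ℝ → ℝ) (σ b : ℝ) (u : SpaceTime → ℂ) : ℝ≥0∞ :=
  (∑' n : ℕ, ENNReal.ofReal (((2 : ℝ) ^ n) ^ (2 * σ)) *
      (∑' l : ℕ, ENNReal.ofReal (((2 : ℝ) ^ l) ^ b) *
        eLpNorm (SL ψ ((2 : ℝ) ^ l) (PN ψ ((2 : ℝ) ^ n) u)) 2 volume) ^ 2) ^ ((1 : ℝ) / 2)

/-- The Bourgain norm ‖v‖_{X^{W±}_{σ,b,1}}; `s = ±1`. -/
def XWnorm1 (ψ : ℝ → ℝ) (s σ b : ℝ) (v : SpaceTime → ℂ) : ℝ≥0∞ :=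
  (∑' n : ℕ, ENNReal.ofReal (((2 : ℝ) ^ n) ^ (2 * σ)) *
      (∑' l : ℕ, ENNReal.ofReal (((2 : ℝ) ^ l) ^ b) *
        eLpNorm (WL ψ s ((2 : ℝ) ^ l) (PN ψ ((2 : ℝ) ^ n) v)) 2 volume) ^ 2) ^ ((1 : ℝ) / 2)

section TriBound

/-- The `L²` norm of an `ℝ≥0∞`-valued function. -/
def l2 {α : Type*} [MeasurableSpace α] (μ : Measure α) (f : α → ℝ≥0∞) : ℝ≥0∞ :=
  (∫⁻ x, f x ^ 2 ∂μ) ^ (1 / 2 : ℝ)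

theorem l2_sq {α : Type*} [MeasurableSpace α] (μ : Measure α) (f : α → ℝ≥0∞) :
    l2 μ f ^ 2 = ∫⁻ x, f x ^ 2 ∂μ := by
  rw [l2, ← ENNReal.rpow_natCast, ← ENNReal.rpow_mul]; norm_num

theorem ennreal_le_of_sq_le_sq {a b : ℝ≥0∞} (h : a ^ 2 ≤ b ^ 2) : a ≤ b :=
  (ENNReal.pow_le_pow_left_iff two_ne_zero).1 h

theorem lintegral_mul_le_l2 {α : Type*} [MeasurableSpace α] (μ : Measure α) {f g : α → ℝ≥0∞}
    (hf : Measurable f) (hg : Measurable g) : ∫⁻ x, f x * g x ∂μ ≤ l2 μ f * l2 μ g := by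
  have := ENNReal.lintegral_mul_le_Lp_mul_Lq μ Real.HolderConjugate.two_two hf.aemeasurable
    hg.aemeasurable
  simpa [l2] using this

theorem tsum_mul_le {ι : Type*} (a b : ι → ℝ≥0∞) :
    (∑' i, a i * b i) ^ 2 ≤ (∑' i, a i ^ 2) * ∑' i, b i ^ 2 := by
  let _ : MeasurableSpace ι := ⊤
  have h := lintegral_mul_le_l2 Measure.count (f := a) (g := b) (fun _ _ => trivial)
    (fun _ _ => trivial)
  rw [lintegral_count] at h
  calc _ ≤ (l2 Measure.count a * l2 Measure.count b) ^ 2 := by gcongr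
    _ = _ := by rw [mul_pow, l2_sq, l2_sq, lintegral_count, lintegral_count]

variable {X : Type*} [AddCommGroup X] [MeasurableSpace X]

/-- The trilinear convolution form of nonnegative functions, restricted to a set of pairs. -/
def triForm (μ : Measure X) (E : Set (X × X)) (f g h : X → ℝ≥0∞) : ℝ≥0∞ :=
  ∫⁻ p in E, f (p.1 - p.2) * g p.1 * h p.2 ∂(μ.prod μ)

/-- `L²` boundedness of the trilinear convolution form restricted to a set of pairs. -/
def TriBound (μ : Measure X) (E : Set (X × X)) (B : ℝ≥0∞) : Prop :=
  ∀ f g h : X → ℝ≥0∞, Measurable f → Measurable g → Measurable h →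
    triForm μ E f g h ≤ B * l2 μ f * l2 μ g * l2 μ h

theorem TriBound.mono {μ : Measure X} {E E' : Set (X × X)} {B B' : ℝ≥0∞} (h : TriBound μ E B)
    (hE : E' ⊆ E) (hB : B ≤ B') : TriBound μ E' B' := fun f g k hf hg hk =>
  (lintegral_mono_set hE).trans <| (h f g k hf hg hk).trans <| by gcongr

theorem TriBound.iUnion {μ : Measure X} {ι : Type*} [Countable ι] {E : ι → Set (X × X)}
    {B : ι → ℝ≥0∞} (h : ∀ i, TriBound μ (E i) (B i)) : TriBound μ (⋃ i, E i) (∑' i, B i) := by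
  intro f g k hf hg hk
  refine (lintegral_iUnion_le _ _).trans ?_
  rw [← ENNReal.tsum_mul_right, ← ENNReal.tsum_mul_right, ← ENNReal.tsum_mul_right]
  exact ENNReal.tsum_le_tsum fun i => h i f g k hf hg hk

theorem TriBound.union {μ : Measure X} {E E' : Set (X × X)} {B B' : ℝ≥0∞} (h : TriBound μ E B)
    (h' : TriBound μ E' B') : TriBound μ (E ∪ E') (B + B') := by
  intro f g k hf hg hk
  refine (lintegral_union_le _ _ _).trans ?_
  rw [add_mul, add_mul, add_mul]
  exact add_le_add (h f g k hf hg hk) (h' f g k hf hg hk)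

theorem l2_comp_neg [MeasurableNeg X] {μ : Measure X} [μ.IsNegInvariant] (f : X → ℝ≥0∞) :
    l2 μ (fun x => f (-x)) = l2 μ f := by
  unfold l2
  rw [lintegral_neg_eq_self (μ := μ) (fun x => f x ^ 2)]

variable [MeasurableAdd₂ X] [MeasurableNeg X] [MeasurableSub₂ X]
  {μ : Measure X} [SFinite μ]

omit [MeasurableAdd₂ X] [MeasurableNeg X] [MeasurableSub₂ X] in
theorem triForm_swap [μ.IsNegInvariant] {E : Set (X × X)} (hE : MeasurableSet E)
    (f g h : X → ℝ≥0∞) :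
    triForm μ (Prod.swap ⁻¹' E) (fun x => f (-x)) h g = triForm μ E f g h := by
  unfold triForm
  rw [← lintegral_indicator hE, ← lintegral_indicator (measurable_swap hE),
    ← lintegral_prod_swap]
  refine lintegral_congr fun p => ?_
  by_cases hp : p ∈ E
  · rw [Set.indicator_of_mem hp, Set.indicator_of_mem (by simpa using hp)]
    simp [mul_right_comm]
  · rw [Set.indicator_of_notMem hp, Set.indicator_of_notMem (by simpa using hp)]

omit [MeasurableAdd₂ X] [MeasurableSub₂ X] in
theorem TriBound.swap [μ.IsNegInvariant] {E : Set (X × X)} (hE : MeasurableSet E) {B : ℝ≥0∞}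
    (h : TriBound μ E B) : TriBound μ (Prod.swap ⁻¹' E) B := by
  intro f g k hf hg hk
  have h1 := triForm_swap (μ := μ) hE (fun x => f (-x)) k g
  simp only [neg_neg] at h1
  rw [h1]
  refine (h _ k g (hf.comp measurable_neg) hk hg).trans (le_of_eq ?_)
  rw [show f ∘ Neg.neg = fun x => f (-x) from rfl, l2_comp_neg]; ring

omit [AddCommGroup X] [MeasurableAdd₂ X] [MeasurableNeg X] [MeasurableSub₂ X] [SFinite μ] in
theorem tsum_l2_indicator_sq_le {ι : Type*} [Countable ι] {A : ι → Set X}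
    (hA : ∀ i, MeasurableSet (A i)) (hd : Pairwise (Function.onFun Disjoint A)) (g : X → ℝ≥0∞) :
    ∑' i, l2 μ ((A i).indicator g) ^ 2 ≤ l2 μ g ^ 2 := by
  have : ∀ i, l2 μ ((A i).indicator g) ^ 2 = ∫⁻ x in A i, g x ^ 2 ∂μ := fun i => by
    rw [l2_sq, ← lintegral_indicator (hA i)]
    refine lintegral_congr fun x => ?_
    by_cases hx : x ∈ A i <;> simp [hx]
  simp only [this]
  rw [← lintegral_iUnion hA hd, l2_sq]
  exact setLIntegral_le_lintegral _ _

omit [MeasurableAdd₂ X] [MeasurableNeg X] [SFinite μ] in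
theorem TriBound.of_blocks {ι : Type*} [Countable ι] {E : Set (X × X)} {A A' : ι → Set X}
    (hA : ∀ i, MeasurableSet (A i)) (hA' : ∀ i, MeasurableSet (A' i))
    (hd : Pairwise (Function.onFun Disjoint A)) (hd' : Pairwise (Function.onFun Disjoint A'))
    (hE : E ⊆ ⋃ i, A i ×ˢ A' i) {B : ℝ≥0∞} (h : ∀ i, TriBound μ (E ∩ A i ×ˢ A' i) B) :
    TriBound μ E B := by
  intro f g k hf hg hk
  have h1 : triForm μ E f g k ≤
      ∑' i, B * l2 μ f * (l2 μ ((A i).indicator g) * l2 μ ((A' i).indicator k)) := by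
    have : E ⊆ ⋃ i, E ∩ A i ×ˢ A' i := by
      rw [← Set.inter_iUnion]; exact Set.subset_inter le_rfl hE
    refine (lintegral_mono_set this).trans <| (lintegral_iUnion_le _ _).trans ?_
    refine ENNReal.tsum_le_tsum fun i => ?_
    refine le_trans ?_ ((h i f _ _ hf (hg.indicator (hA i))
      (hk.indicator (hA' i))).trans (le_of_eq (mul_assoc _ _ _)))
    refine setLIntegral_mono (((hf.comp (measurable_fst.sub measurable_snd)).mul
      ((hg.indicator (hA i)).comp measurable_fst)).mul
      ((hk.indicator (hA' i)).comp measurable_snd)) fun p hp => ?_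
    simp [hp.2.1, hp.2.2]
  refine h1.trans ?_
  rw [ENNReal.tsum_mul_left, mul_assoc _ (l2 μ g)]
  gcongr
  refine ennreal_le_of_sq_le_sq ((tsum_mul_le _ _).trans ?_)
  rw [mul_pow]
  gcongr
  · exact tsum_l2_indicator_sq_le hA hd g
  · exact tsum_l2_indicator_sq_le hA' hd' k

omit [MeasurableAdd₂ X] [MeasurableNeg X] [SFinite μ] in
theorem TriBound.of_labels {E : Set (X × X)} {k₁ k₂ : X → ℤ} (h₁ : Measurable k₁)
    (h₂ : Measurable k₂) (hE : ∀ p ∈ E, |k₁ p.1 - k₂ p.2| ≤ 1) {B : ℝ≥0∞}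
    (h : ∀ k k', TriBound μ (E ∩ {p | k₁ p.1 = k ∧ k₂ p.2 = k'}) B) : TriBound μ E (3 * B) := by
  have key : ∀ d : ℤ, TriBound μ {p ∈ E | k₂ p.2 = k₁ p.1 + d} B := fun d => by
    refine TriBound.of_blocks (A := fun k => k₁ ⁻¹' {k}) (A' := fun k => k₂ ⁻¹' {k + d})
      (fun k => h₁ (measurableSet_singleton _)) (fun k => h₂ (measurableSet_singleton _))
      ?_ ?_ ?_ fun k => (h k (k + d)).mono ?_ le_rfl
    · intro a b hab
      exact Disjoint.preimage _ (by simpa using hab)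
    · intro a b hab
      exact Disjoint.preimage _ (by simpa using hab)
    · rintro p ⟨-, hp⟩
      simp [hp]
    · rintro p ⟨⟨hp, -⟩, hp', hp''⟩
      exact ⟨hp, hp', hp''⟩
  refine (((key (-1)).union (key 0)).union (key 1)).mono (fun p hp => ?_) (le_of_eq (by ring))
  have := abs_le.1 (hE p hp)
  rcases (by omega : k₂ p.2 = k₁ p.1 + -1 ∨ k₂ p.2 = k₁ p.1 + 0 ∨ k₂ p.2 = k₁ p.1 + 1)
    with h | h | h
  · exact .inl (.inl ⟨hp, h⟩)
  · exact .inl (.inr ⟨hp, h⟩)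
  · exact .inr ⟨hp, h⟩

variable [μ.IsAddRightInvariant]

theorem triBound_of_measure_fst {E : Set (X × X)} (hE : MeasurableSet E) {B : ℝ≥0∞}
    (h : ∀ x, μ {y | (x, y) ∈ E} ≤ B ^ 2) : TriBound μ E B := by
  intro f g k hf hg hk
  have e : triForm μ E f g k = ∫⁻ p, (f (p.1 - p.2) * k p.2) * (E.indicator (fun p => g p.1) p)
      ∂(μ.prod μ) := by
    unfold triForm
    rw [← lintegral_indicator hE]
    refine lintegral_congr fun p => ?_
    by_cases hp : p ∈ E
    · simp [hp, mul_right_comm]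
    · simp [hp]
  rw [e]
  have m1 : Measurable fun p : X × X => f (p.1 - p.2) * k p.2 :=
    (hf.comp (measurable_fst.sub measurable_snd)).mul (hk.comp measurable_snd)
  have m2 : Measurable (E.indicator (fun p : X × X => g p.1)) :=
    (hg.comp measurable_fst).indicator hE
  refine (lintegral_mul_le_l2 _ m1 m2).trans ?_
  refine ennreal_le_of_sq_le_sq ?_
  simp only [mul_pow, l2_sq]
  have i1 : ∫⁻ p, f (p.1 - p.2) ^ 2 * k p.2 ^ 2 ∂(μ.prod μ) =
      (∫⁻ x, f x ^ 2 ∂μ) * ∫⁻ x, k x ^ 2 ∂μ := by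
    have m3 : Measurable fun p : X × X => f (p.1 - p.2) ^ 2 * k p.2 ^ 2 :=
      ((hf.comp (measurable_fst.sub measurable_snd)).pow_const 2).mul
        ((hk.comp measurable_snd).pow_const 2)
    rw [lintegral_prod_symm _ m3.aemeasurable]
    have : ∀ y, ∫⁻ x, f (x - y) ^ 2 * k y ^ 2 ∂μ = (∫⁻ x, f x ^ 2 ∂μ) * k y ^ 2 := by
      intro y
      rw [lintegral_mul_const _ (by fun_prop), lintegral_sub_right_eq_self (fun x => f x ^ 2) y]
    simp only [this]
    rw [lintegral_const_mul _ (by fun_prop)]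
  have i2 : ∫⁻ p, E.indicator (fun p => g p.1) p ^ 2 ∂(μ.prod μ) ≤
      B ^ 2 * ∫⁻ x, g x ^ 2 ∂μ := by
    rw [lintegral_prod _ (m2.pow_const 2).aemeasurable, ← lintegral_const_mul _ (by fun_prop)]
    refine lintegral_mono fun x => ?_
    calc ∫⁻ y, E.indicator (fun p => g p.1) (x, y) ^ 2 ∂μ
        = ∫⁻ y, {y | (x, y) ∈ E}.indicator (fun _ => g x ^ 2) y ∂μ := by
          refine lintegral_congr fun y => ?_
          by_cases hp : (x, y) ∈ E <;> simp [hp]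
      _ = g x ^ 2 * μ {y | (x, y) ∈ E} := lintegral_indicator_const (measurable_prodMk_left hE) _
      _ ≤ B ^ 2 * g x ^ 2 := by rw [mul_comm]; gcongr; exact h x
  calc _ ≤ ((∫⁻ x, f x ^ 2 ∂μ) * ∫⁻ x, k x ^ 2 ∂μ) * (B ^ 2 * ∫⁻ x, g x ^ 2 ∂μ) := by
        rw [i1]; gcongr
    _ = _ := by ring

omit [MeasurableNeg X] [MeasurableSub₂ X] in
theorem lintegral_prod_diff {F : X × X → ℝ≥0∞} (hF : Measurable F) :
    ∫⁻ p, F p ∂(μ.prod μ) = ∫⁻ z, ∫⁻ y, F (z + y, y) ∂μ ∂μ := by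
  rw [lintegral_prod_symm _ hF.aemeasurable]
  have : ∀ y, ∫⁻ x, F (x, y) ∂μ = ∫⁻ z, F (z + y, y) ∂μ := fun y =>
    (lintegral_add_right_eq_self (fun x => F (x, y)) y).symm
  simp only [this]
  rw [lintegral_lintegral_swap]
  exact (hF.comp ((measurable_snd.add measurable_fst).prodMk measurable_fst)).aemeasurable

omit [MeasurableNeg X] in
theorem triBound_of_measure_diff {E : Set (X × X)} (hE : MeasurableSet E) {B : ℝ≥0∞}
    (h : ∀ z, μ {y | (z + y, y) ∈ E} ≤ B ^ 2) : TriBound μ E B := by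
  intro f g k hf hg hk
  have e : triForm μ E f g k = ∫⁻ p, (g p.1 * k p.2) *
      (E.indicator (fun p => f (p.1 - p.2)) p) ∂(μ.prod μ) := by
    unfold triForm
    rw [← lintegral_indicator hE]
    refine lintegral_congr fun p => ?_
    by_cases hp : p ∈ E
    · simp only [hp, Set.indicator_of_mem]; ring
    · simp [hp]
  rw [e]
  have m1 : Measurable fun p : X × X => g p.1 * k p.2 :=
    (hg.comp measurable_fst).mul (hk.comp measurable_snd)
  have m2 : Measurable (E.indicator (fun p : X × X => f (p.1 - p.2))) :=
    (hf.comp (measurable_fst.sub measurable_snd)).indicator hE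
  refine (lintegral_mul_le_l2 _ m1 m2).trans ?_
  refine ennreal_le_of_sq_le_sq ?_
  simp only [mul_pow, l2_sq]
  have i1 : ∫⁻ p, g p.1 ^ 2 * k p.2 ^ 2 ∂(μ.prod μ) =
      (∫⁻ x, g x ^ 2 ∂μ) * ∫⁻ x, k x ^ 2 ∂μ :=
    lintegral_prod_mul (hg.pow_const 2).aemeasurable (hk.pow_const 2).aemeasurable
  have i2 : ∫⁻ p, E.indicator (fun p => f (p.1 - p.2)) p ^ 2 ∂(μ.prod μ) ≤
      B ^ 2 * ∫⁻ x, f x ^ 2 ∂μ := by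
    rw [lintegral_prod_diff (m2.pow_const 2), ← lintegral_const_mul _ (by fun_prop)]
    refine lintegral_mono fun z => ?_
    calc ∫⁻ y, E.indicator (fun p => f (p.1 - p.2)) (z + y, y) ^ 2 ∂μ
        = ∫⁻ y, {y | (z + y, y) ∈ E}.indicator (fun _ => f z ^ 2) y ∂μ := by
          refine lintegral_congr fun y => ?_
          by_cases hp : (z + y, y) ∈ E <;> simp [hp]
      _ = f z ^ 2 * μ {y | (z + y, y) ∈ E} := lintegral_indicator_const
          (((measurable_const_add z).prodMk measurable_id) hE) _
      _ ≤ B ^ 2 * f z ^ 2 := by rw [mul_comm]; gcongr; exact h z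
  calc _ ≤ ((∫⁻ x, g x ^ 2 ∂μ) * ∫⁻ x, k x ^ 2 ∂μ) * (B ^ 2 * ∫⁻ x, f x ^ 2 ∂μ) := by
        rw [i1]; gcongr
    _ = _ := by ring


omit [MeasurableNeg X] in
theorem TriBound.of_boxes {ι : Type*} [Countable ι] [MeasurableSpace ι]
    [MeasurableSingletonClass ι] {E : Set (X × X)} (hE : MeasurableSet E) {Q : X → ι}
    (hQ : Measurable Q) {B : ℝ≥0∞} (h : ∀ x q, μ {y | (x, y) ∈ E ∧ Q y = q} ≤ B ^ 2) {C : ℕ}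
    (hC : ∀ z, ∃ T : Finset ι, T.card ≤ C ∧ ∀ y, (z + y, y) ∈ E → Q y ∈ T) :
    TriBound μ E (B * C) := by
  intro f g k hf hg hk
  set A : ι → Set X := fun q => Q ⁻¹' {q} with hA_def
  have hA : ∀ q, MeasurableSet (A q) := fun q => hQ (measurableSet_singleton _)
  have hAd : Pairwise (Function.onFun Disjoint A) := fun a b hab =>
    Disjoint.preimage _ (by simpa using hab)
  have mE : ∀ q, MeasurableSet (E ∩ Prod.snd ⁻¹' A q) := fun q =>
    hE.inter (measurable_snd (hA q))
  let m : ι → X → ℝ≥0∞ := fun q z =>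
    ∫⁻ y, (E ∩ Prod.snd ⁻¹' A q).indicator (fun p => k p.2 ^ 2) (z + y, y) ∂μ
  have mind : ∀ q, Measurable ((E ∩ Prod.snd ⁻¹' A q).indicator (fun p => k p.2 ^ 2)) :=
    fun q => ((hk.comp measurable_snd).pow_const 2).indicator (mE q)
  have hm : ∀ q, Measurable (m q) := fun q => by
    have : Measurable fun p : X × X => (E ∩ Prod.snd ⁻¹' A q).indicator
        (fun p => k p.2 ^ 2) (p.1 + p.2, p.2) :=
      (mind q).comp ((measurable_fst.add measurable_snd).prodMk measurable_snd)
    exact this.lintegral_prod_right'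
  let F : ι → Set X := fun q => {z | m q z ≠ 0}
  have hF : ∀ q, MeasurableSet (F q) := fun q => hm q (measurableSet_singleton 0).compl
  have hmF : ∀ q z, m q z ≤ (F q).indicator (fun _ => l2 μ ((A q).indicator k) ^ 2) z := by
    intro q z
    by_cases hz : m q z = 0
    · simp [hz]
    · rw [Set.indicator_of_mem (show z ∈ F q from hz), l2_sq]
      refine lintegral_mono fun y => ?_
      by_cases hy : (z + y, y) ∈ E ∩ Prod.snd ⁻¹' A q
      · have : y ∈ A q := hy.2
        simp [hy, this]
      · simp [hy]
  have hcount : ∀ z, ∑' q, (F q).indicator (fun _ => (1 : ℝ≥0∞)) z ≤ C := by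
    intro z
    obtain ⟨T, hT, hT'⟩ := hC z
    calc ∑' q, (F q).indicator (fun _ => (1 : ℝ≥0∞)) z
        ≤ ∑' q, (T : Set ι).indicator (fun _ => (1 : ℝ≥0∞)) q := by
          refine ENNReal.tsum_le_tsum fun q => ?_
          by_cases hq : q ∈ (T : Set ι)
          · rw [Set.indicator_of_mem hq]
            exact Set.indicator_le_self' (fun _ _ => zero_le) z
          · have : m q z = 0 := by
              refine lintegral_eq_zero_of_ae_eq_zero (Filter.Eventually.of_forall fun y => ?_)
              refine Set.indicator_of_notMem (fun hy => hq ?_) _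
              have h2 : Q y = q := hy.2
              exact h2 ▸ hT' y hy.1
            simp [F, this]
      _ = T.card := by
          rw [← tsum_subtype, Finset.tsum_subtype' T (fun _ => (1 : ℝ≥0∞))]
          simp
      _ ≤ C := by exact_mod_cast hT
  have bound : ∀ q, triForm μ (E ∩ Prod.snd ⁻¹' A q) f g k ≤
      B * l2 μ g * (l2 μ ((A q).indicator k) * l2 μ ((F q).indicator f)) := by
    intro q
    have e : triForm μ (E ∩ Prod.snd ⁻¹' A q) f g k =
        ∫⁻ p, (f (p.1 - p.2) * (E ∩ Prod.snd ⁻¹' A q).indicator (fun p => k p.2) p) *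
          ((E ∩ Prod.snd ⁻¹' A q).indicator (fun p => g p.1) p) ∂(μ.prod μ) := by
      unfold triForm
      rw [← lintegral_indicator (mE q)]
      refine lintegral_congr fun p => ?_
      by_cases hp : p ∈ E ∩ Prod.snd ⁻¹' A q
      · simp only [hp, Set.indicator_of_mem]; ring
      · simp [hp]
    rw [e]
    have m1 : Measurable fun p : X × X => f (p.1 - p.2) *
        (E ∩ Prod.snd ⁻¹' A q).indicator (fun p => k p.2) p :=
      (hf.comp (measurable_fst.sub measurable_snd)).mul
        ((hk.comp measurable_snd).indicator (mE q))
    have m2 : Measurable ((E ∩ Prod.snd ⁻¹' A q).indicator (fun p : X × X => g p.1)) :=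
      (hg.comp measurable_fst).indicator (mE q)
    refine (lintegral_mul_le_l2 _ m1 m2).trans (ennreal_le_of_sq_le_sq ?_)
    rw [mul_pow, l2_sq, l2_sq]
    have i1 : ∫⁻ p, (f (p.1 - p.2) *
        (E ∩ Prod.snd ⁻¹' A q).indicator (fun p => k p.2) p) ^ 2 ∂(μ.prod μ) ≤
        l2 μ ((A q).indicator k) ^ 2 * l2 μ ((F q).indicator f) ^ 2 := by
      rw [lintegral_prod_diff (m1.pow_const 2), l2_sq μ ((F q).indicator f),
        ← lintegral_const_mul _ ((hf.indicator (hF q)).pow_const 2)]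
      refine lintegral_mono fun z => ?_
      calc _ = ∫⁻ y, f z ^ 2 *
            (E ∩ Prod.snd ⁻¹' A q).indicator (fun p => k p.2 ^ 2) (z + y, y) ∂μ := by
            refine lintegral_congr fun y => ?_
            by_cases hy : (z + y, y) ∈ E ∩ Prod.snd ⁻¹' A q
            · simp [hy, mul_pow]
            · simp [hy]
        _ = f z ^ 2 * m q z := lintegral_const_mul _ ((mind q).comp
            ((measurable_const_add z).prodMk measurable_id))
        _ ≤ f z ^ 2 * (F q).indicator (fun _ => l2 μ ((A q).indicator k) ^ 2) z := by
            gcongr; exact hmF q z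
        _ = _ := by
            by_cases hz : z ∈ F q
            · simp [hz, mul_comm]
            · simp [hz]
    have i2 : ∫⁻ p, (E ∩ Prod.snd ⁻¹' A q).indicator (fun p => g p.1) p ^ 2 ∂(μ.prod μ) ≤
        B ^ 2 * l2 μ g ^ 2 := by
      rw [l2_sq, lintegral_prod _ (m2.pow_const 2).aemeasurable,
        ← lintegral_const_mul _ (by fun_prop)]
      refine lintegral_mono fun x => ?_
      calc ∫⁻ y, (E ∩ Prod.snd ⁻¹' A q).indicator (fun p => g p.1) (x, y) ^ 2 ∂μ
          = ∫⁻ y, {y | (x, y) ∈ E ∧ Q y = q}.indicator (fun _ => g x ^ 2) y ∂μ := by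
            refine lintegral_congr fun y => ?_
            by_cases hp : (x, y) ∈ E ∧ Q y = q
            · have : (x, y) ∈ E ∩ Prod.snd ⁻¹' A q := hp
              simp [hp, this]
            · have : (x, y) ∉ E ∩ Prod.snd ⁻¹' A q := hp
              simp [hp, this]
        _ = g x ^ 2 * μ {y | (x, y) ∈ E ∧ Q y = q} :=
            lintegral_indicator_const (measurable_prodMk_left (mE q)) _
        _ ≤ B ^ 2 * g x ^ 2 := by rw [mul_comm]; gcongr; exact h x q
    calc _ ≤ (l2 μ ((A q).indicator k) ^ 2 * l2 μ ((F q).indicator f) ^ 2) *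
          (B ^ 2 * l2 μ g ^ 2) := by gcongr
      _ = _ := by ring
  have sumF : ∑' q, l2 μ ((F q).indicator f) ^ 2 ≤ C * l2 μ f ^ 2 := by
    simp only [l2_sq]
    rw [← lintegral_tsum fun q => ((hf.indicator (hF q)).pow_const 2).aemeasurable,
      ← lintegral_const_mul _ (hf.pow_const 2)]
    refine lintegral_mono fun z => ?_
    calc ∑' q, (F q).indicator f z ^ 2
        = ∑' q, (F q).indicator (fun _ => (1 : ℝ≥0∞)) z * f z ^ 2 := by
          refine tsum_congr fun q => ?_
          by_cases hz : z ∈ F q <;> simp [hz]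
      _ ≤ C * f z ^ 2 := by rw [ENNReal.tsum_mul_right]; gcongr; exact hcount z
  have hcover : E ⊆ ⋃ q, E ∩ Prod.snd ⁻¹' A q := fun p hp =>
    Set.mem_iUnion.2 ⟨Q p.2, hp, rfl⟩
  calc triForm μ E f g k ≤ ∑' q, triForm μ (E ∩ Prod.snd ⁻¹' A q) f g k :=
        (lintegral_mono_set hcover).trans (lintegral_iUnion_le _ _)
    _ ≤ ∑' q, B * l2 μ g * (l2 μ ((A q).indicator k) * l2 μ ((F q).indicator f)) :=
        ENNReal.tsum_le_tsum bound
    _ = B * l2 μ g * ∑' q, (l2 μ ((A q).indicator k) * l2 μ ((F q).indicator f)) :=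
        ENNReal.tsum_mul_left
    _ ≤ B * l2 μ g * (C * l2 μ k * l2 μ f) := by
        gcongr
        refine ennreal_le_of_sq_le_sq ((tsum_mul_le _ _).trans ?_)
        calc _ ≤ l2 μ k ^ 2 * (C * l2 μ f ^ 2) := by
              gcongr; exact tsum_l2_indicator_sq_le hA hAd k
          _ ≤ l2 μ k ^ 2 * (((C : ℝ≥0∞) ^ 2) * l2 μ f ^ 2) := by
              gcongr
              rcases Nat.eq_zero_or_pos C with h0 | h0
              · simp [h0]
              · exact_mod_cast Nat.le_self_pow two_ne_zero C
          _ = _ := by ring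
    _ = _ := by ring

end TriBound

section PlanarMeasure

instance : (volume : Measure (ℂ × ℝ)).IsAddHaarMeasure :=
  inferInstanceAs ((volume : Measure ℂ).prod (volume : Measure ℝ)).IsAddHaarMeasure

theorem volume_le_of_dist_le {S : Set ℝ} {t : ℝ} (h : ∀ x ∈ S, ∀ y ∈ S, |x - y| ≤ t) :
    volume S ≤ ENNReal.ofReal t := by
  refine (Real.volume_le_diam S).trans (Metric.ediam_le fun x hx y hy => ?_)
  rw [edist_dist, Real.dist_eq]
  exact ENNReal.ofReal_le_ofReal (h x hx y hy)

theorem prod_volume_le {α : Type*} [MeasurableSpace α] {μ : Measure α} [SFinite μ]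
    {S : Set (α × ℝ)} (hS : MeasurableSet S) {T : Set α} (hT : ∀ p ∈ S, p.1 ∈ T) {t : ℝ}
    (h : ∀ x τ τ', (x, τ) ∈ S → (x, τ') ∈ S → |τ - τ'| ≤ t) :
    (μ.prod volume) S ≤ μ T * ENNReal.ofReal t := by
  rw [Measure.prod_apply hS, ← measure_toMeasurable T, mul_comm,
    ← lintegral_indicator_const (measurableSet_toMeasurable μ T)]
  refine lintegral_mono fun x => ?_
  by_cases hx : x ∈ toMeasurable μ T
  · rw [Set.indicator_of_mem hx]
    exact volume_le_of_dist_le fun τ hτ τ' hτ' => h x τ τ' hτ hτ'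
  · rw [Set.indicator_of_notMem hx]
    refine le_of_eq (measure_mono_null (t := ∅) (fun τ hτ => ?_) measure_empty)
    exact hx (subset_toMeasurable μ T (hT _ hτ))

theorem complex_volume_le {T : Set ℂ} (hT : MeasurableSet T) {p q : ℝ} (hp : 0 ≤ p)
    (h₁ : ∀ z ∈ T, ∀ z' ∈ T, |z.re - z'.re| ≤ p)
    (h₂ : ∀ z ∈ T, ∀ z' ∈ T, z.re = z'.re → |z.im - z'.im| ≤ q) :
    volume T ≤ ENNReal.ofReal (p * q) := by
  have hS : MeasurableSet (Complex.measurableEquivRealProd.symm ⁻¹' T) :=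
    Complex.measurableEquivRealProd.symm.measurable hT
  rw [← Complex.volume_preserving_equiv_real_prod.symm.measure_preimage_equiv T]
  refine (prod_volume_le hS (T := Complex.re '' T) (fun x hx => ⟨_, hx, rfl⟩) (t := q)
    fun x τ τ' hτ hτ' => h₂ _ hτ _ hτ' rfl).trans ?_
  rw [ENNReal.ofReal_mul hp]
  gcongr
  refine volume_le_of_dist_le ?_
  rintro _ ⟨z, hz, rfl⟩ _ ⟨z', hz', rfl⟩
  exact h₁ z hz z' hz'

theorem complex_volume_le_rotate {T : Set ℂ} (hT : MeasurableSet T) {e : ℂ} (he : ‖e‖ = 1)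
    {p q : ℝ} (hp : 0 ≤ p)
    (h₁ : ∀ z ∈ T, ∀ z' ∈ T, |(z * star e).re - (z' * star e).re| ≤ p)
    (h₂ : ∀ z ∈ T, ∀ z' ∈ T, (z * star e).re = (z' * star e).re →
      |(z * star e).im - (z' * star e).im| ≤ q) :
    volume T ≤ ENNReal.ofReal (p * q) := by
  let c : Circle := ⟨e, by simpa [Submonoid.unitSphere] using he⟩
  have mp := (rotation c).measurePreserving
  have ee : ∀ z : ℂ, rotation c z * star e = z := fun z => by
    have : e * star e = 1 := by
      have := Complex.mul_conj e
      rw [Complex.normSq_eq_norm_sq, he] at this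
      simpa using this
    rw [rotation_apply, mul_right_comm]
    show e * star e * z = z
    rw [this, one_mul]
  rw [← mp.measure_preimage hT.nullMeasurableSet]
  refine complex_volume_le (mp.measurable hT) hp (fun z hz z' hz' => ?_) fun z hz z' hz' => ?_
  · simpa only [ee] using h₁ _ hz _ hz'
  · simpa only [ee] using h₂ _ hz _ hz'

theorem norm_sq_eq_rotate {e : ℂ} (he : ‖e‖ = 1) (z : ℂ) :
    ‖z‖ ^ 2 = (z * star e).re ^ 2 + (z * star e).im ^ 2 := by
  have : ‖z * star e‖ = ‖z‖ := by simp [he]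
  rw [← this, ← Complex.normSq_eq_norm_sq, Complex.normSq_apply]; ring

theorem volume_ring_sector_le {T : Set ℂ} (hT : MeasurableSet T) {e : ℂ} (he : ‖e‖ = 1)
    {r₀ m ℓ : ℝ} (hr : 4 ≤ r₀) (hl : 0 ≤ ℓ) (hm : 0 ≤ m)
    (h₀ : ∀ z ∈ T, r₀ / 2 ≤ |(z * star e).im|)
    (hs : ∀ z ∈ T, ∀ z' ∈ T, 0 ≤ (z * star e).im * (z' * star e).im)
    (h₁ : ∀ z ∈ T, ∀ z' ∈ T, |(z * star e).re - (z' * star e).re| ≤ ℓ)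
    (h₂ : ∀ z ∈ T, ∀ z' ∈ T, |‖z‖ ^ 2 - ‖z'‖ ^ 2| ≤ 2 * m + ‖z - z'‖) :
    volume T ≤ ENNReal.ofReal (ℓ * (4 * m / r₀)) := by
  refine complex_volume_le_rotate hT he hl h₁ fun z hz z' hz' hre => ?_
  have a := h₂ z hz z' hz'
  have b := h₀ z hz
  have b' := h₀ z' hz'
  have c := hs z hz z' hz'
  have d : ‖z - z'‖ = |(z * star e).im - (z' * star e).im| := by
    have := norm_sq_eq_rotate he (z - z')
    rw [sub_mul, Complex.sub_re, Complex.sub_im, hre] at this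
    rw [← abs_of_nonneg (norm_nonneg (z - z'))]
    exact (sq_eq_sq_iff_abs_eq_abs _ _).1 (by linarith)
  rw [norm_sq_eq_rotate he z, norm_sq_eq_rotate he z', hre, d] at a
  set x := (z * star e).im
  set y := (z' * star e).im
  have f : |x + y| = |x| + |y| := (abs_add_eq_add_abs_iff _ _).2 (by
    rcases le_total 0 x with h | h <;> rcases le_total 0 y with h' | h'
    · exact .inl ⟨h, h'⟩
    · have : x * y = 0 := le_antisymm (mul_nonpos_of_nonneg_of_nonpos h h') c
      rcases mul_eq_zero.1 this with h0 | h0 <;> simp [h0] at b b' ⊢ <;> linarith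
    · have : x * y = 0 := le_antisymm (mul_nonpos_of_nonpos_of_nonneg h h') c
      rcases mul_eq_zero.1 this with h0 | h0 <;> simp [h0] at b b' ⊢ <;> linarith
    · exact .inr ⟨h, h'⟩)
  have g : |x - y| * (|x| + |y|) ≤ 2 * m + |x - y| := by
    rw [← f, ← abs_mul]
    refine le_trans (le_of_eq ?_) a
    congr 1; ring
  rw [le_div_iff₀ (by linarith)]
  nlinarith [abs_nonneg (x - y)]

theorem volume_ring_le {T : Set ℂ} (hT : MeasurableSet T)
    {r₀ m ℓ : ℝ} (hr : 4 ≤ r₀) (hl : 0 ≤ ℓ) (hm : 0 ≤ m) (h₀ : ∀ z ∈ T, r₀ ≤ ‖z‖)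
    (h₁ : ∀ z ∈ T, ∀ z' ∈ T, |z.re - z'.re| ≤ ℓ) (h₁' : ∀ z ∈ T, ∀ z' ∈ T, |z.im - z'.im| ≤ ℓ)
    (h₂ : ∀ z ∈ T, ∀ z' ∈ T, |‖z‖ ^ 2 - ‖z'‖ ^ 2| ≤ 2 * m + ‖z - z'‖) :
    volume T ≤ ENNReal.ofReal (16 * ℓ * m / r₀) := by
  have cover : T ⊆ ((T ∩ {z | |z.re| ≤ |z.im| ∧ 0 ≤ z.im}) ∪
      (T ∩ {z | |z.re| ≤ |z.im| ∧ z.im ≤ 0})) ∪ ((T ∩ {z | |z.im| ≤ |z.re| ∧ 0 ≤ z.re}) ∪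
      (T ∩ {z | |z.im| ≤ |z.re| ∧ z.re ≤ 0})) := by
    intro z hz
    rcases le_total |z.re| |z.im| with h | h
    · rcases le_total 0 z.im with h' | h'
      · exact .inl (.inl ⟨hz, h, h'⟩)
      · exact .inl (.inr ⟨hz, h, h'⟩)
    · rcases le_total 0 z.re with h' | h'
      · exact .inr (.inl ⟨hz, h, h'⟩)
      · exact .inr (.inr ⟨hz, h, h'⟩)
  have sz : ∀ z : ℂ, ‖z‖ ^ 2 = z.re ^ 2 + z.im ^ 2 := fun z => by
    rw [← Complex.normSq_eq_norm_sq, Complex.normSq_apply]; ring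
  have big : ∀ z ∈ T, ∀ x y : ℝ, ‖z‖ ^ 2 = x ^ 2 + y ^ 2 → |x| ≤ |y| → r₀ / 2 ≤ |y| := by
    intro z hz x y h h'
    have := h₀ z hz
    by_contra! hc
    have h1 : x ^ 2 ≤ y ^ 2 := sq_le_sq.2 h'
    have h2 : y ^ 2 ≤ (r₀ / 2) ^ 2 := by rw [← sq_abs]; gcongr
    nlinarith
  have c1 : MeasurableSet {z : ℂ | |z.re| ≤ |z.im| ∧ 0 ≤ z.im} := by measurability
  have c2 : MeasurableSet {z : ℂ | |z.re| ≤ |z.im| ∧ z.im ≤ 0} := by measurability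
  have c3 : MeasurableSet {z : ℂ | |z.im| ≤ |z.re| ∧ 0 ≤ z.re} := by measurability
  have c4 : MeasurableSet {z : ℂ | |z.im| ≤ |z.re| ∧ z.re ≤ 0} := by measurability
  have hI : ∀ z : ℂ, (z * star (1 : ℂ)).im = z.im ∧ (z * star (1 : ℂ)).re = z.re := by simp
  have hJ : ∀ z : ℂ, (z * star Complex.I).im = -z.re ∧ (z * star Complex.I).re = z.im := by simp
  refine (measure_mono cover).trans <| (measure_union_le _ _).trans <|
    (add_le_add (measure_union_le _ _) (measure_union_le _ _)).trans ?_
  have b1 := volume_ring_sector_le (hT.inter c1) (e := 1) (by simp) hr hl hm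
    (by rintro z ⟨hz, h, h'⟩; rw [(hI z).1]; exact big z hz _ _ (sz z) h)
    (by rintro z ⟨hz, h, h'⟩ z' ⟨hz', k, k'⟩; rw [(hI z).1, (hI z').1]; exact mul_nonneg h' k')
    (by rintro z ⟨hz, h, h'⟩ z' ⟨hz', k, k'⟩; rw [(hI z).2, (hI z').2]; exact h₁ z hz z' hz')
    (fun z hz z' hz' => h₂ z hz.1 z' hz'.1)
  have b2 := volume_ring_sector_le (hT.inter c2) (e := 1) (by simp) hr hl hm
    (by rintro z ⟨hz, h, h'⟩; rw [(hI z).1]; exact big z hz _ _ (sz z) h)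
    (by rintro z ⟨hz, h, h'⟩ z' ⟨hz', k, k'⟩; rw [(hI z).1, (hI z').1]
        exact mul_nonneg_of_nonpos_of_nonpos h' k')
    (by rintro z ⟨hz, h, h'⟩ z' ⟨hz', k, k'⟩; rw [(hI z).2, (hI z').2]; exact h₁ z hz z' hz')
    (fun z hz z' hz' => h₂ z hz.1 z' hz'.1)
  have b3 := volume_ring_sector_le (hT.inter c3) (e := Complex.I) (by simp) hr hl hm
    (by rintro z ⟨hz, h, h'⟩; rw [(hJ z).1, abs_neg]
        exact big z hz _ _ ((sz z).trans (add_comm _ _)) h)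
    (by rintro z ⟨hz, h, h'⟩ z' ⟨hz', k, k'⟩; rw [(hJ z).1, (hJ z').1, neg_mul_neg]
        exact mul_nonneg h' k')
    (by rintro z ⟨hz, h, h'⟩ z' ⟨hz', k, k'⟩; rw [(hJ z).2, (hJ z').2]; exact h₁' z hz z' hz')
    (fun z hz z' hz' => h₂ z hz.1 z' hz'.1)
  have b4 := volume_ring_sector_le (hT.inter c4) (e := Complex.I) (by simp) hr hl hm
    (by rintro z ⟨hz, h, h'⟩; rw [(hJ z).1, abs_neg]
        exact big z hz _ _ ((sz z).trans (add_comm _ _)) h)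
    (by rintro z ⟨hz, h, h'⟩ z' ⟨hz', k, k'⟩; rw [(hJ z).1, (hJ z').1, neg_mul_neg]
        exact mul_nonneg_of_nonpos_of_nonpos h' k')
    (by rintro z ⟨hz, h, h'⟩ z' ⟨hz', k, k'⟩; rw [(hJ z).2, (hJ z').2]; exact h₁' z hz z' hz')
    (fun z hz z' hz' => h₂ z hz.1 z' hz'.1)
  refine (add_le_add (add_le_add b1 b2) (add_le_add b3 b4)).trans (le_of_eq ?_)
  have : 0 ≤ ℓ * (4 * m / r₀) := by positivity
  rw [← ENNReal.ofReal_add this this, ← ENNReal.ofReal_add (by positivity) (by positivity)]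
  congr 1; ring

end PlanarMeasure

section ModulationSets

/-- Square-normalised `L²` boundedness of the restricted trilinear form on `ℂ × ℝ`. -/
def SqBound (E : Set ((ℂ × ℝ) × (ℂ × ℝ))) (x : ℝ) : Prop :=
  TriBound (volume : Measure (ℂ × ℝ)) E (ENNReal.ofReal (√x))

theorem SqBound.mono {E E' : Set ((ℂ × ℝ) × (ℂ × ℝ))} {x x' : ℝ} (h : SqBound E x)
    (hE : E' ⊆ E) (hx : x ≤ x') : SqBound E' x' :=
  TriBound.mono h hE (ENNReal.ofReal_le_ofReal (Real.sqrt_le_sqrt hx))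

theorem SqBound.union {E E' : Set ((ℂ × ℝ) × (ℂ × ℝ))} {x x' : ℝ} (h : SqBound E x)
    (h' : SqBound E' x') : SqBound (E ∪ E') (2 * (max x 0 + max x' 0)) := by
  refine (TriBound.union (h.mono le_rfl (le_max_left x 0))
    (h'.mono le_rfl (le_max_left x' 0))).mono le_rfl ?_
  rw [← ENNReal.ofReal_add (Real.sqrt_nonneg _) (Real.sqrt_nonneg _)]
  refine ENNReal.ofReal_le_ofReal (Real.le_sqrt_of_sq_le ?_)
  have h1 := Real.sq_sqrt (le_max_right x 0)
  have h2 := Real.sq_sqrt (le_max_right x' 0)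
  nlinarith [sq_nonneg (√(max x 0) - √(max x' 0))]

theorem sq_ofReal_sqrt {x : ℝ} (hx : 0 ≤ x) : ENNReal.ofReal (√x) ^ 2 = ENNReal.ofReal x := by
  rw [← ENNReal.ofReal_pow (Real.sqrt_nonneg _), Real.sq_sqrt hx]

theorem SqBound.of_fst {E : Set ((ℂ × ℝ) × (ℂ × ℝ))} (hE : MeasurableSet E) {x : ℝ} (hx : 0 ≤ x)
    (h : ∀ a, volume {y | (a, y) ∈ E} ≤ ENNReal.ofReal x) : SqBound E x :=
  triBound_of_measure_fst hE fun a => by rw [sq_ofReal_sqrt hx]; exact h a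

theorem SqBound.of_diff {E : Set ((ℂ × ℝ) × (ℂ × ℝ))} (hE : MeasurableSet E) {x : ℝ} (hx : 0 ≤ x)
    (h : ∀ z, volume {y | (z + y, y) ∈ E} ≤ ENNReal.ofReal x) : SqBound E x :=
  triBound_of_measure_diff hE fun a => by rw [sq_ofReal_sqrt hx]; exact h a

theorem SqBound.of_swap {E : Set ((ℂ × ℝ) × (ℂ × ℝ))} (hE : MeasurableSet E) {x : ℝ}
    (h : SqBound (Prod.swap ⁻¹' E) x) : SqBound E x := by
  simpa [SqBound, ← Set.preimage_comp] using TriBound.swap (measurable_swap hE) h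

theorem SqBound.of_labels {E : Set ((ℂ × ℝ) × (ℂ × ℝ))} {k₁ k₂ : ℂ × ℝ → ℤ}
    (h₁ : Measurable k₁) (h₂ : Measurable k₂) (hE : ∀ p ∈ E, |k₁ p.1 - k₂ p.2| ≤ 1) {x : ℝ}
    (h : ∀ k k', SqBound (E ∩ {p | k₁ p.1 = k ∧ k₂ p.2 = k'}) x) : SqBound E (9 * x) := by
  refine (TriBound.of_labels h₁ h₂ hE h).mono le_rfl (le_of_eq ?_)
  rw [Real.sqrt_mul (by norm_num), ENNReal.ofReal_mul (by positivity),
    show (9 : ℝ) = 3 ^ 2 by norm_num, Real.sqrt_sq (by norm_num)]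
  norm_num

theorem SqBound.of_boxes {ι : Type*} [Countable ι] [MeasurableSpace ι]
    [MeasurableSingletonClass ι] {E : Set ((ℂ × ℝ) × (ℂ × ℝ))} (hE : MeasurableSet E)
    {Q : ℂ × ℝ → ι} (hQ : Measurable Q) {x : ℝ} (hx : 0 ≤ x)
    (h : ∀ a q, volume {y | (a, y) ∈ E ∧ Q y = q} ≤ ENNReal.ofReal x) {C : ℕ}
    (hC : ∀ z, ∃ T : Finset ι, T.card ≤ C ∧ ∀ y, (z + y, y) ∈ E → Q y ∈ T) :
    SqBound E (C ^ 2 * x) := by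
  refine (TriBound.of_boxes hE hQ (B := ENNReal.ofReal (√x))
    (fun a q => by rw [sq_ofReal_sqrt hx]; exact h a q) hC).mono le_rfl (le_of_eq ?_)
  rw [Real.sqrt_mul (by positivity), Real.sqrt_sq (by positivity),
    ENNReal.ofReal_mul (by positivity), mul_comm]
  simp

/-- Pairs of frequencies whose three modulations are at most `2 * L₁`, `2 * L₂`, `2 * L`. -/
def modSet (s L₁ L₂ L : ℝ) : Set ((ℂ × ℝ) × (ℂ × ℝ)) :=
  {p | |p.1.2 + ‖p.1.1‖ ^ 2| ≤ 2 * L₁ ∧ |p.2.2 + ‖p.2.1‖ ^ 2| ≤ 2 * L₂ ∧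
    |p.1.2 - p.2.2 + s * ‖p.1.1 - p.2.1‖| ≤ 2 * L}

theorem swap_subset_modSet {E : Set ((ℂ × ℝ) × (ℂ × ℝ))} {s L₁ L₂ L : ℝ}
    (h : E ⊆ modSet s L₁ L₂ L) : Prod.swap ⁻¹' E ⊆ modSet (-s) L₂ L₁ L := by
  rintro ⟨x, y⟩ hp
  obtain ⟨h1, h2, h3⟩ := h hp
  refine ⟨h2, h1, ?_⟩
  simp only [Prod.swap] at h3 ⊢
  rw [norm_sub_rev, ← abs_neg]
  refine le_trans (le_of_eq ?_) h3
  congr 1; ring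

variable {E : Set ((ℂ × ℝ) × (ℂ × ℝ))} {s L₁ L₂ L : ℝ}

theorem volume_fiber_fst_le (hE : MeasurableSet E) (h : E ⊆ modSet s L₁ L₂ L) (a : ℂ × ℝ)
    {T : Set ℂ} (hT : ∀ y, (a, y) ∈ E → y.1 ∈ T) :
    volume {y | (a, y) ∈ E} ≤ volume T * ENNReal.ofReal (4 * min L₂ L) := by
  refine prod_volume_le (measurable_prodMk_left hE) (fun p hp => hT p hp) ?_
  intro x τ τ' hτ hτ'
  obtain ⟨-, h2, h3⟩ := h hτ
  obtain ⟨-, h2', h3'⟩ := h hτ'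
  simp only [abs_le] at *
  rcases min_choice L₂ L with h | h <;> rw [h] <;> constructor <;> linarith

theorem volume_fiber_diff_le (hE : MeasurableSet E) (h : E ⊆ modSet s L₁ L₂ L) (z : ℂ × ℝ)
    {T : Set ℂ} (hT : ∀ y, (z + y, y) ∈ E → y.1 ∈ T) :
    volume {y | (z + y, y) ∈ E} ≤ volume T * ENNReal.ofReal (4 * min L₁ L₂) := by
  refine prod_volume_le (((measurable_const_add z).prodMk measurable_id) hE)
    (fun p hp => hT p hp) ?_
  intro x τ τ' hτ hτ'
  obtain ⟨h2, h3, -⟩ := h hτ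
  obtain ⟨h2', h3', -⟩ := h hτ'
  simp only [abs_le, Prod.fst_add, Prod.snd_add, id] at *
  rcases min_choice L₁ L₂ with h | h <;> rw [h] <;> constructor <;> linarith

theorem volume_closedBall_le (c : ℂ) {ρ : ℝ} (hρ : 0 ≤ ρ) :
    volume (Metric.closedBall c ρ) ≤ ENNReal.ofReal (4 * ρ ^ 2) := by
  have h : ∀ z ∈ Metric.closedBall c ρ, ∀ z' ∈ Metric.closedBall c ρ, ‖z - z'‖ ≤ 2 * ρ := by
    intro z hz z' hz'
    rw [Metric.mem_closedBall] at hz hz'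
    rw [← dist_eq_norm]
    linarith [dist_triangle_right z z' c]
  refine (complex_volume_le Metric.isClosed_closedBall.measurableSet (p := 2 * ρ) (q := 2 * ρ)
    (by positivity) (fun z hz z' hz' => ?_) fun z hz z' hz' _ => ?_).trans
    (le_of_eq (by congr 1; ring))
  · exact (Complex.abs_re_le_norm (z - z')).trans (h z hz z' hz')
  · exact (Complex.abs_im_le_norm (z - z')).trans (h z hz z' hz')

theorem SqBound.of_fst_area (hE : MeasurableSet E) (h : E ⊆ modSet s L₁ L₂ L) (h₂ : 0 ≤ L₂)
    (h₃ : 0 ≤ L) {A : ℝ} (hA : 0 ≤ A)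
    (hT : ∀ a, ∃ T : Set ℂ, (∀ y, (a, y) ∈ E → y.1 ∈ T) ∧ volume T ≤ ENNReal.ofReal A) :
    SqBound E (4 * A * min L₂ L) := by
  refine SqBound.of_fst hE (by positivity) fun a => ?_
  obtain ⟨T, hT1, hT2⟩ := hT a
  refine (volume_fiber_fst_le hE h a hT1).trans ?_
  rw [show 4 * A * min L₂ L = A * (4 * min L₂ L) by ring, ENNReal.ofReal_mul hA]
  gcongr

theorem SqBound.of_diff_area (hE : MeasurableSet E) (h : E ⊆ modSet s L₁ L₂ L) (h₁ : 0 ≤ L₁)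
    (h₂ : 0 ≤ L₂) {A : ℝ} (hA : 0 ≤ A)
    (hT : ∀ z, ∃ T : Set ℂ, (∀ y, (z + y, y) ∈ E → y.1 ∈ T) ∧ volume T ≤ ENNReal.ofReal A) :
    SqBound E (4 * A * min L₁ L₂) := by
  refine SqBound.of_diff hE (by positivity) fun a => ?_
  obtain ⟨T, hT1, hT2⟩ := hT a
  refine (volume_fiber_diff_le hE h a hT1).trans ?_
  rw [show 4 * A * min L₁ L₂ = A * (4 * min L₁ L₂) by ring, ENNReal.ofReal_mul hA]
  gcongr

theorem SqBound.of_norm_fst_le (hE : MeasurableSet E) (h : E ⊆ modSet s L₁ L₂ L) (h₁ : 0 ≤ L₁)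
    (h₂ : 0 ≤ L₂) (h₃ : 0 ≤ L) {ρ : ℝ} (hρ : 0 ≤ ρ) (hb : ∀ p ∈ E, ‖p.1.1‖ ≤ ρ) :
    SqBound E (16 * ρ ^ 2 * min (min L₁ L₂) L) := by
  have a1 : SqBound E (4 * (4 * ρ ^ 2) * min L₁ L₂) := by
    refine SqBound.of_diff_area hE h h₁ h₂ (by positivity) fun z =>
      ⟨Metric.closedBall (-z.1) ρ, fun y hy => ?_, volume_closedBall_le _ hρ⟩
    have := hb _ hy
    rw [Metric.mem_closedBall, dist_eq_norm, sub_neg_eq_add, add_comm]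
    exact this
  have a2 : SqBound E (4 * (4 * ρ ^ 2) * min L₁ L) := by
    refine SqBound.of_swap hE (SqBound.of_fst_area (measurable_swap hE) (swap_subset_modSet h)
      h₁ h₃ (by positivity) fun a => ⟨Metric.closedBall 0 ρ, fun y hy => ?_,
        volume_closedBall_le _ hρ⟩)
    rw [mem_closedBall_zero_iff]
    exact hb _ hy
  rcases le_total (min L₁ L₂) L with h' | h'
  · rw [min_eq_left h']; exact a1.mono le_rfl (le_of_eq (by ring))
  · rw [min_eq_right h']
    refine a2.mono le_rfl ?_
    have := min_le_right L₁ L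
    nlinarith [sq_nonneg ρ]

theorem SqBound.of_norm_snd_le (hE : MeasurableSet E) (h : E ⊆ modSet s L₁ L₂ L) (h₁ : 0 ≤ L₁)
    (h₂ : 0 ≤ L₂) (h₃ : 0 ≤ L) {ρ : ℝ} (hρ : 0 ≤ ρ) (hb : ∀ p ∈ E, ‖p.2.1‖ ≤ ρ) :
    SqBound E (16 * ρ ^ 2 * min (min L₁ L₂) L) := by
  rw [min_comm L₁]
  exact SqBound.of_swap hE (SqBound.of_norm_fst_le (measurable_swap hE) (swap_subset_modSet h)
    h₂ h₁ h₃ hρ fun p hp => hb _ hp)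

theorem SqBound.of_norm_sub_le (hE : MeasurableSet E) (h : E ⊆ modSet s L₁ L₂ L) (h₁ : 0 ≤ L₁)
    (h₂ : 0 ≤ L₂) (h₃ : 0 ≤ L) {ρ : ℝ} (hρ : 0 ≤ ρ) (hb : ∀ p ∈ E, ‖p.1.1 - p.2.1‖ ≤ ρ) :
    SqBound E (16 * ρ ^ 2 * min (min L₁ L₂) L) := by
  have a1 : SqBound E (4 * (4 * ρ ^ 2) * min L₁ L) := by
    refine SqBound.of_swap hE (SqBound.of_fst_area (measurable_swap hE) (swap_subset_modSet h)
      h₁ h₃ (by positivity) fun a => ⟨Metric.closedBall a.1 ρ, fun y hy => ?_,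
        volume_closedBall_le _ hρ⟩)
    rw [mem_closedBall_iff_norm]
    exact hb _ hy
  have a2 : SqBound E (4 * (4 * ρ ^ 2) * min L₂ L) := by
    refine SqBound.of_fst_area hE h h₂ h₃ (by positivity) fun a =>
      ⟨Metric.closedBall a.1 ρ, fun y hy => ?_, volume_closedBall_le _ hρ⟩
    rw [mem_closedBall_iff_norm']
    exact hb _ hy
  rcases le_total L₁ L₂ with h' | h'
  · rw [min_eq_left h']; exact a1.mono le_rfl (le_of_eq (by ring))
  · rw [min_eq_right h']; exact a2.mono le_rfl (le_of_eq (by ring))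

end ModulationSets

section Resonance

theorem abs_floor_sub_floor_le {u v : ℝ} (h : |u - v| ≤ 1) : |⌊u⌋ - ⌊v⌋| ≤ 1 := by
  rw [abs_le] at h
  have h1 := Int.floor_le u
  have h2 := Int.lt_floor_add_one u
  have h3 := Int.floor_le v
  have h4 := Int.lt_floor_add_one v
  have h5 : ⌊u⌋ - ⌊v⌋ < 2 := by
    have : ((⌊u⌋ - ⌊v⌋ : ℤ) : ℝ) < 2 := by push_cast; linarith
    exact_mod_cast this
  have h6 : -2 < ⌊u⌋ - ⌊v⌋ := by
    have : (-2 : ℝ) < ((⌊u⌋ - ⌊v⌋ : ℤ) : ℝ) := by push_cast; linarith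
    exact_mod_cast this
  rw [abs_le]; omega

theorem SqBound.of_annuli {E : Set ((ℂ × ℝ) × (ℂ × ℝ))} (hE : MeasurableSet E) {σ M x : ℝ}
    (hM : 0 < M) (h : ∀ p ∈ E, |(‖p.1.1‖ - σ) ^ 2 - (‖p.2.1‖ + σ) ^ 2| ≤ M)
    (hx : ∀ E' ⊆ E, MeasurableSet E' → ∀ u v : ℝ, (∀ p ∈ E', u ≤ (‖p.1.1‖ - σ) ^ 2 ∧
      (‖p.1.1‖ - σ) ^ 2 ≤ u + M ∧ v ≤ (‖p.2.1‖ + σ) ^ 2 ∧ (‖p.2.1‖ + σ) ^ 2 ≤ v + M) →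
      SqBound E' x) : SqBound E (9 * x) := by
  have m₁ : Measurable fun x : ℂ × ℝ => ⌊(‖x.1‖ - σ) ^ 2 / M⌋ := by fun_prop
  have m₂ : Measurable fun x : ℂ × ℝ => ⌊(‖x.1‖ + σ) ^ 2 / M⌋ := by fun_prop
  refine SqBound.of_labels m₁ m₂ (fun p hp => abs_floor_sub_floor_le ?_) fun k k' => ?_
  · rw [← sub_div, abs_div, abs_of_pos hM]
    exact (div_le_one hM).2 (h p hp)
  · refine hx _ Set.inter_subset_left (hE.inter ?_) (k * M) (k' * M) ?_
    · exact ((m₁.comp measurable_fst) (measurableSet_singleton k)).inter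
        ((m₂.comp measurable_snd) (measurableSet_singleton k'))
    · rintro p ⟨-, h1, h2⟩
      rw [Int.floor_eq_iff, le_div_iff₀ hM, div_lt_iff₀ hM] at h1 h2
      exact ⟨h1.1, by linarith, h2.1, by linarith⟩

/-- Pairs with comparable frequencies satisfying a resonance condition, on one side of the line
spanned by their difference and away from it. -/
def resSet (σ M K β ν o : ℝ) : Set ((ℂ × ℝ) × (ℂ × ℝ)) :=
  {p | ν ≤ ‖p.1.1 - p.2.1‖ ∧ |(‖p.1.1‖ - σ) ^ 2 - (‖p.2.1‖ + σ) ^ 2| ≤ M ∧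
    K / 16 ≤ ‖p.1.1‖ ∧ ‖p.1.1‖ ≤ 2 * K ∧ K / 16 ≤ ‖p.2.1‖ ∧ ‖p.2.1‖ ≤ 2 * K ∧
    β * ‖p.1.1 - p.2.1‖ ≤ |(p.1.1 * star (p.1.1 - p.2.1)).im| ∧
    0 ≤ o * (p.1.1 * star (p.1.1 - p.2.1)).im}

theorem swap_subset_resSet {E : Set ((ℂ × ℝ) × (ℂ × ℝ))} {σ M K β ν o : ℝ}
    (h : E ⊆ resSet σ M K β ν o) : Prod.swap ⁻¹' E ⊆ resSet (-σ) M K β ν (-o) := by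
  rintro ⟨x, y⟩ hp
  obtain ⟨h1, h2, h3, h4, h5, h6, h7, h8⟩ := h hp
  simp only [Prod.swap] at *
  have e : (x.1 * star (x.1 - y.1)).im = -(y.1 * star (y.1 - x.1)).im := by
    simp; ring
  refine ⟨by rwa [norm_sub_rev], ?_, h5, h6, h3, h4, ?_, ?_⟩
  · rw [abs_sub_comm]; simpa [sub_neg_eq_add, ← sub_eq_add_neg] using h2
  · rw [norm_sub_rev, e, abs_neg]; exact h7
  · rw [e, neg_mul_neg]; exact h8

theorem abs_norm_sq_sub_le {σ r r' M u : ℝ} (hσ : |σ| ≤ 1 / 2) (hr : 2 ≤ r) (hr' : 2 ≤ r')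
    (h1 : u ≤ (r - σ) ^ 2) (h2 : (r - σ) ^ 2 ≤ u + M) (h1' : u ≤ (r' - σ) ^ 2)
    (h2' : (r' - σ) ^ 2 ≤ u + M) : |r ^ 2 - r' ^ 2| ≤ 2 * M := by
  rw [abs_le] at *
  constructor <;> rcases le_total r r' with h | h <;> nlinarith

theorem abs_sub_mul_add_abs {o b b' : ℝ} (ho : o = 1 ∨ o = -1) (hb : 0 ≤ o * b)
    (hb' : 0 ≤ o * b') : |b - b'| * (|b| + |b'|) = |b ^ 2 - b' ^ 2| := by
  have : |b + b'| = |b| + |b'| := by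
    refine (abs_add_eq_add_abs_iff _ _).2 ?_
    rcases ho with rfl | rfl
    · exact .inl ⟨by linarith, by linarith⟩
    · exact .inr ⟨by linarith, by linarith⟩
  rw [← this, ← abs_mul]; congr 1; ring

/-- Coordinates adapted to a nonzero vector. -/
theorem exists_unit_coordinates {ξ : ℂ} (hξ : ξ ≠ 0) : ∃ e : ℂ, ‖e‖ = 1 ∧ ∀ w : ℂ,
    ‖ξ + w‖ ^ 2 = ((w * star e).re + ‖ξ‖) ^ 2 + (w * star e).im ^ 2 ∧
    ‖w‖ ^ 2 = (w * star e).re ^ 2 + (w * star e).im ^ 2 ∧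
    ((ξ + w) * star ξ).im = ‖ξ‖ * (w * star e).im := by
  have h0 : ‖ξ‖ ≠ 0 := norm_ne_zero_iff.2 hξ
  have h0' : (‖ξ‖ : ℂ) ≠ 0 := by exact_mod_cast h0
  refine ⟨ξ / ‖ξ‖, by simp [h0], fun w => ?_⟩
  have he : ‖ξ / (‖ξ‖ : ℂ)‖ = 1 := by simp [h0]
  have e1 : ξ = ‖ξ‖ * (ξ / ‖ξ‖) := by field_simp
  set e := ξ / (‖ξ‖ : ℂ) with hedef
  have ee : e * star e = 1 := by
    have := Complex.mul_conj e
    rw [Complex.normSq_eq_norm_sq, he] at this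
    simpa using this
  have e2 : ξ * star e = ‖ξ‖ := by
    conv_lhs => rw [e1]
    rw [mul_assoc, ee, mul_one]
  have e3 : (ξ + w) * star e = ‖ξ‖ + w * star e := by rw [add_mul, e2]
  refine ⟨?_, norm_sq_eq_rotate he w, ?_⟩
  · rw [norm_sq_eq_rotate he, e3]; simp; ring
  · have : star ξ = ‖ξ‖ * star e := by
      conv_lhs => rw [e1]
      simp
    rw [this, mul_left_comm, e3]
    simp

variable {E : Set ((ℂ × ℝ) × (ℂ × ℝ))} {s L₁ L₂ L σ M K β ν o D : ℝ}

theorem SqBound.res_schrodinger (hE : MeasurableSet E) (h : E ⊆ modSet s L₁ L₂ L)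
    (hr : E ⊆ resSet σ M K β ν o) (h₁ : 0 ≤ L₁) (h₂ : 0 ≤ L₂)
    (hσ : |σ| ≤ 1 / 2) (hM : 0 < M) (hK : 64 ≤ K) (hβ : 0 ≤ β) (hν : 0 < ν)
    (ho : o = 1 ∨ o = -1) (hD : 0 < D) (hMD : M ≤ D ^ 2 ∨ M ≤ D * β) :
    SqBound E (288 * (L₁ * L₂ * D / ν)) := by
  refine (SqBound.of_annuli (x := 16 * (L₁ + L₂) * D / ν * min L₁ L₂) hE hM
    (fun p hp => (hr hp).2.1) ?_).mono le_rfl ?_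
  swap
  · have : (L₁ + L₂) * min L₁ L₂ ≤ 2 * (L₁ * L₂) := by
      rcases le_total L₁ L₂ with h | h
      · rw [min_eq_left h]; nlinarith
      · rw [min_eq_right h]; nlinarith
    calc _ = 144 * (D / ν) * ((L₁ + L₂) * min L₁ L₂) := by ring
      _ ≤ 144 * (D / ν) * (2 * (L₁ * L₂)) := by gcongr
      _ = _ := by ring
  intro E' hE' mE' u v hu
  refine (SqBound.of_diff_area (A := 2 * (L₁ + L₂) / ν * (2 * D)) mE' (hE'.trans h) h₁ h₂
    (by positivity) fun z => ?_).mono le_rfl (le_of_eq (by ring))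
  let T : Set ℂ := {w | ν ≤ ‖z.1‖ ∧ |z.2 + ‖z.1 + w‖ ^ 2 - ‖w‖ ^ 2| ≤ 2 * (L₁ + L₂) ∧
    u ≤ (‖z.1 + w‖ - σ) ^ 2 ∧ (‖z.1 + w‖ - σ) ^ 2 ≤ u + M ∧ K / 16 ≤ ‖z.1 + w‖ ∧
    β * ‖z.1‖ ≤ |((z.1 + w) * star z.1).im| ∧ 0 ≤ o * ((z.1 + w) * star z.1).im}
  have mT : MeasurableSet T := by
    simp only [T, Set.ofPred_and]
    refine (MeasurableSet.const _).inter ?_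
    repeat' apply MeasurableSet.inter
    all_goals exact measurableSet_le (by fun_prop) (by fun_prop)
  refine ⟨T, fun y hy => ?_, ?_⟩
  · obtain ⟨h1, h2, h3, h4, h5, h6, h7, h8⟩ := hr (hE' hy)
    obtain ⟨g1, g2, -⟩ := h (hE' hy)
    obtain ⟨k1, k2, -⟩ := hu _ hy
    simp only [Prod.fst_add, Prod.snd_add, add_sub_cancel_right] at *
    refine ⟨h1, ?_, k1, k2, h3, h7, h8⟩
    rw [abs_le] at *
    constructor <;> linarith
  by_cases hz : ν ≤ ‖z.1‖
  swap
  · have : T = ∅ := Set.eq_empty_of_forall_notMem fun w hw => hz hw.1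
    simp [this]
  have hz0 : 0 < ‖z.1‖ := hν.trans_le hz
  obtain ⟨e, he, hc⟩ := exists_unit_coordinates (norm_pos_iff.1 hz0)
  refine complex_volume_le_rotate mT he (by positivity) (fun w hw w' hw' => ?_)
    fun w hw w' hw' hre => ?_
  · obtain ⟨-, q, -⟩ := hw
    obtain ⟨-, q', -⟩ := hw'
    rw [(hc w).1, (hc w).2.1] at q
    rw [(hc w').1, (hc w').2.1] at q'
    set a := (w * star e).re
    set a' := (w' * star e).re
    have : |a - a'| * ‖z.1‖ ≤ 2 * (L₁ + L₂) := by
      rw [← abs_of_pos hz0, ← abs_mul]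
      rw [abs_le] at *
      constructor <;> nlinarith
    rw [le_div_iff₀ hν]
    exact (mul_le_mul_of_nonneg_left hz (abs_nonneg _)).trans this
  · obtain ⟨-, -, q1, q2, q3, q4, q5⟩ := hw
    obtain ⟨-, -, q1', q2', q3', q4', q5'⟩ := hw'
    have key := abs_norm_sq_sub_le hσ (by linarith) (by linarith) q1 q2 q1' q2'
    rw [(hc w).1, (hc w').1, hre] at key
    rw [(hc w).2.2] at q4 q5
    rw [(hc w').2.2] at q4' q5'
    set b := (w * star e).im
    set b' := (w' * star e).im
    have cancel : ∀ b : ℝ, β * ‖z.1‖ ≤ |‖z.1‖ * b| → β ≤ |b| := fun b hb => by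
      rw [abs_mul, abs_of_pos hz0, mul_comm] at hb
      exact le_of_mul_le_mul_left hb hz0
    have sgn : ∀ b : ℝ, 0 ≤ o * (‖z.1‖ * b) → 0 ≤ o * b := fun b hb => by
      rw [mul_left_comm] at hb
      exact nonneg_of_mul_nonneg_right hb hz0
    have p1 := cancel b q4
    have p2 := cancel b' q4'
    have p3 := abs_sub_mul_add_abs ho (sgn b q5) (sgn b' q5')
    rw [add_sub_add_left_eq_sub, ← p3] at key
    have tri : |b - b'| ≤ |b| + |b'| := abs_sub _ _
    rcases hMD with hMD | hMD
    · by_contra! hcon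
      nlinarith [abs_nonneg (b - b')]
    · have hβ' : 0 < β := by
        rcases hβ.eq_or_lt with h0 | h0
        · rw [← h0] at hMD; simp at hMD; linarith
        · exact h0
      by_contra! hcon
      nlinarith [abs_nonneg (b - b')]

end Resonance

section WaveResonance

variable {E : Set ((ℂ × ℝ) × (ℂ × ℝ))} {s L₁ L₂ L σ M K β ν o D : ℝ}

theorem sq_add_sq_le_of_res {a a' b b' X : ℝ} (hM : 0 < M) (hK : 64 ≤ K)
    (hβ : 0 ≤ β) (hν : 0 < ν) (hνK : ν ≤ 8 * K) (hD : 0 < D)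
    (hMD : M ≤ D ^ 2 ∨ M ≤ D * β) (hξ : ν ≤ X)
    (k1 : |(a + X) ^ 2 + b ^ 2 - ((a' + X) ^ 2 + b' ^ 2)| ≤ 2 * M)
    (k2 : |a ^ 2 + b ^ 2 - (a' ^ 2 + b' ^ 2)| ≤ 2 * M) (n1 : a ^ 2 + b ^ 2 ≤ (2 * K) ^ 2)
    (n1' : a' ^ 2 + b' ^ 2 ≤ (2 * K) ^ 2) (p1 : β ≤ |b|) (p2 : β ≤ |b'|)
    (p3 : |b - b'| * (|b| + |b'|) = |b ^ 2 - b' ^ 2|) :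
    (a - a') ^ 2 + (b - b') ^ 2 ≤ (50 * K * D / ν) ^ 2 := by
  have hz0 : 0 < X := hν.trans_le hξ
  have hK0 : 0 < K := by linarith
  have ha : |a - a'| * ν ≤ 2 * M := by
    have : |a - a'| * X ≤ 2 * M := by
      have l1 := abs_le.1 k1
      have l2 := abs_le.1 k2
      have l3 : 2 * ((a - a') * X) = ((a + X) ^ 2 + b ^ 2 - ((a' + X) ^ 2 + b' ^ 2)) -
          (a ^ 2 + b ^ 2 - (a' ^ 2 + b' ^ 2)) := by ring
      rw [← abs_of_pos hz0, ← abs_mul]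
      exact abs_le.2 ⟨by linarith, by linarith⟩
    exact (mul_le_mul_of_nonneg_left hξ (abs_nonneg _)).trans this
  have bound : ∀ x y : ℝ, x ^ 2 + y ^ 2 ≤ (2 * K) ^ 2 → |x| ≤ 2 * K := fun x y hxy =>
    abs_le_of_sq_le_sq (by linarith [sq_nonneg y]) (by linarith)
  have ba := bound a b n1
  have ba' := bound a' b' n1'
  have bb := bound b a (by linarith)
  have haa : |a - a'| ≤ 4 * K := (abs_sub _ _).trans (by linarith)
  have haa2 : |a + a'| ≤ 4 * K := (abs_add_le _ _).trans (by linarith)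
  have hb2 : |b ^ 2 - b' ^ 2| * ν ≤ 24 * K * M := by
    have e1 : b ^ 2 - b' ^ 2 = (a ^ 2 + b ^ 2 - (a' ^ 2 + b' ^ 2)) - (a - a') * (a + a') := by
      ring
    have e2 : |b ^ 2 - b' ^ 2| ≤ 2 * M + |a - a'| * (4 * K) := by
      rw [e1]
      refine (abs_sub _ _).trans (add_le_add k2 ?_)
      rw [abs_mul]; gcongr
    calc |b ^ 2 - b' ^ 2| * ν ≤ (2 * M + |a - a'| * (4 * K)) * ν := by gcongr
      _ = 2 * M * ν + |a - a'| * ν * (4 * K) := by ring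
      _ ≤ 2 * M * (8 * K) + 2 * M * (4 * K) := by gcongr
      _ = 24 * K * M := by ring
  rw [← p3] at hb2
  have tri : |b - b'| ≤ |b| + |b'| := abs_sub _ _
  have A0 := abs_nonneg (a - a')
  have B0 := abs_nonneg (b - b')
  have hρ : 0 < K * D / ν := by positivity
  have key : |a - a'| ≤ 20 * (K * D / ν) ∧ |b - b'| ≤ 20 * (K * D / ν) := by
    set ρ := K * D / ν with hρdef
    have hρν : ρ * ν = K * D := by rw [hρdef]; field_simp
    rcases hMD with hMD | hMD
    · have r1 : D ≤ 8 * ρ := by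
        have : D * ν ≤ 8 * ρ * ν := by rw [mul_assoc, hρν]; linarith [mul_le_mul_of_nonneg_left hνK hD.le]
        exact le_of_mul_le_mul_right this hν
      constructor
      · refine abs_le_of_sq_le_sq' ?_ (by positivity) |>.2
        have : |a - a'| ^ 2 * ν ≤ (64 * ρ ^ 2) * ν := by
          calc |a - a'| ^ 2 * ν = |a - a'| * (|a - a'| * ν) := by ring
            _ ≤ 4 * K * (2 * D ^ 2) :=
              mul_le_mul haa (ha.trans (by linarith)) (by positivity) (by positivity)
            _ = 8 * (K * D) * D := by ring
            _ = 8 * (ρ * ν) * D := by rw [hρν]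
            _ ≤ 8 * (ρ * ν) * (8 * ρ) := by gcongr
            _ = _ := by ring
        have := le_of_mul_le_mul_right this hν
        linarith [sq_nonneg ρ]
      · refine abs_le_of_sq_le_sq' ?_ (by positivity) |>.2
        have : |b - b'| ^ 2 * ν ≤ (192 * ρ ^ 2) * ν := by
          calc |b - b'| ^ 2 * ν = |b - b'| * |b - b'| * ν := by ring
            _ ≤ |b - b'| * (|b| + |b'|) * ν := by gcongr
            _ ≤ 24 * K * M := hb2
            _ ≤ 24 * K * D ^ 2 := by gcongr
            _ = 24 * (K * D) * D := by ring
            _ = 24 * (ρ * ν) * D := by rw [hρν]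
            _ ≤ 24 * (ρ * ν) * (8 * ρ) := by gcongr
            _ = _ := by ring
        have := le_of_mul_le_mul_right this hν
        linarith [sq_nonneg ρ]
    · have hβ' : 0 < β := by
        rcases hβ.eq_or_lt with h0 | h0
        · rw [← h0] at hMD; simp at hMD; linarith
        · exact h0
      constructor
      · have : |a - a'| * ν ≤ 20 * ρ * ν := by
          rw [mul_assoc, hρν]
          have : D * β ≤ D * (2 * K) := by gcongr; linarith
          linarith [mul_pos hD hK0]
        exact le_of_mul_le_mul_right this hν
      · have : |b - b'| * (2 * β * ν) ≤ 20 * ρ * (2 * β * ν) := by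
          calc |b - b'| * (2 * β * ν) = |b - b'| * (β + β) * ν := by ring
            _ ≤ |b - b'| * (|b| + |b'|) * ν := by gcongr
            _ ≤ 24 * K * M := hb2
            _ ≤ 24 * K * (D * β) := by gcongr
            _ = 24 * (K * D) * β := by ring
            _ = 24 * (ρ * ν) * β := by rw [hρν]
            _ ≤ _ := by linarith [mul_pos (mul_pos hρ hν) hβ']
        exact le_of_mul_le_mul_right this (by positivity)
  rw [show 50 * K * D / ν = 50 * (K * D / ν) by ring, ← sq_abs (a - a'), ← sq_abs (b - b')]
  have g1 : |a - a'| ^ 2 ≤ (20 * (K * D / ν)) ^ 2 := by gcongr; exact key.1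
  have g2 : |b - b'| ^ 2 ≤ (20 * (K * D / ν)) ^ 2 := by gcongr; exact key.2
  nlinarith [sq_nonneg (K * D / ν)]

/-- Two points on a fixed translate of an annulus cross-section stay close. -/
theorem norm_sub_le_of_res {ξ w w' : ℂ} {u v : ℝ} (hσ : |σ| ≤ 1 / 2) (hM : 0 < M) (hK : 64 ≤ K)
    (hβ : 0 ≤ β) (hν : 0 < ν) (hνK : ν ≤ 8 * K) (ho : o = 1 ∨ o = -1) (hD : 0 < D)
    (hMD : M ≤ D ^ 2 ∨ M ≤ D * β) (hξ : ν ≤ ‖ξ‖)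
    (h : ∀ z ∈ ({w, w'} : Set ℂ), u ≤ (‖ξ + z‖ - σ) ^ 2 ∧ (‖ξ + z‖ - σ) ^ 2 ≤ u + M ∧
      v ≤ (‖z‖ + σ) ^ 2 ∧ (‖z‖ + σ) ^ 2 ≤ v + M ∧ K / 16 ≤ ‖ξ + z‖ ∧ ‖ξ + z‖ ≤ 2 * K ∧
      K / 16 ≤ ‖z‖ ∧ ‖z‖ ≤ 2 * K ∧ β * ‖ξ‖ ≤ |((ξ + z) * star ξ).im| ∧
      0 ≤ o * ((ξ + z) * star ξ).im) : ‖w - w'‖ ≤ 50 * K * D / ν := by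
  obtain ⟨q1, q2, q3, q4, q5, q6, q7, q8, q9, q10⟩ := h w (by simp)
  obtain ⟨q1', q2', q3', q4', q5', q6', q7', q8', q9', q10'⟩ := h w' (by simp)
  have hz0 : 0 < ‖ξ‖ := hν.trans_le hξ
  obtain ⟨e, he, hc⟩ := exists_unit_coordinates (norm_pos_iff.1 hz0)
  have k1 := abs_norm_sq_sub_le hσ (by linarith) (by linarith) q1 q2 q1' q2'
  have k2 := abs_norm_sq_sub_le (σ := -σ) (r := ‖w‖) (r' := ‖w'‖) (by rwa [abs_neg]) (by linarith)
    (by linarith)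
    (by simpa using q3) (by simpa using q4) (by simpa using q3') (by simpa using q4')
  have n1 : ‖w‖ ^ 2 ≤ (2 * K) ^ 2 := by gcongr
  have n1' : ‖w'‖ ^ 2 ≤ (2 * K) ^ 2 := by gcongr
  have nd : ‖w - w'‖ ^ 2 = ((w * star e).re - (w' * star e).re) ^ 2 +
      ((w * star e).im - (w' * star e).im) ^ 2 := by
    rw [(hc (w - w')).2.1, sub_mul, Complex.sub_re, Complex.sub_im]
  rw [(hc w).1, (hc w').1] at k1
  rw [(hc w).2.1, (hc w').2.1] at k2
  rw [(hc w).2.1] at n1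
  rw [(hc w').2.1] at n1'
  rw [(hc w).2.2] at q9 q10
  rw [(hc w').2.2] at q9' q10'
  set a := (w * star e).re
  set a' := (w' * star e).re
  set b := (w * star e).im
  set b' := (w' * star e).im
  have cancel : ∀ b : ℝ, β * ‖ξ‖ ≤ |‖ξ‖ * b| → β ≤ |b| := fun b hb => by
    rw [abs_mul, abs_of_pos hz0, mul_comm] at hb
    exact le_of_mul_le_mul_left hb hz0
  have sgn : ∀ b : ℝ, 0 ≤ o * (‖ξ‖ * b) → 0 ≤ o * b := fun b hb => by
    rw [mul_left_comm] at hb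
    exact nonneg_of_mul_nonneg_right hb hz0
  have p1 := cancel b q9
  have p2 := cancel b' q9'
  have p3 := abs_sub_mul_add_abs ho (sgn b q10) (sgn b' q10')
  refine abs_le_of_sq_le_sq' ?_ (by positivity) |>.2
  rw [nd]
  exact sq_add_sq_le_of_res hM hK hβ hν hνK hD hMD hξ k1 k2 n1 n1' p1 p2 p3

theorem exists_finset_floor (ℓ : ℝ) (hl : 0 < ℓ) {S : Set (ℂ × ℝ)}
    (h : ∀ y ∈ S, ∀ y' ∈ S, ‖y.1 - y'.1‖ ≤ ℓ) : ∃ T : Finset (ℤ × ℤ), T.card ≤ 9 ∧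
      ∀ y ∈ S, ((⌊y.1.re / ℓ⌋, ⌊y.1.im / ℓ⌋) : ℤ × ℤ) ∈ T := by
  rcases S.eq_empty_or_nonempty with rfl | ⟨y₀, h₀⟩
  · exact ⟨∅, by simp, by simp⟩
  refine ⟨Finset.Icc (⌊y₀.1.re / ℓ⌋ - 1) (⌊y₀.1.re / ℓ⌋ + 1) ×ˢ
    Finset.Icc (⌊y₀.1.im / ℓ⌋ - 1) (⌊y₀.1.im / ℓ⌋ + 1), ?_, fun y hy => ?_⟩
  · rw [Finset.card_product, Int.card_Icc, Int.card_Icc]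
    have : ∀ k : ℤ, (k + 1 + 1 - (k - 1)).toNat = 3 := fun k => by
      rw [show k + 1 + 1 - (k - 1) = 3 by ring]; rfl
    rw [this, this]
  · have h1 := h y hy y₀ h₀
    have r := (Complex.abs_re_le_norm (y.1 - y₀.1)).trans h1
    have i := (Complex.abs_im_le_norm (y.1 - y₀.1)).trans h1
    have f : ∀ x x' : ℝ, |x - x'| ≤ ℓ → |⌊x / ℓ⌋ - ⌊x' / ℓ⌋| ≤ 1 := fun x x' hx =>
      abs_floor_sub_floor_le (by rw [← sub_div, abs_div, abs_of_pos hl]; exact (div_le_one hl).2 hx)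
    have fr := abs_le.1 (f _ _ r)
    have fi := abs_le.1 (f _ _ i)
    rw [Finset.mem_product, Finset.mem_Icc, Finset.mem_Icc]
    dsimp only
    omega

theorem abs_sub_le_of_floor_eq {ℓ x x' : ℝ} (hl : 0 < ℓ) (h : ⌊x / ℓ⌋ = ⌊x' / ℓ⌋) :
    |x - x'| ≤ ℓ := by
  have := Int.abs_sub_lt_one_of_floor_eq_floor h
  rw [← sub_div, abs_div, abs_of_pos hl, div_lt_one hl] at this
  exact this.le

theorem abs_norm_sq_sub_le_of_wave {T : Set ℂ} {c m : ℝ} {w₀ : ℂ} (hs : |s| ≤ 1)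
    (h : ∀ z ∈ T, |c + ‖z‖ ^ 2 + s * ‖w₀ - z‖| ≤ m) (z : ℂ) (hz : z ∈ T) (z' : ℂ) (hz' : z' ∈ T) :
    |‖z‖ ^ 2 - ‖z'‖ ^ 2| ≤ 2 * m + ‖z - z'‖ := by
  have e : ‖z‖ ^ 2 - ‖z'‖ ^ 2 = ((c + ‖z‖ ^ 2 + s * ‖w₀ - z‖) - (c + ‖z'‖ ^ 2 + s * ‖w₀ - z'‖)) -
      s * (‖w₀ - z‖ - ‖w₀ - z'‖) := by ring
  rw [e]
  refine (abs_sub _ _).trans (add_le_add ?_ ?_)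
  · refine (abs_sub _ _).trans ?_
    linarith [h z hz, h z' hz']
  · rw [abs_mul]
    calc |s| * |‖w₀ - z‖ - ‖w₀ - z'‖| ≤ 1 * ‖(w₀ - z) - (w₀ - z')‖ := by
          gcongr; exact abs_norm_sub_norm_le _ _
      _ = ‖z - z'‖ := by rw [one_mul, sub_sub_sub_cancel_left, norm_sub_rev]

theorem SqBound.res_wave_snd (hE : MeasurableSet E) (h : E ⊆ modSet s L₁ L₂ L) (hs : |s| ≤ 1)
    (hr : E ⊆ resSet σ M K β ν o) (h₂ : 0 ≤ L₂) (h₃ : 0 ≤ L)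
    (hσ : |σ| ≤ 1 / 2) (hM : 0 < M) (hK : 64 ≤ K) (hβ : 0 ≤ β) (hν : 0 < ν) (hνK : ν ≤ 8 * K)
    (ho : o = 1 ∨ o = -1) (hD : 0 < D) (hMD : M ≤ D ^ 2 ∨ M ≤ D * β) :
    SqBound E (10 ^ 9 * (L₂ * L * D / ν)) := by
  set ℓ := 50 * K * D / ν with hℓ
  have hK0 : 0 < K := by linarith
  have hl : 0 < ℓ := by positivity
  refine (SqBound.of_annuli (x := (9 : ℕ) ^ 2 * (16 * ℓ * (2 * L₂ + 2 * L) / (K / 16) *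
    (4 * min L₂ L))) hE hM (fun p hp => (hr hp).2.1) ?_).mono le_rfl ?_
  swap
  · have : (L₂ + L) * min L₂ L ≤ 2 * (L₂ * L) := by
      rcases le_total L₂ L with h | h
      · rw [min_eq_left h]; nlinarith
      · rw [min_eq_right h]; nlinarith
    have hDν : 0 < D / ν := by positivity
    calc _ = 729 * 102400 * (D / ν) * ((L₂ + L) * min L₂ L) := by
          rw [hℓ]; field_simp; push_cast; ring
      _ ≤ 729 * 102400 * (D / ν) * (2 * (L₂ * L)) := by gcongr
      _ = 149299200 * (L₂ * L * D / ν) := by ring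
      _ ≤ _ := by
        have : 0 ≤ L₂ * L * D / ν := by positivity
        nlinarith
  intro E' hE' mE' u v hu
  have mQ : Measurable fun y : ℂ × ℝ => ((⌊y.1.re / ℓ⌋, ⌊y.1.im / ℓ⌋) : ℤ × ℤ) := by fun_prop
  refine SqBound.of_boxes (Q := fun y : ℂ × ℝ => ((⌊y.1.re / ℓ⌋, ⌊y.1.im / ℓ⌋) : ℤ × ℤ))
    mE' mQ (by positivity) (fun a q => ?_) fun z => ?_
  · let T : Set ℂ := {w | |a.2 + ‖w‖ ^ 2 + s * ‖a.1 - w‖| ≤ 2 * L₂ + 2 * L ∧ K / 16 ≤ ‖w‖ ∧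
      ⌊w.re / ℓ⌋ = q.1 ∧ ⌊w.im / ℓ⌋ = q.2}
    have mT : MeasurableSet T := by
      have m1 : Measurable fun w : ℂ => ⌊w.re / ℓ⌋ := by fun_prop
      have m2 : Measurable fun w : ℂ => ⌊w.im / ℓ⌋ := by fun_prop
      have m3 : MeasurableSet {w : ℂ | |a.2 + ‖w‖ ^ 2 + s * ‖a.1 - w‖| ≤ 2 * L₂ + 2 * L} :=
        measurableSet_le (by fun_prop) (by fun_prop)
      have m4 : MeasurableSet {w : ℂ | K / 16 ≤ ‖w‖} :=
        measurableSet_le (by fun_prop) (by fun_prop)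
      exact m3.inter (m4.inter ((m1 (measurableSet_singleton q.1)).inter
        (m2 (measurableSet_singleton q.2))))
    have m3 : MeasurableSet (E' ∩ {p | ((⌊p.2.1.re / ℓ⌋, ⌊p.2.1.im / ℓ⌋) : ℤ × ℤ) = q}) :=
      mE'.inter ((mQ.comp measurable_snd) (measurableSet_singleton q))
    refine (volume_fiber_fst_le (s := s) (L₁ := L₁) (L₂ := L₂) (L := L) m3
      ((Set.inter_subset_left.trans hE').trans h) a (T := T) ?_).trans ?_
    · rintro y ⟨hy, hq⟩
      obtain ⟨-, h2, h3, h4, h5, h6, h7, h8⟩ := hr (hE' hy)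
      obtain ⟨-, g2, g3⟩ := h (hE' hy)
      refine ⟨?_, h5, by rw [← hq], by rw [← hq]⟩
      dsimp only at g2 g3 ⊢
      rw [abs_le] at *
      constructor <;> linarith
    · rw [ENNReal.ofReal_mul (p := 16 * ℓ * (2 * L₂ + 2 * L) / (K / 16)) (by positivity)]
      gcongr
      exact volume_ring_le mT (by linarith) hl.le (by positivity) (fun z hz => hz.2.1)
        (fun z hz z' hz' => abs_sub_le_of_floor_eq hl (hz.2.2.1.trans hz'.2.2.1.symm))
        (fun z hz z' hz' => abs_sub_le_of_floor_eq hl (hz.2.2.2.trans hz'.2.2.2.symm))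
        (abs_norm_sq_sub_le_of_wave hs fun z hz => hz.1)
  · refine exists_finset_floor ℓ hl (S := {y | (z + y, y) ∈ E'}) fun y hy y' hy' => ?_
    have hz : ∀ y : ℂ × ℝ, (z + y, y) ∈ E' → ν ≤ ‖z.1‖ ∧ u ≤ (‖z.1 + y.1‖ - σ) ^ 2 ∧
        (‖z.1 + y.1‖ - σ) ^ 2 ≤ u + M ∧ v ≤ (‖y.1‖ + σ) ^ 2 ∧ (‖y.1‖ + σ) ^ 2 ≤ v + M ∧
        K / 16 ≤ ‖z.1 + y.1‖ ∧ ‖z.1 + y.1‖ ≤ 2 * K ∧ K / 16 ≤ ‖y.1‖ ∧ ‖y.1‖ ≤ 2 * K ∧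
        β * ‖z.1‖ ≤ |((z.1 + y.1) * star z.1).im| ∧ 0 ≤ o * ((z.1 + y.1) * star z.1).im := by
      intro y hy
      obtain ⟨h1, h2, h3, h4, h5, h6, h7, h8⟩ := hr (hE' hy)
      obtain ⟨k1, k2, k3, k4⟩ := hu _ hy
      simp only [Prod.fst_add, add_sub_cancel_right] at *
      exact ⟨h1, k1, k2, k3, k4, h3, h4, h5, h6, h7, h8⟩
    refine norm_sub_le_of_res hσ hM hK hβ hν hνK ho hD hMD (hz y hy).1 (u := u) (v := v) ?_
    rintro x (rfl | rfl)
    · exact (hz y hy).2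
    · exact (hz y' hy').2

theorem SqBound.res_wave_fst (hE : MeasurableSet E) (h : E ⊆ modSet s L₁ L₂ L) (hs : |s| ≤ 1)
    (hr : E ⊆ resSet σ M K β ν o) (h₁ : 0 ≤ L₁) (h₃ : 0 ≤ L)
    (hσ : |σ| ≤ 1 / 2) (hM : 0 < M) (hK : 64 ≤ K) (hβ : 0 ≤ β) (hν : 0 < ν) (hνK : ν ≤ 8 * K)
    (ho : o = 1 ∨ o = -1) (hD : 0 < D) (hMD : M ≤ D ^ 2 ∨ M ≤ D * β) :
    SqBound E (10 ^ 9 * (L₁ * L * D / ν)) :=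
  SqBound.of_swap hE (SqBound.res_wave_snd (measurable_swap hE) (swap_subset_modSet h)
    (by rwa [abs_neg]) (swap_subset_resSet hr) h₁ h₃ (by rwa [abs_neg]) hM hK hβ hν hνK
    (by rcases ho with rfl | rfl <;> simp) hD hMD)

end WaveResonance

section ComparableFrequencies

variable {E : Set ((ℂ × ℝ) × (ℂ × ℝ))} {s L₁ L₂ L σ M K β ν D Y : ℝ}

theorem SqBound.iUnion_geometric {F : ℕ → Set ((ℂ × ℝ) × (ℂ × ℝ))} {x : ℝ} (hx : 0 ≤ x)
    (h : ∀ i, SqBound (F i) (x * (1 / 2) ^ i)) : SqBound (⋃ i, F i) (16 * x) := by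
  refine (TriBound.iUnion h).mono le_rfl ?_
  have h1 : ∀ i : ℕ, ENNReal.ofReal (√(x * (1 / 2) ^ i)) ≤
      ENNReal.ofReal (√x) * ENNReal.ofReal (3 / 4) ^ i := fun i => by
    rw [← ENNReal.ofReal_pow (by norm_num), ← ENNReal.ofReal_mul (by positivity)]
    refine ENNReal.ofReal_le_ofReal (Real.sqrt_le_iff.2 ⟨by positivity, ?_⟩)
    rw [mul_pow, Real.sq_sqrt hx, ← pow_mul, mul_comm i 2, pow_mul]
    gcongr; norm_num
  refine (ENNReal.tsum_le_tsum h1).trans ?_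
  rw [ENNReal.tsum_mul_left, ENNReal.tsum_geometric, ← ENNReal.ofReal_one,
    ← ENNReal.ofReal_sub _ (by norm_num), ← ENNReal.ofReal_inv_of_pos (by norm_num),
    ← ENNReal.ofReal_mul (by positivity), Real.sqrt_mul (by norm_num),
    show (16 : ℝ) = 4 ^ 2 by norm_num, Real.sqrt_sq (by norm_num)]
  refine ENNReal.ofReal_le_ofReal (le_of_eq ?_)
  norm_num; ring

theorem SqBound.iff_inter_union {E A A' : Set ((ℂ × ℝ) × (ℂ × ℝ))} {x : ℝ} (hx : 0 ≤ x)
    (h : E ⊆ A ∪ A') (h₁ : SqBound (E ∩ A) x) (h₂ : SqBound (E ∩ A') x) : SqBound E (4 * x) := by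
  refine (h₁.union h₂).mono (fun p hp => ?_) ?_
  · rcases h hp with h | h
    · exact .inl ⟨hp, h⟩
    · exact .inr ⟨hp, h⟩
  · rw [max_eq_left hx]; linarith

/-- The largest of three modulations. -/
def modMax (L₁ L₂ L : ℝ) : ℝ := max (max L₁ L₂) L

/-- The product of the two smaller modulations. -/
def modProd (L₁ L₂ L : ℝ) : ℝ := L₁ * L₂ * L / modMax L₁ L₂ L

theorem le_modMax : L₁ ≤ modMax L₁ L₂ L ∧ L₂ ≤ modMax L₁ L₂ L ∧ L ≤ modMax L₁ L₂ L :=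
  ⟨(le_max_left _ _).trans (le_max_left _ _), (le_max_right _ _).trans (le_max_left _ _),
    le_max_right _ _⟩

theorem modProd_eq (h₁ : 1 ≤ L₁) (h₂ : 1 ≤ L₂) (h₃ : 1 ≤ L) :
    modProd L₁ L₂ L = L₁ * L₂ ∨ modProd L₁ L₂ L = L₁ * L ∨ modProd L₁ L₂ L = L₂ * L := by
  unfold modProd modMax
  rcases max_choice (max L₁ L₂) L with h | h <;> rw [h]
  · rcases max_choice L₁ L₂ with h | h <;> rw [h]
    · right; right; field_simp
    · right; left; field_simp
  · left; field_simp

theorem modProd_pos (h₁ : 1 ≤ L₁) (h₂ : 1 ≤ L₂) (h₃ : 1 ≤ L) : 0 < modProd L₁ L₂ L := by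
  rcases modProd_eq h₁ h₂ h₃ with h | h | h <;> rw [h] <;> positivity

theorem SqBound.of_res (hE : MeasurableSet E) (h : E ⊆ modSet s L₁ L₂ L) (hs : |s| ≤ 1)
    (h₁ : 1 ≤ L₁) (h₂ : 1 ≤ L₂) (h₃ : 1 ≤ L)
    (hσ : |σ| ≤ 1 / 2) (hM : 0 < M) (hK : 64 ≤ K) (hβ : 0 ≤ β) (hν : 0 < ν) (hνK : ν ≤ 8 * K)
    (hD : 0 < D) (hMD : M ≤ D ^ 2 ∨ M ≤ D * β)
    (hr : ∀ p ∈ E, K / 16 ≤ ‖p.1.1‖ ∧ ‖p.1.1‖ ≤ 2 * K ∧ K / 16 ≤ ‖p.2.1‖ ∧ ‖p.2.1‖ ≤ 2 * K)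
    (hξ : ∀ p ∈ E, ν ≤ ‖p.1.1 - p.2.1‖)
    (hres : ∀ p ∈ E, |(‖p.1.1‖ - σ) ^ 2 - (‖p.2.1‖ + σ) ^ 2| ≤ M)
    (hb : ∀ p ∈ E, β * ‖p.1.1 - p.2.1‖ ≤ |(p.1.1 * star (p.1.1 - p.2.1)).im|) :
    SqBound E (10 ^ 10 * (modProd L₁ L₂ L * D / ν)) := by
  have main : ∀ o : ℝ, o = 1 ∨ o = -1 →
      SqBound (E ∩ {p | 0 ≤ o * (p.1.1 * star (p.1.1 - p.2.1)).im})
        (10 ^ 9 * (modProd L₁ L₂ L * D / ν)) := by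
    intro o ho
    have mE : MeasurableSet (E ∩ {p | 0 ≤ o * (p.1.1 * star (p.1.1 - p.2.1)).im}) :=
      hE.inter (measurableSet_le (by fun_prop) (by fun_prop))
    have hsub : E ∩ {p | 0 ≤ o * (p.1.1 * star (p.1.1 - p.2.1)).im} ⊆ resSet σ M K β ν o :=
      fun p hp => ⟨hξ p hp.1, hres p hp.1, (hr p hp.1).1, (hr p hp.1).2.1, (hr p hp.1).2.2.1,
        (hr p hp.1).2.2.2, hb p hp.1, hp.2⟩
    have h' : E ∩ {p | 0 ≤ o * (p.1.1 * star (p.1.1 - p.2.1)).im} ⊆ modSet s L₁ L₂ L :=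
      Set.inter_subset_left.trans h
    rcases modProd_eq h₁ h₂ h₃ with e | e | e <;> rw [e]
    · refine (SqBound.res_schrodinger mE h' hsub (by linarith) (by linarith) hσ hM hK hβ hν ho
        hD hMD).mono le_rfl ?_
      gcongr; norm_num
    · exact SqBound.res_wave_fst mE h' hs hsub (by linarith) (by linarith) hσ hM hK hβ hν hνK ho
        hD hMD
    · exact SqBound.res_wave_snd mE h' hs hsub (by linarith) (by linarith) hσ hM hK hβ hν hνK ho
        hD hMD
  have hP := modProd_pos h₁ h₂ h₃
  refine (SqBound.iff_inter_union (by positivity) (fun p _ => ?_) (main 1 (.inl rfl))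
    (main (-1) (.inr rfl))).mono le_rfl ?_
  · rcases le_total 0 ((p.1.1 * star (p.1.1 - p.2.1)).im) with h | h
    · left; simpa using h
    · right
      rw [Set.mem_ofPred_eq]
      linarith
  · have : 0 ≤ modProd L₁ L₂ L * D / ν := by positivity
    linarith

theorem four_mul_cross_sq (x y : ℂ) : 4 * (x * star (x - y)).im ^ 2 =
    4 * ‖x‖ ^ 2 * ‖x - y‖ ^ 2 - (‖x‖ ^ 2 - ‖y‖ ^ 2 + ‖x - y‖ ^ 2) ^ 2 := by
  rw [← Complex.normSq_eq_norm_sq, ← Complex.normSq_eq_norm_sq, ← Complex.normSq_eq_norm_sq,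
    Complex.normSq_apply, Complex.normSq_apply, Complex.normSq_apply]
  simp
  ring

theorem abs_resonance_le (h : E ⊆ modSet s L₁ L₂ L) {p : (ℂ × ℝ) × (ℂ × ℝ)} (hp : p ∈ E) :
    |‖p.1.1‖ ^ 2 - ‖p.2.1‖ ^ 2 - s * ‖p.1.1 - p.2.1‖| ≤ 6 * modMax L₁ L₂ L := by
  obtain ⟨h1, h2, h3⟩ := h hp
  obtain ⟨k1, k2, k3⟩ := le_modMax (L₁ := L₁) (L₂ := L₂) (L := L)
  rw [abs_le] at *
  constructor <;> linarith

theorem abs_norm_sq_sub_le_of_modSet (h : E ⊆ modSet s L₁ L₂ L) (hs : |s| ≤ 1)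
    {p : (ℂ × ℝ) × (ℂ × ℝ)} (hp : p ∈ E) :
    |‖p.1.1‖ ^ 2 - ‖p.2.1‖ ^ 2| ≤ ‖p.1.1 - p.2.1‖ + 6 * modMax L₁ L₂ L := by
  have := abs_resonance_le h hp
  have h2 : |s * ‖p.1.1 - p.2.1‖| ≤ ‖p.1.1 - p.2.1‖ := by
    rw [abs_mul, abs_norm]
    exact mul_le_of_le_one_left (norm_nonneg _) hs
  rw [abs_le] at *
  constructor <;> linarith

theorem SqBound.comparable_low_res (hE : MeasurableSet E) (h : E ⊆ modSet s L₁ L₂ L)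
    (hs : |s| ≤ 1) (h₁ : 1 ≤ L₁) (h₂ : 1 ≤ L₂) (h₃ : 1 ≤ L) (hK : 64 ≤ K) (hν : 0 < ν)
    (hνK : ν ≤ 8 * K) (hY : 0 < Y)
    (hr : ∀ p ∈ E, K / 16 ≤ ‖p.1.1‖ ∧ ‖p.1.1‖ ≤ 2 * K ∧ K / 16 ≤ ‖p.2.1‖ ∧ ‖p.2.1‖ ≤ 2 * K)
    (hξ : ∀ p ∈ E, ν ≤ ‖p.1.1 - p.2.1‖) (hξY : ∀ p ∈ E, ‖p.1.1 - p.2.1‖ ≤ Y) :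
    SqBound E (10 ^ 10 * (modProd L₁ L₂ L * √(Y + 6 * modMax L₁ L₂ L) / ν)) := by
  have hΛ : 1 ≤ modMax L₁ L₂ L := h₁.trans le_modMax.1
  have hM : 0 < Y + 6 * modMax L₁ L₂ L := by linarith
  refine SqBound.of_res (σ := 0) (β := 0) hE h hs h₁ h₂ h₃ (by norm_num) hM hK le_rfl hν hνK
    (Real.sqrt_pos.2 hM) (.inl (Real.sq_sqrt hM.le).ge) hr hξ (fun p hp => ?_) (fun p hp => ?_)
  · rw [sub_zero, add_zero]
    exact (abs_norm_sq_sub_le_of_modSet h hs hp).trans (by linarith [hξY p hp])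
  · rw [zero_mul]; exact abs_nonneg _

theorem SqBound.comparable_transversal (hE : MeasurableSet E) (h : E ⊆ modSet s L₁ L₂ L)
    (hs : |s| ≤ 1) (h₁ : 1 ≤ L₁) (h₂ : 1 ≤ L₂) (h₃ : 1 ≤ L) (hK : 64 ≤ K) (hν : 0 < ν)
    (hνK : ν ≤ 8 * K) (hY : 0 < Y) (hsmall : 1 + 6 * modMax L₁ L₂ L / ν + Y ≤ K / 16)
    (hr : ∀ p ∈ E, K / 16 ≤ ‖p.1.1‖ ∧ ‖p.1.1‖ ≤ 2 * K ∧ K / 16 ≤ ‖p.2.1‖ ∧ ‖p.2.1‖ ≤ 2 * K)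
    (hξ : ∀ p ∈ E, ν ≤ ‖p.1.1 - p.2.1‖) (hξY : ∀ p ∈ E, ‖p.1.1 - p.2.1‖ ≤ Y) :
    SqBound E (10 ^ 10 * (modProd L₁ L₂ L * (32 * (Y + 6 * modMax L₁ L₂ L) / K) / ν)) := by
  have hΛ : 1 ≤ modMax L₁ L₂ L := h₁.trans le_modMax.1
  have hM : 0 < Y + 6 * modMax L₁ L₂ L := by linarith
  have hK0 : 0 < K := by linarith
  refine SqBound.of_res (σ := 0) (β := K / 32) hE h hs h₁ h₂ h₃ (by norm_num) hM hK
    (by positivity) hν hνK (by positivity) (.inr (le_of_eq (by field_simp))) hr hξ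
    (fun p hp => ?_) (fun p hp => ?_)
  · rw [sub_zero, add_zero]
    exact (abs_norm_sq_sub_le_of_modSet h hs hp).trans (by linarith [hξY p hp])
  · have e := four_mul_cross_sq p.1.1 p.2.1
    have a := abs_norm_sq_sub_le_of_modSet h hs hp
    have b := hξ p hp
    have b' := hξY p hp
    have c := (hr p hp).1
    set X := ‖p.1.1 - p.2.1‖
    have hX : 0 < X := hν.trans_le b
    have d : |‖p.1.1‖ ^ 2 - ‖p.2.1‖ ^ 2 + X ^ 2| ≤ K / 16 * X := by
      have d1 : 6 * modMax L₁ L₂ L ≤ 6 * modMax L₁ L₂ L / ν * X := by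
        rw [div_mul_eq_mul_div, le_div_iff₀ hν]; gcongr
      calc _ ≤ |‖p.1.1‖ ^ 2 - ‖p.2.1‖ ^ 2| + |X ^ 2| := abs_add_le _ _
        _ ≤ (X + 6 * modMax L₁ L₂ L / ν * X) + Y * X := by
          rw [abs_of_nonneg (sq_nonneg X), sq X]
          exact add_le_add (a.trans (by linarith)) (mul_le_mul_of_nonneg_right b' hX.le)
        _ = (1 + 6 * modMax L₁ L₂ L / ν + Y) * X := by ring
        _ ≤ _ := by gcongr
    have d' := sq_le_sq' (by linarith [(abs_le.1 d).1]) (abs_le.1 d).2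
    have c' : (K / 16) ^ 2 ≤ ‖p.1.1‖ ^ 2 := by gcongr
    have c'' : (K / 16) ^ 2 * X ^ 2 ≤ ‖p.1.1‖ ^ 2 * X ^ 2 := by gcongr
    refine abs_le_of_sq_le_sq' ?_ (abs_nonneg _) |>.2
    rw [sq_abs]
    have : 0 ≤ (K * X) ^ 2 := sq_nonneg _
    linarith

end ComparableFrequencies

section HighWaveFrequency

variable {E : Set ((ℂ × ℝ) × (ℂ × ℝ))} {s L₁ L₂ L K : ℝ}

/-- Heron-type bound for the defect of the triangle inequality. -/
theorem sub_norm_le_of_cross {r₁ r₂ X c K Λ s : ℝ} (hs : |s| ≤ 1) (hK : 1024 ≤ K)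
    (h₁ : K / 16 ≤ r₁) (h₂ : K / 16 ≤ r₂) (hX : K / 128 ≤ X) (hSX : X ≤ r₁ + r₂)
    (hΛ : 0 ≤ Λ) (hc : 4 * c ^ 2 = ((r₁ + r₂) ^ 2 - X ^ 2) * (X ^ 2 - (r₁ - r₂) ^ 2))
    (hres : |r₁ ^ 2 - r₂ ^ 2 - s * X| ≤ 6 * Λ) :
    (r₁ + r₂ - X) * (K * X ^ 2) ≤ 3 * Λ * (K * X ^ 2) + 43 * c ^ 2 := by
  have hX0 : 0 < X := by linarith
  rcases le_or_gt |r₁ - r₂| (X / 2) with hd | hd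
  · have hd2 : (r₁ - r₂) ^ 2 ≤ (X / 2) ^ 2 := sq_le_sq' (by linarith [(abs_le.1 hd).1])
      (abs_le.1 hd).2
    have e1 : (r₁ + r₂ - X) * (K / 8) ≤ (r₁ + r₂) ^ 2 - X ^ 2 := by
      have : (r₁ + r₂) ^ 2 - X ^ 2 = (r₁ + r₂ - X) * (r₁ + r₂ + X) := by ring
      rw [this]
      exact mul_le_mul_of_nonneg_left (by linarith) (by linarith)
    have e0 : 0 ≤ (r₁ + r₂ - X) * (K / 8) := mul_nonneg (by linarith) (by linarith)
    have e2 : (r₁ + r₂ - X) * (K / 8) * (3 / 4 * X ^ 2) ≤ 4 * c ^ 2 := by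
      rw [hc]
      exact mul_le_mul e1 (by linarith) (by positivity) (by linarith)
    have e3 : 0 ≤ 3 * Λ * (K * X ^ 2) := by positivity
    have e4 : 0 ≤ c ^ 2 := sq_nonneg c
    linarith
  · have hsX : |s * X| ≤ X := by
      rw [abs_mul, abs_of_pos hX0]
      exact mul_le_of_le_one_left hX0.le hs
    have e1 : |r₁ - r₂| * (r₁ + r₂) ≤ 6 * Λ + X := by
      rw [← abs_of_nonneg (show 0 ≤ r₁ + r₂ by linarith), ← abs_mul]
      have : (r₁ - r₂) * (r₁ + r₂) = (r₁ ^ 2 - r₂ ^ 2 - s * X) + s * X := by ring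
      rw [this]
      exact (abs_add_le _ _).trans (add_le_add hres hsX)
    have e2 : X / 2 * (r₁ + r₂) ≤ |r₁ - r₂| * (r₁ + r₂) :=
      mul_le_mul_of_nonneg_right hd.le (by linarith)
    have e3 : 8 * (r₁ + r₂ - 4) ≤ X * (r₁ + r₂ - 4) :=
      mul_le_mul_of_nonneg_right (by linarith) (by linarith)
    have e4 : r₁ + r₂ - X ≤ 3 * Λ := by linarith
    have e5 := mul_le_mul_of_nonneg_right e4 (show 0 ≤ K * X ^ 2 by positivity)
    have e6 : 0 ≤ c ^ 2 := sq_nonneg c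
    linarith

theorem abs_shifted_resonance_le (h : E ⊆ modSet s L₁ L₂ L) (hs : |s| = 1) (hK : 1024 ≤ K)
    (h₁ : 1 ≤ L₁) {p : (ℂ × ℝ) × (ℂ × ℝ)} (hp : p ∈ E)
    (hr₁ : K / 16 ≤ ‖p.1.1‖) (hr₂ : K / 16 ≤ ‖p.2.1‖) (hX : K / 128 ≤ ‖p.1.1 - p.2.1‖) {B : ℝ}
    (hB : |(p.1.1 * star (p.1.1 - p.2.1)).im| ≤ B * ‖p.1.1 - p.2.1‖) :
    |(‖p.1.1‖ - s / 2) ^ 2 - (‖p.2.1‖ + s / 2) ^ 2| ≤ 9 * modMax L₁ L₂ L + 43 * B ^ 2 / K := by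
  have hΛ : 0 ≤ modMax L₁ L₂ L := by linarith [le_modMax (L₁ := L₁) (L₂ := L₂) (L := L) |>.1]
  have hres := abs_resonance_le h hp
  have htri := norm_sub_le p.1.1 p.2.1
  have hc := four_mul_cross_sq p.1.1 p.2.1
  set X := ‖p.1.1 - p.2.1‖
  have hX0 : 0 < X := by linarith
  have key := sub_norm_le_of_cross hs.le hK hr₁ hr₂ hX htri hΛ (hc.trans (by ring)) hres
  have hB2 : (p.1.1 * star (p.1.1 - p.2.1)).im ^ 2 ≤ (B * X) ^ 2 :=
    sq_le_sq' (by linarith [(abs_le.1 hB).1]) (abs_le.1 hB).2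
  have key2 : ‖p.1.1‖ + ‖p.2.1‖ - X ≤ 3 * modMax L₁ L₂ L + 43 * B ^ 2 / K := by
    have hK0 : 0 < K := by linarith
    have : 43 * (p.1.1 * star (p.1.1 - p.2.1)).im ^ 2 ≤ 43 * B ^ 2 / K * (K * X ^ 2) := by
      have : 43 * B ^ 2 / K * (K * X ^ 2) = 43 * (B * X) ^ 2 := by field_simp
      linarith
    have : (‖p.1.1‖ + ‖p.2.1‖ - X) * (K * X ^ 2) ≤
        (3 * modMax L₁ L₂ L + 43 * B ^ 2 / K) * (K * X ^ 2) := by linarith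
    exact le_of_mul_le_mul_right this (by positivity)
  have e : (‖p.1.1‖ - s / 2) ^ 2 - (‖p.2.1‖ + s / 2) ^ 2 =
      (‖p.1.1‖ ^ 2 - ‖p.2.1‖ ^ 2 - s * X) - s * (‖p.1.1‖ + ‖p.2.1‖ - X) := by ring
  rw [e]
  refine (abs_sub _ _).trans ?_
  rw [abs_mul, hs, one_mul, abs_of_nonneg (show 0 ≤ ‖p.1.1‖ + ‖p.2.1‖ - X by linarith)]
  linarith

theorem SqBound.comparable_high (hE : MeasurableSet E) (h : E ⊆ modSet s L₁ L₂ L)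
    (hs : |s| = 1) (h₁ : 1 ≤ L₁) (h₂ : 1 ≤ L₂) (h₃ : 1 ≤ L) (hK : 1024 ≤ K)
    (hr : ∀ p ∈ E, K / 16 ≤ ‖p.1.1‖ ∧ ‖p.1.1‖ ≤ 2 * K ∧ K / 16 ≤ ‖p.2.1‖ ∧ ‖p.2.1‖ ≤ 2 * K)
    (hξ : ∀ p ∈ E, K / 128 ≤ ‖p.1.1 - p.2.1‖) :
    SqBound E (10 ^ 16 * (modProd L₁ L₂ L * √(modMax L₁ L₂ L) / K)) := by
  have hΛ : 1 ≤ modMax L₁ L₂ L := h₁.trans le_modMax.1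
  have hP := modProd_pos h₁ h₂ h₃
  have hK0 : 0 < K := by linarith
  set Λ := modMax L₁ L₂ L with hΛdef
  set P := modProd L₁ L₂ L
  have hσ : |s / 2| ≤ 1 / 2 := by rw [abs_div, hs]; norm_num
  let F : ℕ → Set ((ℂ × ℝ) × (ℂ × ℝ)) := fun i =>
    E ∩ {p | Λ ≤ K * ((1 / 2) ^ i) ^ 2 ∧
      K * (1 / 2) ^ i * ‖p.1.1 - p.2.1‖ ≤ |(p.1.1 * star (p.1.1 - p.2.1)).im| ∧
      |(p.1.1 * star (p.1.1 - p.2.1)).im| ≤ 2 * (K * (1 / 2) ^ i) * ‖p.1.1 - p.2.1‖}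
  let G : Set ((ℂ × ℝ) × (ℂ × ℝ)) :=
    E ∩ {p | |(p.1.1 * star (p.1.1 - p.2.1)).im| ≤ 2 * √(K * Λ) * ‖p.1.1 - p.2.1‖}
  have mF : ∀ i, MeasurableSet (F i) := fun i => by
    have m1 : MeasurableSet {p : (ℂ × ℝ) × (ℂ × ℝ) |
        K * (1 / 2) ^ i * ‖p.1.1 - p.2.1‖ ≤ |(p.1.1 * star (p.1.1 - p.2.1)).im|} :=
      measurableSet_le (by fun_prop) (by fun_prop)
    have m2 : MeasurableSet {p : (ℂ × ℝ) × (ℂ × ℝ) |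
        |(p.1.1 * star (p.1.1 - p.2.1)).im| ≤ 2 * (K * (1 / 2) ^ i) * ‖p.1.1 - p.2.1‖} :=
      measurableSet_le (by fun_prop) (by fun_prop)
    exact hE.inter ((MeasurableSet.const _).inter (m1.inter m2))
  have mG : MeasurableSet G := hE.inter (measurableSet_le (by fun_prop) (by fun_prop))
  have bF : ∀ i, SqBound (F i) (10 ^ 10 * 181 * 128 * (P / K) * (1 / 2) ^ i) := by
    intro i
    set t : ℝ := (1 / 2) ^ i
    have ht : 0 < t := by positivity
    refine (SqBound.of_res (σ := s / 2) (M := 181 * K * t ^ 2) (K := K) (β := K * t)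
      (ν := K / 128) (D := 181 * t) (mF i) (Set.inter_subset_left.trans h) hs.le h₁ h₂ h₃ hσ
      (by positivity) (by linarith) (by positivity) (by positivity) (by linarith) (by positivity)
      (.inr (le_of_eq (by ring))) (fun p hp => hr p hp.1) (fun p hp => hξ p hp.1)
      (fun p hp => ?_) (fun p hp => hp.2.2.1)).mono le_rfl (le_of_eq ?_)
    · refine (abs_shifted_resonance_le h hs hK h₁ hp.1 (hr p hp.1).1 (hr p hp.1).2.2.1
        (hξ p hp.1) hp.2.2.2).trans ?_
      have e : 43 * (2 * (K * t)) ^ 2 / K = 172 * (K * t ^ 2) := by field_simp; ring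
      have := hp.2.1
      rw [e]
      linarith
    · change 10 ^ 10 * (P * (181 * t) / (K / 128)) = _
      field_simp
  have bG : SqBound G (10 ^ 10 * 14 * 128 * (P * √Λ / K)) := by
    refine (SqBound.of_res (σ := s / 2) (M := 181 * Λ) (K := K) (β := 0)
      (ν := K / 128) (D := 14 * √Λ) mG (Set.inter_subset_left.trans h) hs.le h₁ h₂ h₃ hσ
      (by positivity) (by linarith) le_rfl (by positivity) (by linarith) (by positivity)
      (.inl ?_) (fun p hp => hr p hp.1) (fun p hp => hξ p hp.1)
      (fun p hp => ?_) (fun p hp => ?_)).mono le_rfl (le_of_eq ?_)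
    · rw [mul_pow, Real.sq_sqrt (by linarith)]; linarith
    · refine (abs_shifted_resonance_le h hs hK h₁ hp.1 (hr p hp.1).1 (hr p hp.1).2.2.1
        (hξ p hp.1) hp.2).trans ?_
      have e : 43 * (2 * √(K * Λ)) ^ 2 / K = 172 * Λ := by
        rw [mul_pow, Real.sq_sqrt (by positivity)]; field_simp; ring
      rw [e]
      linarith
    · rw [zero_mul]; exact abs_nonneg _
    · change 10 ^ 10 * (P * (14 * √Λ) / (K / 128)) = _
      field_simp
  have bF' := SqBound.iUnion_geometric (by positivity) bF
  have cover : E ⊆ (⋃ i, F i) ∪ G := by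
    intro p hp
    by_cases hc : |(p.1.1 * star (p.1.1 - p.2.1)).im| ≤ 2 * √(K * Λ) * ‖p.1.1 - p.2.1‖
    · exact .inr ⟨hp, hc⟩
    left
    push Not at hc
    have hX0 : 0 < ‖p.1.1 - p.2.1‖ := by linarith [hξ p hp]
    have hle : |(p.1.1 * star (p.1.1 - p.2.1)).im| ≤ 2 * K * ‖p.1.1 - p.2.1‖ := by
      refine (Complex.abs_im_le_norm _).trans ?_
      rw [norm_mul, norm_star]
      exact mul_le_mul_of_nonneg_right (hr p hp).2.1 hX0.le
    set c := |(p.1.1 * star (p.1.1 - p.2.1)).im| with hcdef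
    set X := ‖p.1.1 - p.2.1‖ with hXdef
    have hc0 : 0 < c := lt_of_le_of_lt (by positivity) hc
    obtain ⟨i, hi1, hi2⟩ := exists_nat_pow_near_of_lt_one (x := c / (2 * K * X)) (y := 1 / 2)
      (by positivity) ((div_le_one (by positivity)).2 hle) (by norm_num) (by norm_num)
    rw [lt_div_iff₀ (by positivity), pow_succ] at hi1
    rw [div_le_iff₀ (by positivity)] at hi2
    have hi2' : c ≤ 2 * (K * (1 / 2) ^ i) * X := by linarith
    refine Set.mem_iUnion.2 ⟨i, hp, ?_, by linarith, hi2'⟩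
    have h1 : 2 * √(K * Λ) ≤ 2 * (K * (1 / 2) ^ i) := le_of_mul_le_mul_right (hc.le.trans hi2') hX0
    have h2 : K * Λ ≤ (K * (1 / 2) ^ i) ^ 2 := by
      rw [← Real.sq_sqrt (show 0 ≤ K * Λ by positivity)]
      exact pow_le_pow_left₀ (by positivity) (by linarith) 2
    refine le_of_mul_le_mul_left (h2.trans (le_of_eq ?_)) hK0
    ring
  refine (bF'.union bG).mono cover ?_
  have hsq : 1 ≤ √Λ := Real.one_le_sqrt.2 hΛ
  have e1 : P / K ≤ P * √Λ / K := by
    gcongr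
    exact le_mul_of_one_le_right hP.le hsq
  have e2 : 0 < P / K := by positivity
  rw [max_eq_left (by positivity), max_eq_left (by positivity)]
  linarith

end HighWaveFrequency

section SeparatedFrequencies

variable {E : Set ((ℂ × ℝ) × (ℂ × ℝ))} {s L₁ L₂ L N₁ N₂ R : ℝ}

theorem max_add_le {a b : ℝ} : a + b ≤ 2 * max a b := by
  linarith [le_max_left a b, le_max_right a b]

theorem SqBound.of_ring_snd (hE : MeasurableSet E) (h : E ⊆ modSet s L₁ L₂ L) (hs : |s| ≤ 1)
    (h₂ : 0 ≤ L₂) (h₃ : 0 ≤ L) (hR : 8 ≤ R)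
    (hr : ∀ p ∈ E, R / 2 ≤ ‖p.2.1‖ ∧ ‖p.2.1‖ ≤ 2 * R) : SqBound E (2048 * (L₂ * L)) := by
  have hmm : max L₂ L * min L₂ L = L₂ * L := max_mul_min _ _
  have hm0 : 0 ≤ max L₂ L := h₂.trans (le_max_left _ _)
  rw [← hmm, show 2048 * (max L₂ L * min L₂ L) = 4 * (512 * max L₂ L) * min L₂ L by ring]
  refine SqBound.of_fst_area hE h h₂ h₃ (by positivity) fun a => ?_
  refine ⟨{z | |a.2 + ‖z‖ ^ 2 + s * ‖a.1 - z‖| ≤ 2 * (L₂ + L)} ∩ {z | R / 2 ≤ ‖z‖} ∩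
    {z | ‖z‖ ≤ 2 * R}, fun y hy => ?_, ?_⟩
  · obtain ⟨-, k2, k3⟩ := h hy
    refine ⟨⟨?_, (hr _ hy).1⟩, (hr _ hy).2⟩
    rw [Set.mem_ofPred_eq]
    have e : a.2 + ‖y.1‖ ^ 2 + s * ‖a.1 - y.1‖ =
      (y.2 + ‖y.1‖ ^ 2) + (a.2 - y.2 + s * ‖a.1 - y.1‖) := by ring
    rw [e]
    refine (abs_add_le _ _).trans ?_
    simp only at k2 k3
    linarith
  · have m1 : MeasurableSet {z : ℂ | |a.2 + ‖z‖ ^ 2 + s * ‖a.1 - z‖| ≤ 2 * (L₂ + L)} :=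
      measurableSet_le (by fun_prop) (by fun_prop)
    have m2 : MeasurableSet {z : ℂ | R / 2 ≤ ‖z‖} := measurableSet_le (by fun_prop) (by fun_prop)
    have m3 : MeasurableSet {z : ℂ | ‖z‖ ≤ 2 * R} := measurableSet_le (by fun_prop) (by fun_prop)
    have hd : ∀ z z' : ℂ, ‖z‖ ≤ 2 * R → ‖z'‖ ≤ 2 * R → ‖z - z'‖ ≤ 4 * R := fun z z' hz hz' => by
      linarith [norm_sub_le z z']
    refine (volume_ring_le (r₀ := R / 2) (m := 2 * (L₂ + L)) (ℓ := 4 * R) ((m1.inter m2).inter m3)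
      (by linarith) (by linarith) (by linarith) (fun z hz => hz.1.2)
      (fun z hz z' hz' => ?_) (fun z hz z' hz' => ?_)
      (abs_norm_sq_sub_le_of_wave hs fun z hz => hz.1.1)).trans ?_
    · exact (Complex.abs_re_le_norm (z - z')).trans (hd z z' hz.2 hz'.2)
    · exact (Complex.abs_im_le_norm (z - z')).trans (hd z z' hz.2 hz'.2)
    · refine ENNReal.ofReal_le_ofReal ?_
      have hR0 : 0 < R := by linarith
      have e : 16 * (4 * R) * (2 * (L₂ + L)) / (R / 2) = 256 * (L₂ + L) := by field_simp; ring
      rw [e]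
      linarith [max_add_le (a := L₂) (b := L)]

theorem SqBound.of_strip (hE : MeasurableSet E) (h : E ⊆ modSet s L₁ L₂ L)
    (h₁ : 0 ≤ L₁) (h₂ : 0 ≤ L₂) (hN₁ : 0 ≤ N₁) (hN₂ : 0 < N₂) (hN : N₁ ≤ N₂)
    (hr : ∀ p ∈ E, ‖p.1.1‖ ≤ N₁) (hξ : ∀ p ∈ E, N₂ ≤ ‖p.1.1 - p.2.1‖) :
    SqBound E (32 * (L₁ * L₂)) := by
  have hmm : max L₁ L₂ * min L₁ L₂ = L₁ * L₂ := max_mul_min _ _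
  have hm0 : 0 ≤ max L₁ L₂ := h₁.trans (le_max_left _ _)
  rw [← hmm, show 32 * (max L₁ L₂ * min L₁ L₂) = 4 * (8 * max L₁ L₂) * min L₁ L₂ by ring]
  refine SqBound.of_diff_area hE h h₁ h₂ (by positivity) fun w => ?_
  by_cases hw : N₂ ≤ ‖w.1‖
  swap
  · refine ⟨∅, fun y hy => hw ?_, by simp⟩
    simpa using hξ _ hy
  have hw0 : 0 < ‖w.1‖ := hN₂.trans_le hw
  have hne : w.1 ≠ 0 := norm_pos_iff.1 hw0
  refine ⟨{z | |w.2 + (‖w.1 + z‖ ^ 2 - ‖z‖ ^ 2)| ≤ 2 * (L₁ + L₂)} ∩ {z | ‖w.1 + z‖ ≤ N₁},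
    fun y hy => ?_, ?_⟩
  · obtain ⟨k1, k2, -⟩ := h hy
    refine ⟨?_, hr _ hy⟩
    rw [Set.mem_ofPred_eq]
    simp only [Prod.fst_add, Prod.snd_add] at k1 k2
    have e : w.2 + (‖w.1 + y.1‖ ^ 2 - ‖y.1‖ ^ 2) =
      (w.2 + y.2 + ‖w.1 + y.1‖ ^ 2) - (y.2 + ‖y.1‖ ^ 2) := by ring
    rw [e]
    refine (abs_sub _ _).trans ?_
    linarith
  · have m1 : MeasurableSet {z : ℂ | |w.2 + (‖w.1 + z‖ ^ 2 - ‖z‖ ^ 2)| ≤ 2 * (L₁ + L₂)} :=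
      measurableSet_le (by fun_prop) (by fun_prop)
    have m2 : MeasurableSet {z : ℂ | ‖w.1 + z‖ ≤ N₁} :=
      measurableSet_le (by fun_prop) (by fun_prop)
    set e : ℂ := w.1 / (‖w.1‖ : ℂ) with he
    have hen : ‖e‖ = 1 := by
      rw [he, norm_div, Complex.norm_real, norm_norm, div_self hw0.ne']
    have key : ∀ z : ℂ, ‖w.1 + z‖ ^ 2 - ‖z‖ ^ 2 = ‖w.1‖ ^ 2 + 2 * ‖w.1‖ * (z * star e).re := by
      intro z
      have : w.1 = (‖w.1‖ : ℂ) * e := by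
        rw [he, mul_div_cancel₀ _ (Complex.ofReal_ne_zero.2 hw0.ne')]
      have h2 : (z * star w.1).re = ‖w.1‖ * (z * star e).re := by
        conv_lhs => rw [this]
        simp
        ring
      rw [mul_assoc, ← h2, ← Complex.normSq_eq_norm_sq, ← Complex.normSq_eq_norm_sq,
        ← Complex.normSq_eq_norm_sq, Complex.normSq_apply, Complex.normSq_apply,
        Complex.normSq_apply]
      simp
      ring
    have hd : ∀ z z' : ℂ, ‖w.1 + z‖ ≤ N₁ → ‖w.1 + z'‖ ≤ N₁ → ‖z - z'‖ ≤ 2 * N₁ :=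
      fun z z' hz hz' => by
        have := norm_sub_le (w.1 + z) (w.1 + z')
        rw [add_sub_add_left_eq_sub] at this
        linarith
    refine (complex_volume_le_rotate (m1.inter m2) hen (p := 2 * (L₁ + L₂) / ‖w.1‖) (q := 2 * N₁)
      (by positivity) (fun z hz z' hz' => ?_) (fun z hz z' hz' _ => ?_)).trans ?_
    · have a := hz.1
      have b := hz'.1
      rw [Set.mem_ofPred_eq, key, abs_le] at a b
      rw [le_div_iff₀ hw0]
      nth_rw 1 [← abs_of_pos hw0]
      rw [← abs_mul, abs_le]
      constructor <;> linarith [a.1, a.2, b.1, b.2]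
    · have := Complex.abs_im_le_norm ((z - z') * star e)
      rw [norm_mul, norm_star, hen, mul_one, sub_mul, Complex.sub_im] at this
      exact this.trans (hd z z' hz.2 hz'.2)
    · refine ENNReal.ofReal_le_ofReal ?_
      rw [div_mul_eq_mul_div, div_le_iff₀ hw0]
      have a := max_add_le (a := L₁) (b := L₂)
      calc 2 * (L₁ + L₂) * (2 * N₁) ≤ 2 * (2 * max L₁ L₂) * (2 * ‖w.1‖) := by
            gcongr; exact hN.trans hw
        _ = _ := by ring

theorem SqBound.high_low (hE : MeasurableSet E) (h : E ⊆ modSet s L₁ L₂ L) (hs : |s| ≤ 1)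
    (h₁ : 1 ≤ L₁) (h₂ : 1 ≤ L₂) (h₃ : 1 ≤ L) (hN₁ : 8 ≤ N₁) (hN : 8 * N₁ ≤ N₂)
    (hr₁ : ∀ p ∈ E, N₁ / 2 ≤ ‖p.1.1‖ ∧ ‖p.1.1‖ ≤ 2 * N₁)
    (hr₂ : ∀ p ∈ E, N₂ / 2 ≤ ‖p.2.1‖ ∧ ‖p.2.1‖ ≤ 2 * N₂) :
    SqBound E (2048 * modProd L₁ L₂ L) := by
  rcases modProd_eq h₁ h₂ h₃ with e | e | e <;> rw [e]
  · refine (SqBound.of_strip (N₁ := 2 * N₁) (N₂ := 2 * N₁) hE h (by linarith) (by linarith)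
      (by linarith) (by linarith) le_rfl (fun p hp => (hr₁ p hp).2) fun p hp => ?_).mono le_rfl ?_
    · have := norm_sub_norm_le p.2.1 p.1.1
      rw [norm_sub_rev] at this
      linarith [(hr₁ p hp).2, (hr₂ p hp).1]
    · have : 0 ≤ L₁ * L₂ := by positivity
      linarith
  · exact SqBound.of_swap hE (SqBound.of_ring_snd (s := -s) (measurable_swap hE)
      (swap_subset_modSet h) (by rwa [abs_neg]) (by linarith) (by linarith) hN₁
      fun p hp => hr₁ _ hp)
  · exact SqBound.of_ring_snd hE h hs (by linarith) (by linarith) (by linarith) hr₂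

end SeparatedFrequencies

section DyadicBlocks

/-- The dyadic band of nonnegative reals supporting the `n`-th cutoff. -/
def dyBand (n : ℕ) (r : ℝ) : Prop := r ≤ 2 * 2 ^ n ∧ (1 ≤ n → 2 ^ n / 2 ≤ r)

/-- Pairs of frequencies localised to dyadic frequencies and modulations. -/
def dyBlock (s : ℝ) (n n₁ n₂ l l₁ l₂ : ℕ) : Set ((ℂ × ℝ) × (ℂ × ℝ)) :=
  modSet s (2 ^ l₁) (2 ^ l₂) (2 ^ l) ∩
    {p | dyBand n₁ ‖p.1.1‖ ∧ dyBand n₂ ‖p.2.1‖ ∧ dyBand n ‖p.1.1 - p.2.1‖}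

theorem measurableSet_dyBand (n : ℕ) : MeasurableSet {r | dyBand n r} := by
  simp only [dyBand, Set.ofPred_and]
  have h2 : MeasurableSet {r : ℝ | r ≤ 2 * 2 ^ n} := measurableSet_Iic
  refine h2.inter ?_
  by_cases h : 1 ≤ n
  · have h3 : MeasurableSet {r : ℝ | 2 ^ n / 2 ≤ r} := measurableSet_Ici
    simpa [h] using h3
  · simp [h]

theorem measurableSet_modSet (s L₁ L₂ L : ℝ) : MeasurableSet (modSet s L₁ L₂ L) := by
  simp only [modSet, Set.ofPred_and]
  repeat' apply MeasurableSet.inter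
  all_goals exact measurableSet_le (by fun_prop) (by fun_prop)

theorem measurableSet_dyBlock (s : ℝ) (n n₁ n₂ l l₁ l₂ : ℕ) :
    MeasurableSet (dyBlock s n n₁ n₂ l l₁ l₂) := by
  refine (measurableSet_modSet _ _ _ _).inter ?_
  simp only [Set.ofPred_and]
  have h1 : Measurable fun p : (ℂ × ℝ) × (ℂ × ℝ) => ‖p.1.1‖ := by fun_prop
  have h2 : Measurable fun p : (ℂ × ℝ) × (ℂ × ℝ) => ‖p.2.1‖ := by fun_prop
  have h3 : Measurable fun p : (ℂ × ℝ) × (ℂ × ℝ) => ‖p.1.1 - p.2.1‖ := by fun_prop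
  exact (h1 (measurableSet_dyBand n₁)).inter ((h2 (measurableSet_dyBand n₂)).inter
    (h3 (measurableSet_dyBand n)))

theorem exists_sorted_exponents (l₁ l₂ l : ℕ) : ∃ a b c : ℝ, 0 ≤ a ∧ a ≤ b ∧ b ≤ c ∧
    a + b + c = l₁ + l₂ + l ∧ modMax (2 ^ l₁) (2 ^ l₂) (2 ^ l) = 2 ^ c ∧
    modProd (2 ^ l₁) (2 ^ l₂) (2 ^ l) = 2 ^ (a + b) ∧
    min (min ((2 : ℝ) ^ l₁) (2 ^ l₂)) (2 ^ l) = 2 ^ a := by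
  have mono : ∀ i j : ℕ, i ≤ j → (2 : ℝ) ^ i ≤ 2 ^ j := fun i j h =>
    pow_le_pow_right₀ (by norm_num) h
  have prod : ∀ i j m : ℕ, i + j + m = l₁ + l₂ + l → modMax (2 ^ l₁) (2 ^ l₂) (2 ^ l) = 2 ^ m →
      modProd (2 ^ l₁) (2 ^ l₂) (2 ^ l) = (2 : ℝ) ^ ((i : ℝ) + (j : ℝ)) := by
    intro i j m h h'
    rw [modProd, h', ← pow_add, ← pow_add, ← h, pow_add, mul_div_cancel_right₀ _ (by positivity),
      ← Nat.cast_add, Real.rpow_natCast]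
  have aux : ∀ i j k : ℕ, i ≤ j → j ≤ k → i + j + k = l₁ + l₂ + l →
      modMax (2 ^ l₁) (2 ^ l₂) (2 ^ l) = (2 : ℝ) ^ k →
      min (min ((2 : ℝ) ^ l₁) (2 ^ l₂)) (2 ^ l) = 2 ^ i →
      ∃ a b c : ℝ, 0 ≤ a ∧ a ≤ b ∧ b ≤ c ∧
      a + b + c = l₁ + l₂ + l ∧ modMax (2 ^ l₁) (2 ^ l₂) (2 ^ l) = 2 ^ c ∧
      modProd (2 ^ l₁) (2 ^ l₂) (2 ^ l) = 2 ^ (a + b) ∧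
      min (min ((2 : ℝ) ^ l₁) (2 ^ l₂)) (2 ^ l) = 2 ^ a := by
    intro i j k h1 h2 h3 h4 h5
    refine ⟨i, j, k, by positivity, by exact_mod_cast h1, by exact_mod_cast h2,
      by exact_mod_cast h3, ?_, prod i j k h3 h4, ?_⟩
    · rw [h4, Real.rpow_natCast]
    · rw [h5, Real.rpow_natCast]
  rcases le_total l₁ l₂ with h | h <;> rcases le_total l₂ l with h' | h' <;>
    rcases le_total l₁ l with h'' | h''
  · exact aux l₁ l₂ l h h' (by ring) (by simp [modMax, mono _ _ h, mono _ _ h'])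
      (by simp [mono _ _ h, mono _ _ h''])
  · exact aux l₁ l₂ l h h' (by ring) (by simp [modMax, mono _ _ h, mono _ _ h'])
      (by simp [mono _ _ h, mono _ _ (h.trans h')])
  · exact aux l₁ l l₂ h'' h' (by ring) (by simp [modMax, mono _ _ h, mono _ _ h'])
      (by simp [mono _ _ h, mono _ _ h''])
  · exact aux l l₁ l₂ h'' h (by ring) (by simp [modMax, mono _ _ h, mono _ _ h'])
      (by simp [mono _ _ h, mono _ _ h''])
  · exact aux l₂ l₁ l h h'' (by ring) (by simp [modMax, mono _ _ h, mono _ _ h''])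
      (by simp [mono _ _ h, mono _ _ h'])
  · exact aux l₂ l l₁ h' h'' (by ring) (by simp [modMax, mono _ _ h, mono _ _ h''])
      (by simp [mono _ _ h, mono _ _ h'])
  · exact aux l l₂ l₁ h' h (by ring)
      (by simp [modMax, mono _ _ h, mono _ _ (h'.trans h)]) (by simp [mono _ _ h, mono _ _ h'])
  · exact aux l l₂ l₁ h' h (by ring)
      (by simp [modMax, mono _ _ h, mono _ _ h'']) (by simp [mono _ _ h, mono _ _ h'])

end DyadicBlocks

section DyadicBlockBounds

theorem two_rpow_le {x y : ℝ} (h : x ≤ y) : (2 : ℝ) ^ x ≤ 2 ^ y :=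
  Real.rpow_le_rpow_of_exponent_le (by norm_num) h

theorem le_of_two_rpow_le {x y : ℝ} (h : (2 : ℝ) ^ x ≤ 2 ^ y) : x ≤ y :=
  (Real.rpow_le_rpow_left_iff (by norm_num)).1 h

theorem ten_pow_le_rpow : (10 : ℝ) ^ 10 ≤ 2 ^ (34 : ℝ) ∧ (10 : ℝ) ^ 16 ≤ 2 ^ (54 : ℝ) := by
  constructor <;> norm_num

variable {E : Set ((ℂ × ℝ) × (ℂ × ℝ))} {s : ℝ} {n n₁ n₂ l l₁ l₂ : ℕ}

theorem SqBound.of_empty {x : ℝ} (hx : 0 ≤ x) (h : ∀ p, p ∉ E) : SqBound E x := by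
  rw [Set.eq_empty_iff_forall_notMem.2 h]
  exact SqBound.of_fst MeasurableSet.empty hx (by simp)

theorem SqBound.dyBlock_trivial (hE : MeasurableSet E) (h : E ⊆ modSet s (2 ^ l₁) (2 ^ l₂) (2 ^ l))
    {a e y : ℝ} (ha : min (min ((2 : ℝ) ^ l₁) (2 ^ l₂)) (2 ^ l) = 2 ^ a)
    (hb : (∀ p ∈ E, ‖p.1.1‖ ≤ 2 ^ e) ∨ (∀ p ∈ E, ‖p.2.1‖ ≤ 2 ^ e) ∨
      ∀ p ∈ E, ‖p.1.1 - p.2.1‖ ≤ 2 ^ e) (hy : 4 + 2 * e + a ≤ y) : SqBound E (2 ^ y) := by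
  have key : 16 * ((2 : ℝ) ^ e) ^ 2 * min (min ((2 : ℝ) ^ l₁) (2 ^ l₂)) (2 ^ l) ≤ 2 ^ y := by
    rw [ha, ← Real.rpow_mul_natCast (by norm_num), show (16 : ℝ) = 2 ^ (4 : ℝ) by norm_num,
      ← Real.rpow_add two_pos, ← Real.rpow_add two_pos]
    exact two_rpow_le (by push_cast; linarith)
  rcases hb with hb | hb | hb
  · exact (SqBound.of_norm_fst_le hE h (by positivity) (by positivity) (by positivity)
      (by positivity) hb).mono le_rfl key
  · exact (SqBound.of_norm_snd_le hE h (by positivity) (by positivity) (by positivity)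
      (by positivity) hb).mono le_rfl key
  · exact (SqBound.of_norm_sub_le hE h (by positivity) (by positivity) (by positivity)
      (by positivity) hb).mono le_rfl key

/-- The exponent in the bound for a dyadic block. -/
def dyExponent (n n₁ n₂ l l₁ l₂ : ℕ) : ℝ :=
  5 / 6 * (l₁ + l₂ + l) - n - (|(n : ℝ) - n₁| + |(n : ℝ) - n₂|) / 8 + 100

theorem dyBlock_high_low (hs : |s| ≤ 1) (hn : n₁ + 4 ≤ n₂) :
    SqBound (dyBlock s n n₁ n₂ l l₁ l₂) (2 ^ dyExponent n n₁ n₂ l l₁ l₂) := by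
  obtain ⟨a, b, c, h0, hab, hbc, hS, hmax, hprod, hmin⟩ := exists_sorted_exponents l₁ l₂ l
  have mE := measurableSet_dyBlock s n n₁ n₂ l l₁ l₂
  have hE : dyBlock s n n₁ n₂ l l₁ l₂ ⊆ modSet s (2 ^ l₁) (2 ^ l₂) (2 ^ l) :=
    Set.inter_subset_left
  have one : ∀ i : ℕ, (1 : ℝ) ≤ 2 ^ i := fun i => one_le_pow₀ (by norm_num)
  rcases (dyBlock s n n₁ n₂ l l₁ l₂).eq_empty_or_nonempty with he | ⟨p, hp⟩
  · exact SqBound.of_empty (by positivity) (by simp [he])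
  have hN : (16 : ℝ) * 2 ^ n₁ ≤ 2 ^ n₂ := by
    have := pow_le_pow_right₀ (show (1 : ℝ) ≤ 2 by norm_num) hn
    rw [pow_add] at this
    linarith
  have hN₂ : (16 : ℝ) ≤ 2 ^ n₂ := by linarith [one n₁]
  have hr₁ : ‖p.1.1‖ ≤ 2 * 2 ^ n₁ := hp.2.1.1
  have hr₂ : 2 ^ n₂ / 2 ≤ ‖p.2.1‖ := hp.2.2.1.2 (by omega)
  have hr₂' : ‖p.2.1‖ ≤ 2 * 2 ^ n₂ := hp.2.2.1.1
  have hX1 := norm_sub_norm_le p.2.1 p.1.1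
  have hX2 := norm_sub_le p.1.1 p.2.1
  rw [norm_sub_rev] at hX1
  have hup : n ≤ n₂ + 2 := by
    by_contra hcon
    have h1 : 2 ^ n / 2 ≤ ‖p.1.1 - p.2.1‖ := hp.2.2.2.2 (by omega)
    have h2 := pow_le_pow_right₀ (show (1 : ℝ) ≤ 2 by norm_num) (show n₂ + 3 ≤ n by omega)
    rw [pow_add] at h2
    linarith
  have hlow : n₂ ≤ n + 2 := by
    by_contra hcon
    have h1 : ‖p.1.1 - p.2.1‖ ≤ 2 * 2 ^ n := hp.2.2.2.1
    have h2 := pow_le_pow_right₀ (show (1 : ℝ) ≤ 2 by norm_num) (show n + 3 ≤ n₂ by omega)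
    rw [pow_add] at h2
    linarith
  have hc : 2 * (n₂ : ℝ) - 6 ≤ c := by
    refine le_of_two_rpow_le ?_
    rw [← hmax, Real.rpow_sub two_pos, mul_comm, Real.rpow_mul (by norm_num), Real.rpow_natCast]
    have h1 := abs_resonance_le hE hp
    have h2 : |s * ‖p.1.1 - p.2.1‖| ≤ ‖p.1.1 - p.2.1‖ := by
      rw [abs_mul, abs_norm]
      exact mul_le_of_le_one_left (norm_nonneg _) hs
    have h3 : ‖p.1.1‖ ^ 2 ≤ (2 ^ n₂ / 8) ^ 2 := by gcongr; linarith
    have h4 : (2 ^ n₂ / 2) ^ 2 ≤ ‖p.2.1‖ ^ 2 := by gcongr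
    have h5 : (16 : ℝ) * 2 ^ n₂ ≤ (2 ^ n₂) ^ 2 := by
      rw [sq]; exact mul_le_mul_of_nonneg_right hN₂ (by positivity)
    rw [abs_le] at h1 h2
    norm_num
    rw [div_le_iff₀ (by norm_num)]
    linarith [h1.1, h2.2]
  have hc1 : |(n : ℝ) - n₂| ≤ 2 := by
    rw [abs_le]
    constructor
    · have : (n₂ : ℝ) ≤ n + 2 := by exact_mod_cast hlow
      linarith
    · have : (n : ℝ) ≤ n₂ + 2 := by exact_mod_cast hup
      linarith
  have hc2 : |(n : ℝ) - n₁| ≤ n₂ - n₁ + 2 := by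
    have := abs_sub_le (n : ℝ) n₂ n₁
    have h3 : (n₁ : ℝ) + 4 ≤ n₂ := by exact_mod_cast hn
    rw [abs_of_nonneg (show (0 : ℝ) ≤ (n₂ : ℝ) - n₁ by linarith)] at this
    linarith
  have hnn : (n : ℝ) ≤ n₂ + 2 := by exact_mod_cast hup
  have hn0 : (0 : ℝ) ≤ n₁ := by positivity
  have hn4 : (n₁ : ℝ) + 4 ≤ n₂ := by exact_mod_cast hn
  have htar : 5 / 6 * (a + b + c) - n₂ - 2 - (n₂ - n₁ + 4) / 8 + 100 ≤
      dyExponent n n₁ n₂ l l₁ l₂ := by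
    unfold dyExponent; rw [hS]; linarith
  set y := dyExponent n n₁ n₂ l l₁ l₂
  by_cases hsm : 4 + 2 * ((n₁ : ℝ) + 1) + a ≤ y
  · refine SqBound.dyBlock_trivial mE hE hmin (.inl fun q hq => ?_) hsm
    rw [Real.rpow_add two_pos, Real.rpow_natCast, Real.rpow_one, mul_comm]
    exact hq.2.1.1
  · push Not at hsm
    have hn1 : 3 ≤ n₁ := by
      by_contra hcon
      have : (n₁ : ℝ) ≤ 2 := by exact_mod_cast (by omega : n₁ ≤ 2)
      linarith
    have h8 : (8 : ℝ) ≤ 2 ^ n₁ := by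
      have := pow_le_pow_right₀ (show (1 : ℝ) ≤ 2 by norm_num) hn1
      linarith
    refine (SqBound.high_low mE hE hs (one _) (one _) (one _) h8 (by linarith)
      (fun q hq => ⟨hq.2.1.2 (by omega), hq.2.1.1⟩)
      (fun q hq => ⟨hq.2.2.1.2 (by omega), hq.2.2.1.1⟩)).mono le_rfl ?_
    rw [hprod, show (2048 : ℝ) = 2 ^ (11 : ℝ) by norm_num, ← Real.rpow_add two_pos]
    exact two_rpow_le (by linarith)

end DyadicBlockBounds

section ComparableBlocks

variable {s : ℝ} {n n₁ n₂ l l₁ l₂ : ℕ} {E : Set ((ℂ × ℝ) × (ℂ × ℝ))} {a b c y : ℝ}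

theorem abs_exponent_sub_le (h₁ : n ≤ n₁ + 6) (h₂ : n₁ ≤ n + 6) (h₃ : n ≤ n₂ + 6)
    (h₄ : n₂ ≤ n + 6) : |(n : ℝ) - n₁| + |(n : ℝ) - n₂| ≤ 12 := by
  have e₁ : (n : ℝ) ≤ n₁ + 6 := by exact_mod_cast h₁
  have e₂ : (n₁ : ℝ) ≤ n + 6 := by exact_mod_cast h₂
  have e₃ : (n : ℝ) ≤ n₂ + 6 := by exact_mod_cast h₃
  have e₄ : (n₂ : ℝ) ≤ n + 6 := by exact_mod_cast h₄
  have a₁ : |(n : ℝ) - n₁| ≤ 6 := abs_le.2 ⟨by linarith, by linarith⟩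
  have a₂ : |(n : ℝ) - n₂| ≤ 6 := abs_le.2 ⟨by linarith, by linarith⟩
  linarith

theorem SqBound.rpow_comparable_high (hE : MeasurableSet E)
    (h : E ⊆ modSet s (2 ^ l₁) (2 ^ l₂) (2 ^ l)) (hs : |s| = 1) (hn : 10 ≤ n₂)
    (hmax : modMax (2 ^ l₁) (2 ^ l₂) (2 ^ l) = (2 : ℝ) ^ c)
    (hprod : modProd (2 ^ l₁) (2 ^ l₂) (2 ^ l) = (2 : ℝ) ^ (a + b))
    (hr : ∀ p ∈ E, (2 : ℝ) ^ n₂ / 16 ≤ ‖p.1.1‖ ∧ ‖p.1.1‖ ≤ 2 * 2 ^ n₂ ∧ 2 ^ n₂ / 16 ≤ ‖p.2.1‖ ∧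
      ‖p.2.1‖ ≤ 2 * 2 ^ n₂)
    (hξ : ∀ p ∈ E, 2 ^ n₂ / 128 ≤ ‖p.1.1 - p.2.1‖) (hy : 54 + (a + b) + c / 2 - n₂ ≤ y) :
    SqBound E (2 ^ y) := by
  have one : ∀ i : ℕ, (1 : ℝ) ≤ 2 ^ i := fun i => one_le_pow₀ (by norm_num)
  have hK := pow_le_pow_right₀ (show (1 : ℝ) ≤ 2 by norm_num) hn
  norm_num1 at hK
  refine (SqBound.comparable_high hE h hs (one _) (one _) (one _) hK hr hξ).mono le_rfl ?_
  rw [hmax, hprod, Real.sqrt_eq_rpow, ← Real.rpow_mul (by norm_num), ← Real.rpow_natCast 2 n₂,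
    ← Real.rpow_add two_pos, ← Real.rpow_sub two_pos]
  refine (mul_le_mul_of_nonneg_right ten_pow_le_rpow.2 (by positivity)).trans ?_
  rw [← Real.rpow_add two_pos]
  exact two_rpow_le (by linarith)

theorem SqBound.rpow_comparable_transversal (hE : MeasurableSet E)
    (h : E ⊆ modSet s (2 ^ l₁) (2 ^ l₂) (2 ^ l)) (hs : |s| ≤ 1) (hn : 10 ≤ n₂)
    (hmax : modMax (2 ^ l₁) (2 ^ l₂) (2 ^ l) = (2 : ℝ) ^ c)
    (hprod : modProd (2 ^ l₁) (2 ^ l₂) (2 ^ l) = (2 : ℝ) ^ (a + b)) {v w m : ℝ}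
    (hvK : (2 : ℝ) ^ v ≤ 8 * 2 ^ n₂)
    (hsmall : 1 + 6 * (2 : ℝ) ^ c / 2 ^ v + 2 ^ w ≤ 2 ^ n₂ / 16)
    (hr : ∀ p ∈ E, (2 : ℝ) ^ n₂ / 16 ≤ ‖p.1.1‖ ∧ ‖p.1.1‖ ≤ 2 * 2 ^ n₂ ∧ 2 ^ n₂ / 16 ≤ ‖p.2.1‖ ∧
      ‖p.2.1‖ ≤ 2 * 2 ^ n₂)
    (hξ : ∀ p ∈ E, (2 : ℝ) ^ v ≤ ‖p.1.1 - p.2.1‖) (hξw : ∀ p ∈ E, ‖p.1.1 - p.2.1‖ ≤ 2 ^ w)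
    (hwm : w ≤ m) (hcm : c ≤ m) (hy : 42 + (a + b) + m - n₂ - v ≤ y) :
    SqBound E (2 ^ y) := by
  have one : ∀ i : ℕ, (1 : ℝ) ≤ 2 ^ i := fun i => one_le_pow₀ (by norm_num)
  have hK := pow_le_pow_right₀ (show (1 : ℝ) ≤ 2 by norm_num) hn
  refine (SqBound.comparable_transversal hE h hs (one _) (one _) (one _) (by linarith)
    (by positivity) hvK (by positivity) (by rwa [hmax]) hr hξ hξw).mono le_rfl ?_
  have hM : (2 : ℝ) ^ w + 6 * 2 ^ c ≤ 2 ^ (m + 3) := by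
    rw [Real.rpow_add two_pos]
    have := two_rpow_le hwm
    have := two_rpow_le hcm
    have : (0 : ℝ) < 2 ^ m := by positivity
    norm_num
    linarith
  rw [hmax, hprod]
  calc (10 : ℝ) ^ 10 * (2 ^ (a + b) * (32 * (2 ^ w + 6 * 2 ^ c) / 2 ^ n₂) / 2 ^ v)
      ≤ 2 ^ (34 : ℝ) * (2 ^ (a + b) * (2 ^ (5 : ℝ) * 2 ^ (m + 3) / 2 ^ (n₂ : ℝ)) / 2 ^ v) := by
        rw [Real.rpow_natCast]
        gcongr
        · exact ten_pow_le_rpow.1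
        · norm_num
    _ = 2 ^ (34 + (a + b + (5 + (m + 3) - n₂) - v)) := by
        simp only [← Real.rpow_add two_pos, ← Real.rpow_sub two_pos]
    _ ≤ _ := two_rpow_le (by linarith)

theorem SqBound.rpow_comparable_low_res (hE : MeasurableSet E)
    (h : E ⊆ modSet s (2 ^ l₁) (2 ^ l₂) (2 ^ l)) (hs : |s| ≤ 1) (hn : 10 ≤ n₂)
    (hmax : modMax (2 ^ l₁) (2 ^ l₂) (2 ^ l) = (2 : ℝ) ^ c)
    (hprod : modProd (2 ^ l₁) (2 ^ l₂) (2 ^ l) = (2 : ℝ) ^ (a + b)) {v w : ℝ}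
    (hvK : (2 : ℝ) ^ v ≤ 8 * 2 ^ n₂)
    (hr : ∀ p ∈ E, (2 : ℝ) ^ n₂ / 16 ≤ ‖p.1.1‖ ∧ ‖p.1.1‖ ≤ 2 * 2 ^ n₂ ∧ 2 ^ n₂ / 16 ≤ ‖p.2.1‖ ∧
      ‖p.2.1‖ ≤ 2 * 2 ^ n₂)
    (hξ : ∀ p ∈ E, (2 : ℝ) ^ v ≤ ‖p.1.1 - p.2.1‖) (hξw : ∀ p ∈ E, ‖p.1.1 - p.2.1‖ ≤ 2 ^ w)
    (hwc : w ≤ c + 9) (hy : 40 + (a + b) + c / 2 - v ≤ y) :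
    SqBound E (2 ^ y) := by
  have one : ∀ i : ℕ, (1 : ℝ) ≤ 2 ^ i := fun i => one_le_pow₀ (by norm_num)
  have hK := pow_le_pow_right₀ (show (1 : ℝ) ≤ 2 by norm_num) hn
  refine (SqBound.comparable_low_res hE h hs (one _) (one _) (one _) (by linarith)
    (by positivity) hvK (by positivity) hr hξ hξw).mono le_rfl ?_
  have hM : √((2 : ℝ) ^ w + 6 * 2 ^ c) ≤ 2 ^ (c / 2 + 5) := by
    rw [Real.sqrt_le_left (by positivity), ← Real.rpow_mul_natCast (by norm_num)]
    have := two_rpow_le hwc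
    rw [Real.rpow_add two_pos] at this
    rw [show (c / 2 + 5) * ((2 : ℕ) : ℝ) = c + 10 by push_cast; ring, Real.rpow_add two_pos]
    have : (0 : ℝ) < 2 ^ c := by positivity
    norm_num at *
    linarith
  rw [hmax, hprod]
  calc (10 : ℝ) ^ 10 * (2 ^ (a + b) * √(2 ^ w + 6 * 2 ^ c) / 2 ^ v)
      ≤ 2 ^ (34 : ℝ) * (2 ^ (a + b) * 2 ^ (c / 2 + 5) / 2 ^ v) := by
        gcongr
        exact ten_pow_le_rpow.1
    _ = 2 ^ (34 + (a + b + (c / 2 + 5) - v)) := by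
        simp only [← Real.rpow_add two_pos, ← Real.rpow_sub two_pos]
    _ ≤ _ := two_rpow_le (by linarith)

theorem dyBlock_comparable (hs : |s| = 1) (hn : n₁ ≤ n₂) (hn' : n₂ ≤ n₁ + 3) :
    SqBound (dyBlock s n n₁ n₂ l l₁ l₂) (2 ^ dyExponent n n₁ n₂ l l₁ l₂) := by
  obtain ⟨a, b, c, h0, hab, hbc, hS, hmax, hprod, hmin⟩ := exists_sorted_exponents l₁ l₂ l
  have mE := measurableSet_dyBlock s n n₁ n₂ l l₁ l₂
  have hE : dyBlock s n n₁ n₂ l l₁ l₂ ⊆ modSet s (2 ^ l₁) (2 ^ l₂) (2 ^ l) :=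
    Set.inter_subset_left
  have one : ∀ i : ℕ, (1 : ℝ) ≤ 2 ^ i := fun i => one_le_pow₀ (by norm_num)
  have mono : ∀ i j : ℕ, i ≤ j → (2 : ℝ) ^ i ≤ 2 ^ j := fun i j h =>
    pow_le_pow_right₀ (by norm_num) h
  rcases (dyBlock s n n₁ n₂ l l₁ l₂).eq_empty_or_nonempty with he | ⟨p, hp⟩
  · exact SqBound.of_empty (by positivity) (by simp [he])
  have hup : n ≤ n₂ + 3 := by
    by_contra hcon
    have h1 : 2 ^ n / 2 ≤ ‖p.1.1 - p.2.1‖ := hp.2.2.2.2 (by omega)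
    have h2 := mono (n₂ + 4) n (by omega)
    have h3 := mono _ _ hn
    have hX2 := norm_sub_le p.1.1 p.2.1
    have hr₁ : ‖p.1.1‖ ≤ 2 * 2 ^ n₁ := hp.2.1.1
    have hr₂' : ‖p.2.1‖ ≤ 2 * 2 ^ n₂ := hp.2.2.1.1
    rw [pow_add] at h2
    linarith [one n₂]
  have htwo : ∀ i : ℕ, (2 : ℝ) ^ ((i : ℝ) + 1) = 2 * 2 ^ i := fun i => by
    rw [Real.rpow_add two_pos, Real.rpow_natCast, Real.rpow_one, mul_comm]
  have hξw : ∀ q ∈ dyBlock s n n₁ n₂ l l₁ l₂, ‖q.1.1 - q.2.1‖ ≤ 2 ^ ((n : ℝ) + 1) := by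
    intro q hq
    rw [htwo]
    exact hq.2.2.2.1
  have hnr : (n₁ : ℝ) ≤ n₂ := by exact_mod_cast hn
  have hnr' : (n₂ : ℝ) ≤ n₁ + 3 := by exact_mod_cast hn'
  have hn0 : (0 : ℝ) ≤ n := by positivity
  have hy : dyExponent n n₁ n₂ l l₁ l₂ = 5 / 6 * (a + b + c) - n -
      (|(n : ℝ) - n₁| + |(n : ℝ) - n₂|) / 8 + 100 := by rw [hS]; rfl
  set y := dyExponent n n₁ n₂ l l₁ l₂
  rcases le_or_gt n₂ 9 with h9 | h9
  · refine SqBound.dyBlock_trivial mE hE hmin (e := n₂ + 1) (.inr (.inl fun q hq => ?_)) ?_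
    · rw [htwo]; exact hq.2.2.1.1
    · have e1 : (n₂ : ℝ) ≤ 9 := by exact_mod_cast h9
      have e2 : (n : ℝ) ≤ n₂ + 3 := by exact_mod_cast hup
      have e3 : (0 : ℝ) ≤ n₁ := by positivity
      have a₁ : |(n : ℝ) - n₁| ≤ 12 := abs_le.2 ⟨by linarith, by linarith⟩
      have a₂ : |(n : ℝ) - n₂| ≤ 12 := abs_le.2 ⟨by linarith, by linarith⟩
      linarith
  have hr : ∀ q ∈ dyBlock s n n₁ n₂ l l₁ l₂, (2 : ℝ) ^ n₂ / 16 ≤ ‖q.1.1‖ ∧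
      ‖q.1.1‖ ≤ 2 * 2 ^ n₂ ∧ 2 ^ n₂ / 16 ≤ ‖q.2.1‖ ∧ ‖q.2.1‖ ≤ 2 * 2 ^ n₂ := by
    intro q hq
    have k1 := hq.2.1.1
    have k2 := hq.2.1.2 (by omega)
    have k3 := hq.2.2.1.2 (by omega)
    have k4 := mono _ _ hn
    have k5 := mono _ _ hn'
    rw [pow_add] at k5
    refine ⟨by linarith, by linarith, by linarith [one n₂], hq.2.2.1.1⟩
  have hK : (1024 : ℝ) ≤ 2 ^ n₂ := by
    have := mono 10 n₂ h9
    norm_num1 at this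
    exact this
  rcases le_or_gt n₂ (n + 6) with h6 | h6
  · refine SqBound.rpow_comparable_high mE hE hs h9 hmax hprod hr (fun q hq => ?_) ?_
    · have k1 := hq.2.2.2.2 (by omega)
      have k2 := mono _ _ h6
      rw [pow_add] at k2
      linarith
    · have := abs_exponent_sub_le (n := n) (n₁ := n₁) (n₂ := n₂) (by omega) (by omega) (by omega)
        h6
      have e2 : (n : ℝ) ≤ n₂ + 3 := by exact_mod_cast hup
      linarith
  have h7 : (n : ℝ) + 7 ≤ n₂ := by exact_mod_cast h6
  have a₁ : |(n : ℝ) - n₁| ≤ n₂ - n := abs_le.2 ⟨by linarith, by linarith⟩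
  have a₂ : |(n : ℝ) - n₂| ≤ n₂ - n := abs_le.2 ⟨by linarith, by linarith⟩
  have hKn : (128 : ℝ) * 2 ^ n ≤ 2 ^ n₂ := by
    have := mono (n + 7) n₂ h6
    rw [pow_add] at this
    linarith
  rcases Nat.eq_zero_or_pos n with hn00 | hn00
  · have hnz : (n : ℝ) = 0 := by rw [hn00]; simp
    rw [hnz] at hy a₁ a₂ hξw
    rcases le_or_gt (3 / 4 * (n₂ : ℝ) - 8) c with hc | hc
    · exact SqBound.dyBlock_trivial mE hE hmin (.inr (.inr hξw)) (by linarith)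
    have mX : Measurable fun p : (ℂ × ℝ) × (ℂ × ℝ) => ‖p.1.1 - p.2.1‖ := by fun_prop
    have m1 : MeasurableSet {p : (ℂ × ℝ) × (ℂ × ℝ) | ‖p.1.1 - p.2.1‖ ≤ 2 ^ (-(n₂ : ℝ) / 4)} :=
      mX measurableSet_Iic
    have m2 : MeasurableSet {p : (ℂ × ℝ) × (ℂ × ℝ) | 2 ^ (-(n₂ : ℝ) / 4) ≤ ‖p.1.1 - p.2.1‖} :=
      mX measurableSet_Ici
    refine (SqBound.iff_inter_union (x := 2 ^ (y - 2)) (by positivity)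
      (fun q _ => le_total ‖q.1.1 - q.2.1‖ (2 ^ (-(n₂ : ℝ) / 4))) ?_ ?_).mono le_rfl (le_of_eq ?_)
    · exact SqBound.dyBlock_trivial (mE.inter m1) (Set.inter_subset_left.trans hE) hmin
        (.inr (.inr fun q hq => hq.2)) (by linarith)
    · refine SqBound.rpow_comparable_transversal (mE.inter m2) (Set.inter_subset_left.trans hE)
        hs.le h9 hmax hprod (v := -(n₂ : ℝ) / 4) (w := 0 + 1) (m := c + 1) ?_ ?_
        (fun q hq => hr q hq.1) (fun q hq => hq.2) (fun q hq => hξw q hq.1) (by linarith)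
        (by linarith) (by linarith)
      · have : (2 : ℝ) ^ (-(n₂ : ℝ) / 4) ≤ 2 ^ (0 : ℝ) := two_rpow_le (by linarith)
        rw [Real.rpow_zero] at this
        linarith
      · have h1 : (2 : ℝ) ^ c / 2 ^ (-(n₂ : ℝ) / 4) ≤ 2 ^ n₂ / 256 := by
          have : (2 : ℝ) ^ n₂ / 256 = 2 ^ ((n₂ : ℝ) - 8) := by
            rw [Real.rpow_sub two_pos, Real.rpow_natCast]; norm_num
          rw [this, ← Real.rpow_sub two_pos]
          exact two_rpow_le (by linarith)
        rw [mul_div_assoc, zero_add, Real.rpow_one]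
        linarith
    · rw [Real.rpow_sub two_pos]; norm_num; ring
  have hξ : ∀ q ∈ dyBlock s n n₁ n₂ l l₁ l₂, (2 : ℝ) ^ ((n : ℝ) - 1) ≤ ‖q.1.1 - q.2.1‖ := by
    intro q hq
    rw [Real.rpow_sub two_pos, Real.rpow_one, Real.rpow_natCast]
    exact hq.2.2.2.2 hn00
  have hvK : (2 : ℝ) ^ ((n : ℝ) - 1) ≤ 8 * 2 ^ n₂ := by
    rw [Real.rpow_sub two_pos, Real.rpow_one, Real.rpow_natCast]
    linarith [one n]
  rcases le_or_gt c ((n : ℝ) + n₂ - 10) with hc | hc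
  · have hsm : 1 + 6 * (2 : ℝ) ^ c / 2 ^ ((n : ℝ) - 1) + 2 ^ ((n : ℝ) + 1) ≤ 2 ^ n₂ / 16 := by
      have h1 : (2 : ℝ) ^ c / 2 ^ ((n : ℝ) - 1) ≤ 2 ^ n₂ / 512 := by
        have : (2 : ℝ) ^ n₂ / 512 = 2 ^ ((n₂ : ℝ) - 9) := by
          rw [Real.rpow_sub two_pos, Real.rpow_natCast]; norm_num
        rw [this, ← Real.rpow_sub two_pos]
        exact two_rpow_le (by linarith)
      rw [mul_div_assoc, htwo]
      linarith
    rcases le_total c ((n : ℝ) + 1) with hm | hm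
    · exact SqBound.rpow_comparable_transversal mE hE hs.le h9 hmax hprod hvK hsm hr hξ hξw
        le_rfl hm (by linarith)
    · exact SqBound.rpow_comparable_transversal mE hE hs.le h9 hmax hprod hvK hsm hr hξ hξw
        hm le_rfl (by linarith)
  · by_cases hy2 : 4 + 2 * ((n : ℝ) + 1) + a ≤ y
    · exact SqBound.dyBlock_trivial mE hE hmin (.inr (.inr hξw)) hy2
    · push Not at hy2
      have h10 : (10 : ℝ) ≤ n₂ := by exact_mod_cast h9
      exact SqBound.rpow_comparable_low_res mE hE hs.le h9 hmax hprod hvK hr hξ hξw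
        (by linarith) (by linarith)

theorem swap_preimage_dyBlock :
    Prod.swap ⁻¹' dyBlock s n n₁ n₂ l l₁ l₂ ⊆ dyBlock (-s) n n₂ n₁ l l₂ l₁ := by
  rintro p hp
  refine ⟨swap_subset_modSet Set.inter_subset_left hp, hp.2.2.1, hp.2.1, ?_⟩
  rw [norm_sub_rev]
  exact hp.2.2.2

theorem dyExponent_swap : dyExponent n n₂ n₁ l l₂ l₁ = dyExponent n n₁ n₂ l l₁ l₂ := by
  unfold dyExponent; ring

theorem sqBound_dyBlock (hs : |s| = 1) :
    SqBound (dyBlock s n n₁ n₂ l l₁ l₂) (2 ^ dyExponent n n₁ n₂ l l₁ l₂) := by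
  have main : ∀ (s : ℝ) (n₁ n₂ l₁ l₂ : ℕ), |s| = 1 → n₁ ≤ n₂ →
      SqBound (dyBlock s n n₁ n₂ l l₁ l₂) (2 ^ dyExponent n n₁ n₂ l l₁ l₂) := by
    intro s n₁ n₂ l₁ l₂ hs hn
    rcases le_or_gt (n₁ + 4) n₂ with h | h
    · exact dyBlock_high_low hs.le h
    · exact dyBlock_comparable hs hn (by omega)
  rcases le_total n₁ n₂ with hn | hn
  · exact main s n₁ n₂ l₁ l₂ hs hn
  · refine SqBound.of_swap (measurableSet_dyBlock _ _ _ _ _ _ _) ?_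
    rw [← dyExponent_swap]
    exact (main (-s) n₂ n₁ l₂ l₁ (by rwa [abs_neg]) hn).mono swap_preimage_dyBlock le_rfl

end ComparableBlocks

section DyadicSummation

theorem tsum_mul_mul_le {ι : Type*} (a x y : ι → ℝ≥0∞) :
    (∑' i, a i * x i * y i) ^ 2 ≤ (∑' i, a i ^ 2) * (∑' i, x i ^ 2) * ∑' i, y i ^ 2 := by
  calc (∑' i, a i * x i * y i) ^ 2 = (∑' i, a i * (x i * y i)) ^ 2 := by simp_rw [mul_assoc]
    _ ≤ (∑' i, a i ^ 2) * ∑' i, (x i * y i) ^ 2 := tsum_mul_le _ _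
    _ ≤ (∑' i, a i ^ 2) * ∑' i, (∑' j, x j ^ 2) * y i ^ 2 := by
        gcongr with i
        rw [mul_pow]
        gcongr
        exact ENNReal.le_tsum (f := fun j => x j ^ 2) i
    _ = _ := by rw [ENNReal.tsum_mul_left, mul_assoc]

/-- Schur's test for a symmetric kernel. -/
theorem tsum_sq_tsum_mul_le {ι : Type*} {k : ι → ι → ℝ≥0∞} (hk : ∀ i j, k i j = k j i)
    {S : ℝ≥0∞} (hS : ∀ i, ∑' j, k i j ≤ S) (b : ι → ℝ≥0∞) :
    ∑' i, (∑' j, k i j * b j) ^ 2 ≤ S ^ 2 * ∑' j, b j ^ 2 := by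
  have key : ∀ i, (∑' j, k i j * b j) ^ 2 ≤ S * ∑' j, k i j * b j ^ 2 := by
    intro i
    have hsq : ∀ x : ℝ≥0∞, (x ^ (1 / 2 : ℝ)) ^ 2 = x := fun x => by
      rw [← ENNReal.rpow_natCast, ← ENNReal.rpow_mul]; norm_num
    have := tsum_mul_le (fun j => k i j ^ (1 / 2 : ℝ)) fun j => k i j ^ (1 / 2 : ℝ) * b j
    simp_rw [← mul_assoc, ← sq, mul_pow, hsq] at this
    exact this.trans (by gcongr; exact hS i)
  calc _ ≤ ∑' i, S * ∑' j, k i j * b j ^ 2 := ENNReal.tsum_le_tsum key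
    _ = S * ∑' j, (∑' i, k i j) * b j ^ 2 := by
        rw [ENNReal.tsum_mul_left, ENNReal.tsum_comm]
        simp_rw [ENNReal.tsum_mul_right]
    _ ≤ S * ∑' j, S * b j ^ 2 := by
        gcongr with j
        simp_rw [hk _ j]
        exact hS j
    _ = _ := by rw [ENNReal.tsum_mul_left]; ring

/-- The off-diagonal decay factor. -/
def dyDecay (n m : ℕ) : ℝ≥0∞ := ENNReal.ofReal (2 ^ (-|(n : ℝ) - m| / 16))

/-- A bound for the row sums of `dyDecay`. -/
def dyDecaySum : ℝ≥0∞ := 2 * (1 - ENNReal.ofReal (2 ^ (-1 / 16 : ℝ)))⁻¹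

theorem dyDecay_comm (n m : ℕ) : dyDecay n m = dyDecay m n := by
  rw [dyDecay, dyDecay, abs_sub_comm]

theorem dyDecaySum_ne_top : dyDecaySum ≠ ⊤ := by
  refine ENNReal.mul_ne_top (by simp) (ENNReal.inv_ne_top.2 (tsub_pos_of_lt ?_).ne')
  rw [← ENNReal.ofReal_one]
  exact (ENNReal.ofReal_lt_ofReal_iff one_pos).2
    (Real.rpow_lt_one_of_one_lt_of_neg (by norm_num) (by norm_num))

theorem tsum_dyDecay_le (n : ℕ) : ∑' m, dyDecay n m ≤ dyDecaySum := by
  set q : ℝ≥0∞ := ENNReal.ofReal (2 ^ (-1 / 16 : ℝ)) with hq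
  have hpow : ∀ j : ℕ, q ^ j = ENNReal.ofReal (2 ^ (-(j : ℝ) / 16)) := fun j => by
    rw [hq, ← ENNReal.ofReal_pow (by positivity), ← Real.rpow_mul_natCast (by norm_num)]
    congr 2; ring
  have h1 : ∀ m, dyDecay n (m + n) = q ^ m := fun m => by
    rw [hpow, dyDecay]
    have : |(n : ℝ) - ((m + n : ℕ) : ℝ)| = m := by
      push_cast
      rw [abs_sub_comm, add_sub_cancel_right, Nat.abs_cast]
    rw [this]
  have h2 : ∀ m ∈ Finset.range n, dyDecay n (n - 1 - m) ≤ q ^ m := fun m hm => by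
    rw [Finset.mem_range] at hm
    rw [hpow, dyDecay]
    refine ENNReal.ofReal_le_ofReal (two_rpow_le ?_)
    have e : (((n - 1 - m : ℕ) : ℕ) : ℝ) + 1 + m = n := by
      exact_mod_cast (by omega : n - 1 - m + 1 + m = n)
    have : (m : ℝ) ≤ |(n : ℝ) - ((n - 1 - m : ℕ) : ℝ)| := by
      refine le_trans ?_ (le_abs_self _)
      linarith
    linarith
  rw [← Summable.sum_add_tsum_nat_add' (k := n) ENNReal.summable, dyDecaySum,
    ← Finset.sum_range_reflect, two_mul, ← hq, ← ENNReal.tsum_geometric]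
  refine add_le_add ((Finset.sum_le_sum h2).trans (ENNReal.sum_le_tsum _)) ?_
  simp_rw [h1]
  exact le_rfl

variable {s : ℝ}

theorem triForm_univ_le_tsum {ι : Type*} [Countable ι] {F G H : ℂ × ℝ → ℝ≥0∞}
    {f g h : ι → ℂ × ℝ → ℝ≥0∞} (mf : ∀ i, Measurable (f i)) (mg : ∀ i, Measurable (g i))
    (mh : ∀ i, Measurable (h i)) (hF : ∀ z, F z ≤ ∑' i, f i z) (hG : ∀ z, G z ≤ ∑' i, g i z)
    (hH : ∀ z, H z ≤ ∑' i, h i z) :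
    triForm volume Set.univ F G H ≤
      ∑' i, ∑' j, ∑' k, triForm volume Set.univ (f i) (g j) (h k) := by
  simp only [triForm, Measure.restrict_univ]
  have m : ∀ i j k, Measurable fun p : (ℂ × ℝ) × (ℂ × ℝ) =>
      f i (p.1 - p.2) * g j p.1 * h k p.2 := fun i j k =>
    (((mf i).comp (measurable_fst.sub measurable_snd)).mul ((mg j).comp measurable_fst)).mul
      ((mh k).comp measurable_snd)
  calc _ ≤ ∫⁻ p : (ℂ × ℝ) × (ℂ × ℝ), (∑' i, f i (p.1 - p.2)) * (∑' j, g j p.1) * ∑' k, h k p.2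
        ∂(volume.prod volume) := lintegral_mono fun p =>
          mul_le_mul' (mul_le_mul' (hF _) (hG _)) (hH _)
    _ = ∫⁻ p : (ℂ × ℝ) × (ℂ × ℝ), ∑' i, ∑' j, ∑' k, f i (p.1 - p.2) * g j p.1 * h k p.2
        ∂(volume.prod volume) := by
          simp_rw [ENNReal.tsum_mul_left, ENNReal.tsum_mul_right]
          simp_rw [ENNReal.tsum_mul_left, ENNReal.tsum_mul_right]
    _ = _ := by
      rw [lintegral_tsum fun i => (Measurable.tsum fun j =>
        Measurable.tsum fun k => m i j k).aemeasurable]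
      congr! with i
      rw [lintegral_tsum fun j => (Measurable.tsum fun k => m i j k).aemeasurable]
      congr! with j
      rw [lintegral_tsum fun k => (m i j k).aemeasurable]

/-- The weighted norm of one modulation piece. -/
def dyPiece (σ : ℝ) (i : ℕ × ℕ) (f : ℂ × ℝ → ℝ≥0∞) : ℝ≥0∞ :=
  ENNReal.ofReal (2 ^ (5 / 12 * (i.2 : ℝ) + σ * i.1)) * l2 volume f

theorem triForm_piece_le (hs : |s| = 1) {i j k : ℕ × ℕ} {f g h : ℂ × ℝ → ℝ≥0∞}
    (mf : Measurable f) (mg : Measurable g) (mh : Measurable h)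
    (sf : ∀ z, f z ≠ 0 → dyBand i.1 ‖z.1‖ ∧ |z.2 + s * ‖z.1‖| ≤ 2 * 2 ^ i.2)
    (sg : ∀ z, g z ≠ 0 → dyBand j.1 ‖z.1‖ ∧ |z.2 + ‖z.1‖ ^ 2| ≤ 2 * 2 ^ j.2)
    (sh : ∀ z, h z ≠ 0 → dyBand k.1 ‖z.1‖ ∧ |z.2 + ‖z.1‖ ^ 2| ≤ 2 * 2 ^ k.2) :
    triForm volume Set.univ f g h ≤ ENNReal.ofReal (2 ^ (50 : ℝ)) *
      (dyPiece (-1 / 2) i f * (dyDecay i.1 j.1 * dyPiece 0 j g) *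
        (dyDecay i.1 k.1 * dyPiece 0 k h)) := by
  have e : triForm volume Set.univ f g h =
      triForm volume (dyBlock s i.1 j.1 k.1 i.2 j.2 k.2) f g h := by
    simp only [triForm, Measure.restrict_univ]
    rw [← lintegral_indicator (measurableSet_dyBlock _ _ _ _ _ _ _)]
    refine lintegral_congr fun p => ?_
    by_cases hp : p ∈ dyBlock s i.1 j.1 k.1 i.2 j.2 k.2
    · rw [Set.indicator_of_mem hp]
    rw [Set.indicator_of_notMem hp]
    by_contra hne
    have n1 : f (p.1 - p.2) ≠ 0 := fun h0 => hne (by rw [h0]; simp)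
    have n2 : g p.1 ≠ 0 := fun h0 => hne (by rw [h0]; simp)
    have n3 : h p.2 ≠ 0 := fun h0 => hne (by rw [h0]; simp)
    exact hp ⟨⟨(sg _ n2).2, (sh _ n3).2, (sf _ n1).2⟩, (sg _ n2).1, (sh _ n3).1, (sf _ n1).1⟩
  rw [e]
  refine (sqBound_dyBlock hs f g h mf mg mh).trans (le_of_eq ?_)
  have hB : √((2 : ℝ) ^ dyExponent i.1 j.1 k.1 i.2 j.2 k.2) = 2 ^ (50 : ℝ) *
      (2 ^ (5 / 12 * (i.2 : ℝ) + -1 / 2 * i.1) * (2 ^ (-|(i.1 : ℝ) - j.1| / 16) *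
        2 ^ (5 / 12 * (j.2 : ℝ) + 0 * j.1)) * (2 ^ (-|(i.1 : ℝ) - k.1| / 16) *
        2 ^ (5 / 12 * (k.2 : ℝ) + 0 * k.1))) := by
    rw [Real.sqrt_eq_rpow, ← Real.rpow_mul (by norm_num)]
    simp only [← Real.rpow_add two_pos]
    congr 1
    unfold dyExponent
    ring
  rw [hB]
  simp only [dyPiece, dyDecay]
  repeat rw [ENNReal.ofReal_mul (by positivity)]
  ring

theorem triForm_univ_le (hs : |s| = 1) {F G H : ℂ × ℝ → ℝ≥0∞}
    {f g h : ℕ × ℕ → ℂ × ℝ → ℝ≥0∞} (mf : ∀ i, Measurable (f i)) (mg : ∀ i, Measurable (g i))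
    (mh : ∀ i, Measurable (h i)) (hF : ∀ z, F z ≤ ∑' i, f i z) (hG : ∀ z, G z ≤ ∑' i, g i z)
    (hH : ∀ z, H z ≤ ∑' i, h i z)
    (sf : ∀ i z, f i z ≠ 0 → dyBand i.1 ‖z.1‖ ∧ |z.2 + s * ‖z.1‖| ≤ 2 * 2 ^ i.2)
    (sg : ∀ i z, g i z ≠ 0 → dyBand i.1 ‖z.1‖ ∧ |z.2 + ‖z.1‖ ^ 2| ≤ 2 * 2 ^ i.2)
    (sh : ∀ i z, h i z ≠ 0 → dyBand i.1 ‖z.1‖ ∧ |z.2 + ‖z.1‖ ^ 2| ≤ 2 * 2 ^ i.2) :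
    triForm volume Set.univ F G H ^ 2 ≤ (ENNReal.ofReal (2 ^ (50 : ℝ)) * dyDecaySum ^ 2) ^ 2 *
      ((∑' n, (∑' l, dyPiece (-1 / 2) (n, l) (f (n, l))) ^ 2) *
        (∑' n, (∑' l, dyPiece 0 (n, l) (g (n, l))) ^ 2) *
        ∑' n, (∑' l, dyPiece 0 (n, l) (h (n, l))) ^ 2) := by
  set c : ℝ≥0∞ := ENNReal.ofReal (2 ^ (50 : ℝ))
  have h1 : triForm volume Set.univ F G H ≤ c * ∑' n, (∑' l, dyPiece (-1 / 2) (n, l) (f (n, l))) *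
      (∑' m, dyDecay n m * ∑' l, dyPiece 0 (m, l) (g (m, l))) *
      (∑' m, dyDecay n m * ∑' l, dyPiece 0 (m, l) (h (m, l))) := by
    calc _ ≤ ∑' i, ∑' j, ∑' k, triForm volume Set.univ (f i) (g j) (h k) :=
          triForm_univ_le_tsum mf mg mh hF hG hH
      _ ≤ ∑' i : ℕ × ℕ, ∑' j : ℕ × ℕ, ∑' k : ℕ × ℕ,
          c * (dyPiece (-1 / 2) i (f i) * (dyDecay i.1 j.1 * dyPiece 0 j (g j)) *
          (dyDecay i.1 k.1 * dyPiece 0 k (h k))) := by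
            gcongr with i j k
            exact triForm_piece_le hs (mf i) (mg j) (mh k) (sf i) (sg j) (sh k)
      _ = c * ∑' i : ℕ × ℕ, dyPiece (-1 / 2) i (f i) *
          (∑' j : ℕ × ℕ, dyDecay i.1 j.1 * dyPiece 0 j (g j)) *
          (∑' k : ℕ × ℕ, dyDecay i.1 k.1 * dyPiece 0 k (h k)) := by
            simp_rw [ENNReal.tsum_mul_left, ENNReal.tsum_mul_right, ENNReal.tsum_mul_left]
      _ = _ := by
            simp_rw [ENNReal.tsum_prod' (f := fun i : ℕ × ℕ => _ * _),
              ENNReal.tsum_mul_left, ENNReal.tsum_mul_right]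
  calc _ ≤ (c * ∑' n, (∑' l, dyPiece (-1 / 2) (n, l) (f (n, l))) *
      (∑' m, dyDecay n m * ∑' l, dyPiece 0 (m, l) (g (m, l))) *
      (∑' m, dyDecay n m * ∑' l, dyPiece 0 (m, l) (h (m, l)))) ^ 2 := by gcongr
    _ ≤ c ^ 2 * ((∑' n, (∑' l, dyPiece (-1 / 2) (n, l) (f (n, l))) ^ 2) *
        (dyDecaySum ^ 2 * ∑' n, (∑' l, dyPiece 0 (n, l) (g (n, l))) ^ 2) *
        (dyDecaySum ^ 2 * ∑' n, (∑' l, dyPiece 0 (n, l) (h (n, l))) ^ 2)) := by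
      rw [mul_pow]
      gcongr
      refine (tsum_mul_mul_le _ _ _).trans ?_
      gcongr
      · exact tsum_sq_tsum_mul_le dyDecay_comm tsum_dyDecay_le _
      · exact tsum_sq_tsum_mul_le dyDecay_comm tsum_dyDecay_le _
    _ = _ := by ring

end DyadicSummation

open scoped SchwartzMap ContDiff in
/-- **Plancherel's theorem** for the inverse Fourier integral of a function in `L¹ ∩ L²`. -/
theorem eLpNorm_fourierInv_eq {E : Type*} [NormedAddCommGroup E] [InnerProductSpace ℝ E]
    [FiniteDimensional ℝ E] [MeasurableSpace E] [BorelSpace E] {h : E → ℂ}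
    (h1 : Integrable h) (h2 : MemLp h 2) :
    eLpNorm (𝓕⁻ h) 2 volume = eLpNorm h 2 volume := by
  set H : Lp ℂ 2 (volume : Measure E) := h2.toLp h with hH
  have key : ∀ᵐ x, (𝓕⁻ h) x = (𝓕⁻ H : Lp ℂ 2 (volume : Measure E)) x := by
    apply ae_eq_of_integral_contDiff_smul_eq
    · apply Continuous.locallyIntegrable
      exact VectorFourier.fourierIntegral_continuous Real.continuous_fourierChar
        continuous_inner.neg h1
    · exact (Lp.memLp _).locallyIntegrable (by norm_num)
    · intro g hg hc
      have hc' : HasCompactSupport (fun x => (g x : ℂ)) := hc.comp_left (g := Complex.ofReal) rfl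
      set G : 𝓢(E, ℂ) := hc'.toSchwartzMap (Complex.ofRealCLM.contDiff.comp hg) with hG
      have hGx : ∀ x, G x = g x := fun x => rfl
      have e1 : ∫ x, g x • (𝓕⁻ h) x = ∫ x, (𝓕⁻ h) x • G x := by
        congr 1; ext x; rw [hGx]; simp [mul_comm]
      have e2 : ∫ x, (𝓕⁻ h) x • G x = ∫ x, h x • (𝓕⁻ (G : E → ℂ)) x := by
        have := VectorFourier.integral_fourierIntegral_smul_eq_flip (μ := volume) (ν := volume)
          (e := 𝐞) (L := -innerₗ E) (f := h) (g := (G : E → ℂ)) Real.continuous_fourierChar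
          continuous_inner.neg h1 G.integrable
        have hL : (-innerₗ E).flip = -innerₗ E := by
          ext x y; simp [real_inner_comm]
        rw [hL] at this
        exact this
      have e3 : ∫ x, h x • (𝓕⁻ (G : E → ℂ)) x = ∫ x, (𝓕⁻ G : 𝓢(E, ℂ)) x • H x := by
        apply integral_congr_ae
        filter_upwards [h2.coeFn_toLp] with x hx
        rw [hH, hx, SchwartzMap.fourierInv_coe]; simp [mul_comm]
      have e4 := congrArg (fun T => T G) (Lp.fourierInv_toTemperedDistribution_eq H)
      simp only [TemperedDistribution.fourierInv_apply, Lp.toTemperedDistribution_apply] at e4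
      rw [e1, e2, e3, e4]
      congr 1
  rw [eLpNorm_congr_ae key, ← eLpNorm_congr_ae h2.coeFn_toLp]
  have := Lp.norm_fourier_eq (𝓕⁻ H : Lp ℂ 2 (volume : Measure E))
  rw [FourierTransform.fourier_fourierInv_eq, Lp.norm_def, Lp.norm_def] at this
  exact ((ENNReal.toReal_eq_toReal_iff' (Lp.eLpNorm_ne_top _) (Lp.eLpNorm_ne_top _)).1 this).symm

/-- The identification of `ℂ × ℝ` with space-time. -/
def ofComplexProd (z : ℂ × ℝ) : SpaceTime := !₂[z.1.re, z.1.im, z.2]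

theorem measurePreserving_ofComplexProd : MeasurePreserving ofComplexProd := by
  have h1 := (volume_preserving_finTwoArrow ℝ).symm.comp Complex.volume_preserving_equiv_real_prod
  have h2 := (MeasurePreserving.id (volume : Measure ℝ)).prod h1
  have h3 : MeasurePreserving (Prod.swap : ℂ × ℝ → ℝ × ℂ) volume volume :=
    Measure.measurePreserving_swap
  have h4 := (volume_preserving_piFinSuccAbove (fun _ : Fin 3 => ℝ) 2).symm
  have h5 := (PiLp.volume_preserving_toLp (Fin 3)).comp (h4.comp (h2.comp h3))
  refine (?_ : _ = ofComplexProd) ▸ h5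
  funext z
  refine PiLp.ext fun i => ?_
  fin_cases i <;> rfl

theorem ofComplexProd_sub (z w : ℂ × ℝ) :
    ofComplexProd (z - w) = ofComplexProd z - ofComplexProd w := by
  ext i
  fin_cases i <;> simp [ofComplexProd]

theorem spFreq_ofComplexProd (z : ℂ × ℝ) : spFreq (ofComplexProd z) = ‖z.1‖ := by
  rw [Complex.norm_eq_sqrt_sq_add_sq]
  rfl

theorem tFreq_ofComplexProd (z : ℂ × ℝ) : tFreq (ofComplexProd z) = z.2 := rfl

theorem continuous_spFreq : Continuous spFreq := by
  unfold spFreq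
  fun_prop

theorem continuous_tFreq : Continuous tFreq := by
  unfold tFreq
  fun_prop

theorem lintegral_lintegral_eq_triForm {f g h : SpaceTime → ℝ≥0∞} (mf : Measurable f)
    (mg : Measurable g) (mh : Measurable h) :
    ∫⁻ ζ₁, ∫⁻ ζ₂, f (ζ₁ - ζ₂) * g ζ₁ * h ζ₂ =
      triForm volume Set.univ (f ∘ ofComplexProd) (g ∘ ofComplexProd) (h ∘ ofComplexProd) := by
  have hS := measurePreserving_ofComplexProd
  have mS := hS.measurable
  have m1 : Measurable (fun p : SpaceTime × SpaceTime => f (p.1 - p.2) * g p.1 * h p.2) := by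
    fun_prop
  rw [triForm, Measure.restrict_univ, lintegral_prod _ (by fun_prop),
    ← hS.lintegral_comp m1.lintegral_prod_right']
  refine lintegral_congr fun z => ?_
  have m2 : Measurable fun ζ₂ => f (ofComplexProd z - ζ₂) * g (ofComplexProd z) * h ζ₂ := by
    fun_prop
  rw [← hS.lintegral_comp m2]
  simp only [Function.comp_apply, ofComplexProd_sub]

theorem enorm_trilinI_le (f g h : SpaceTime → ℂ) :
    ‖trilinI f g h‖ₑ ≤ ∫⁻ ζ₁, ∫⁻ ζ₂, ‖f (ζ₁ - ζ₂)‖ₑ * ‖g ζ₁‖ₑ * ‖h ζ₂‖ₑ := by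
  refine (enorm_integral_le_lintegral_enorm _).trans (lintegral_mono fun ζ₁ => ?_)
  refine (enorm_integral_le_lintegral_enorm _).trans (lintegral_mono fun ζ₂ => ?_)
  simp only [enorm_mul, le_refl]

theorem l2_comp_ofComplexProd {f : SpaceTime → ℂ} (hf : Measurable f) :
    l2 volume (fun z => ‖f (ofComplexProd z)‖ₑ) = eLpNorm f 2 volume := by
  have m : Measurable fun ζ => ‖f ζ‖ₑ ^ 2 := by fun_prop
  rw [eLpNorm_eq_lintegral_rpow_enorm_toReal (by norm_num) (by norm_num), l2,
    measurePreserving_ofComplexProd.lintegral_comp m]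
  simp

section cutoff

variable {ψ : ℝ → ℝ}

theorem psiDy_two_pow_succ (n : ℕ) (r : ℝ) :
    psiDy ψ (2 ^ (n + 1)) r = ψ (r / 2 ^ (n + 1)) - ψ (r / 2 ^ n) := by
  have h : (2 : ℝ) ^ (n + 1) ≠ 1 := (one_lt_pow₀ one_lt_two n.succ_ne_zero).ne'
  rw [psiDy, if_neg h, pow_succ']
  congr 2
  field_simp

theorem sum_psiDy (M : ℕ) (r : ℝ) :
    ∑ n ∈ Finset.range (M + 1), psiDy ψ (2 ^ n) r = ψ (r / 2 ^ M) := by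
  induction M with
  | zero => simp [psiDy]
  | succ M ih => rw [Finset.sum_range_succ, ih, psiDy_two_pow_succ]; ring

theorem one_le_tsum_enorm_psiDy (hψone : ∀ r ∈ Set.Icc (-1 : ℝ) 1, ψ r = 1) (r : ℝ) :
    1 ≤ ∑' n : ℕ, ‖psiDy ψ (2 ^ n) r‖ₑ := by
  obtain ⟨M, hM⟩ := pow_unbounded_of_one_lt |r| one_lt_two
  have h2 : (0 : ℝ) < 2 ^ M := by positivity
  have h1 : ψ (r / 2 ^ M) = 1 := by
    apply hψone
    rw [Set.mem_Icc, ← abs_le, abs_div, abs_of_pos h2, div_le_one h2]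
    exact hM.le
  calc (1 : ℝ≥0∞) = ‖∑ n ∈ Finset.range (M + 1), psiDy ψ (2 ^ n) r‖ₑ := by
        rw [sum_psiDy, h1]; simp
    _ ≤ ∑ n ∈ Finset.range (M + 1), ‖psiDy ψ (2 ^ n) r‖ₑ := enorm_sum_le _ _
    _ ≤ _ := ENNReal.sum_le_tsum _

theorem abs_le_of_psiDy_ne_zero (hψsupp : Function.support ψ ⊆ Set.Ioo (-2) 2) {n : ℕ} {r : ℝ}
    (h : psiDy ψ (2 ^ n) r ≠ 0) : |r| ≤ 2 * 2 ^ n := by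
  by_contra! hr
  have key : ∀ m ≤ n, ψ (r / 2 ^ m) = 0 := by
    intro m hm
    by_contra h0
    have h2 : (0 : ℝ) < 2 ^ m := by positivity
    have h3 : (2 : ℝ) ^ m ≤ 2 ^ n := pow_le_pow_right₀ one_le_two hm
    have := hψsupp h0
    rw [Set.mem_Ioo, ← abs_lt, abs_div, abs_of_pos h2, div_lt_iff₀ h2] at this
    linarith
  apply h
  cases n with
  | zero => simpa [psiDy] using key 0 le_rfl
  | succ n => rw [psiDy_two_pow_succ, key _ le_rfl, key n n.le_succ, sub_zero]

theorem le_abs_of_psiDy_ne_zero (hψone : ∀ r ∈ Set.Icc (-1 : ℝ) 1, ψ r = 1) {n : ℕ}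
    (hn : 1 ≤ n) {r : ℝ} (h : psiDy ψ (2 ^ n) r ≠ 0) : 2 ^ n / 2 ≤ |r| := by
  by_contra! hr
  obtain ⟨n, rfl⟩ := Nat.exists_eq_add_of_le' hn
  have key : ∀ m, n ≤ m → ψ (r / 2 ^ m) = 1 := by
    intro m hm
    have h2 : (0 : ℝ) < 2 ^ m := by positivity
    have h3 : (2 : ℝ) ^ n ≤ 2 ^ m := pow_le_pow_right₀ one_le_two hm
    apply hψone
    rw [Set.mem_Icc, ← abs_le, abs_div, abs_of_pos h2, div_le_one h2]
    rw [pow_succ] at hr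
    linarith
  apply h
  rw [psiDy_two_pow_succ, key _ n.le_succ, key n le_rfl, sub_self]

theorem continuous_psiDy (hψ : Continuous ψ) (L : ℝ) : Continuous (psiDy ψ L) := by
  unfold psiDy
  split_ifs <;> fun_prop

theorem exists_abs_psiDy_le (hψ : Continuous ψ)
    (hψsupp : Function.support ψ ⊆ Set.Ioo (-2) 2) (L : ℝ) : ∃ B, ∀ r, |psiDy ψ L r| ≤ B := by
  have hc : HasCompactSupport ψ := HasCompactSupport.of_support_subset_isCompact isCompact_Icc
    (hψsupp.trans Set.Ioo_subset_Icc_self)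
  obtain ⟨B, hB⟩ := hc.exists_bound_of_continuous hψ
  refine ⟨B + B, fun r => ?_⟩
  unfold psiDy
  have hB0 : 0 ≤ B := (norm_nonneg _).trans (hB 0)
  split_ifs
  · exact (hB r).trans (by linarith)
  · exact (abs_sub _ _).trans (add_le_add (hB _) (hB _))

end cutoff

section multiplier

variable {ψ : ℝ → ℝ}

/-- The complex spatial frequency `ξ₁ + iξ₂` as a linear map. -/
def spaceProj : SpaceTime →L[ℝ] ℂ :=
  LinearMap.toContinuousLinearMap
    { toFun := fun ζ => ⟨ζ 0, ζ 1⟩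
      map_add' := fun _ _ => rfl
      map_smul' := fun c ζ => by apply Complex.ext <;> simp }

theorem norm_spaceProj (ζ : SpaceTime) : ‖spaceProj ζ‖ = spFreq ζ := by
  rw [Complex.norm_eq_sqrt_sq_add_sq]
  rfl

theorem hasTemperateGrowth_comp_spFreq_div (hψsmooth : ContDiff ℝ (⊤ : ℕ∞) ψ)
    (hψsupp : Function.support ψ ⊆ Set.Ioo (-2) 2)
    (hψone : ∀ r ∈ Set.Icc (-1 : ℝ) 1, ψ r = 1) {R : ℝ} (hR : 0 < R) :
    (fun ζ : SpaceTime => (ψ (spFreq ζ / R) : ℂ)).HasTemperateGrowth := by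
  have hsm : ContDiff ℝ (⊤ : ℕ∞) (fun w : ℂ => (ψ (‖w‖ / R) : ℂ)) := by
    refine Complex.ofRealCLM.contDiff.comp ?_
    rw [contDiff_iff_contDiffAt]
    intro w
    rcases eq_or_ne w 0 with rfl | hw
    · have h1 : (fun w : ℂ => ψ (‖w‖ / R)) =ᶠ[nhds 0] fun _ => 1 := by
        filter_upwards [Metric.ball_mem_nhds (0 : ℂ) hR] with w hw
        rw [mem_ball_zero_iff] at hw
        apply hψone
        rw [Set.mem_Icc, div_le_one hR]
        exact ⟨by linarith [div_nonneg (norm_nonneg w) hR.le], hw.le⟩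
      exact contDiffAt_const.congr_of_eventuallyEq h1
    · exact hψsmooth.contDiffAt.comp w ((contDiffAt_norm ℝ hw).div_const R)
  have hcs : HasCompactSupport (fun w : ℂ => (ψ (‖w‖ / R) : ℂ)) := by
    refine HasCompactSupport.intro (isCompact_closedBall (0 : ℂ) (2 * R)) fun w hw => ?_
    rw [mem_closedBall_zero_iff, not_le] at hw
    by_contra h
    have := (hψsupp (a := ‖w‖ / R) fun h0 => h (by rw [h0]; rfl)).2
    rw [div_lt_iff₀ hR] at this
    linarith
  have := (hcs.hasTemperateGrowth hsm).comp spaceProj.hasTemperateGrowth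
  simpa only [Function.comp_def, norm_spaceProj] using this

theorem hasTemperateGrowth_psiDy_spFreq (hψsmooth : ContDiff ℝ (⊤ : ℕ∞) ψ)
    (hψsupp : Function.support ψ ⊆ Set.Ioo (-2) 2)
    (hψone : ∀ r ∈ Set.Icc (-1 : ℝ) 1, ψ r = 1) (n : ℕ) :
    (fun ζ : SpaceTime => (psiDy ψ (2 ^ n) (spFreq ζ) : ℂ)).HasTemperateGrowth := by
  have key := fun m : ℕ =>
    hasTemperateGrowth_comp_spFreq_div hψsmooth hψsupp hψone (R := 2 ^ m) (by positivity)
  cases n with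
  | zero => simpa [psiDy] using key 0
  | succ n =>
    have := (key (n + 1)).sub (key n)
    simp only [psiDy_two_pow_succ, Complex.ofReal_sub]
    exact this

theorem fourier_fourierInv_mul {m : SpaceTime → ℂ} (hm : m.HasTemperateGrowth)
    (u : SchwartzMap SpaceTime ℂ) :
    𝓕 (𝓕⁻ fun ζ => m ζ * 𝓕 (⇑u) ζ) = fun ζ => m ζ * 𝓕 (⇑u) ζ := by
  have h : (fun ζ => m ζ * 𝓕 (⇑u) ζ) = ⇑(SchwartzMap.smulLeftCLM ℂ m (𝓕 u)) := by
    ext ζ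
    rw [SchwartzMap.smulLeftCLM_apply_apply hm, SchwartzMap.fourier_coe, smul_eq_mul]
  rw [h, ← SchwartzMap.fourierInv_coe, ← SchwartzMap.fourier_coe,
    FourierTransform.fourier_fourierInv_eq]

theorem eLpNorm_fourierInv_mul {m : SpaceTime → ℂ} (hm : Continuous m) {B : ℝ}
    (hB : ∀ ζ, ‖m ζ‖ ≤ B) (u : SchwartzMap SpaceTime ℂ) :
    eLpNorm (𝓕⁻ fun ζ => m ζ * 𝓕 (⇑u) ζ) 2 volume =
      eLpNorm (fun ζ => m ζ * 𝓕 (⇑u) ζ) 2 volume := by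
  have h (p : ℝ≥0∞) : MemLp (fun ζ => m ζ * 𝓕 (⇑u) ζ) p volume := by
    rw [← SchwartzMap.fourier_coe]
    refine (((𝓕 u).memLp p volume).const_mul (B : ℂ)).of_le
      (hm.aestronglyMeasurable.mul (𝓕 u).continuous.aestronglyMeasurable)
      (Filter.Eventually.of_forall fun ζ => ?_)
    rw [norm_mul, norm_mul]
    refine mul_le_mul_of_nonneg_right ((hB ζ).trans ?_) (norm_nonneg _)
    simpa using le_abs_self B
  exact eLpNorm_fourierInv_eq (memLp_one_iff_integrable.1 (h 1)) (h 2)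

theorem eLpNorm_fourierInv_psiDy_PN (hψsmooth : ContDiff ℝ (⊤ : ℕ∞) ψ)
    (hψsupp : Function.support ψ ⊆ Set.Ioo (-2) 2)
    (hψone : ∀ r ∈ Set.Icc (-1 : ℝ) 1, ψ r = 1) (n : ℕ) (L : ℝ) {q : SpaceTime → ℝ}
    (hq : Continuous q) (u : SchwartzMap SpaceTime ℂ) :
    eLpNorm (𝓕⁻ fun ζ => (psiDy ψ L (q ζ) : ℂ) * 𝓕 (PN ψ (2 ^ n) u) ζ) 2 volume =
      eLpNorm (fun ζ => ((psiDy ψ L (q ζ) * psiDy ψ (2 ^ n) (spFreq ζ) : ℝ) : ℂ) * 𝓕 (⇑u) ζ) 2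
        volume := by
  have hc := hψsmooth.continuous
  obtain ⟨B₁, h₁⟩ := exists_abs_psiDy_le hc hψsupp L
  obtain ⟨B₂, h₂⟩ := exists_abs_psiDy_le hc hψsupp (2 ^ n)
  have e := fourier_fourierInv_mul (hasTemperateGrowth_psiDy_spFreq hψsmooth hψsupp hψone n) u
  rw [PN, e]
  simp only [← mul_assoc, ← Complex.ofReal_mul]
  have hm : Continuous fun ζ : SpaceTime =>
      ((psiDy ψ L (q ζ) * psiDy ψ (2 ^ n) (spFreq ζ) : ℝ) : ℂ) :=
    Complex.continuous_ofReal.comp (((continuous_psiDy hc L).comp hq).mul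
      ((continuous_psiDy hc _).comp continuous_spFreq))
  refine eLpNorm_fourierInv_mul hm (B := B₁ * B₂) (fun ζ => ?_) u
  rw [Complex.norm_real, Real.norm_eq_abs, abs_mul]
  exact mul_le_mul (h₁ _) (h₂ _) (abs_nonneg _) ((abs_nonneg _).trans (h₁ 0))

end multiplier

section assembly

variable {ψ : ℝ → ℝ}

/-- The piece of `𝓕 u` at spatial frequency `2 ^ i.1` and modulation `2 ^ i.2`, where the
modulation is measured by `q`. -/
def dyPart (ψ : ℝ → ℝ) (q : SpaceTime → ℝ) (u : SpaceTime → ℂ) (i : ℕ × ℕ) (ζ : SpaceTime) : ℂ :=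
  ((psiDy ψ (2 ^ i.2) (q ζ) * psiDy ψ (2 ^ i.1) (spFreq ζ) : ℝ) : ℂ) * 𝓕 u ζ

theorem continuous_fourier_schwartz (u : SchwartzMap SpaceTime ℂ) : Continuous (𝓕 (⇑u)) := by
  rw [← SchwartzMap.fourier_coe]
  exact (𝓕 u).continuous

theorem continuous_dyPart (hψ : Continuous ψ) {q : SpaceTime → ℝ} (hq : Continuous q)
    (u : SchwartzMap SpaceTime ℂ) (i : ℕ × ℕ) : Continuous (dyPart ψ q u i) :=
  (Complex.continuous_ofReal.comp (((continuous_psiDy hψ _).comp hq).mul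
    ((continuous_psiDy hψ _).comp continuous_spFreq))).mul (continuous_fourier_schwartz u)

theorem enorm_fourier_le_tsum_dyPart (hψone : ∀ r ∈ Set.Icc (-1 : ℝ) 1, ψ r = 1)
    (q : SpaceTime → ℝ) (u : SpaceTime → ℂ) (ζ : SpaceTime) :
    ‖𝓕 u ζ‖ₑ ≤ ∑' i, ‖dyPart ψ q u i ζ‖ₑ := by
  have e (i : ℕ × ℕ) : ‖dyPart ψ q u i ζ‖ₑ =
      ‖psiDy ψ (2 ^ i.2) (q ζ)‖ₑ * ‖psiDy ψ (2 ^ i.1) (spFreq ζ)‖ₑ * ‖𝓕 u ζ‖ₑ := by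
    rw [← ofReal_norm, dyPart, norm_mul, Complex.norm_real, norm_mul,
      ENNReal.ofReal_mul (by positivity), ENNReal.ofReal_mul (by positivity)]
    simp only [ofReal_norm]
  simp_rw [e, ENNReal.tsum_prod', ENNReal.tsum_mul_right]
  rw [ENNReal.tsum_mul_left]
  calc ‖𝓕 u ζ‖ₑ = 1 * 1 * ‖𝓕 u ζ‖ₑ := by simp
    _ ≤ _ := by
      gcongr
      · exact one_le_tsum_enorm_psiDy hψone _
      · exact one_le_tsum_enorm_psiDy hψone _

theorem dyBand_of_dyPart_ne_zero (hψsupp : Function.support ψ ⊆ Set.Ioo (-2) 2)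
    (hψone : ∀ r ∈ Set.Icc (-1 : ℝ) 1, ψ r = 1) {q : SpaceTime → ℝ} {u : SpaceTime → ℂ}
    {i : ℕ × ℕ} {z : ℂ × ℝ} (h : ‖dyPart ψ q u i (ofComplexProd z)‖ₑ ≠ 0) :
    dyBand i.1 ‖z.1‖ ∧ |q (ofComplexProd z)| ≤ 2 * 2 ^ i.2 := by
  rw [enorm_ne_zero, dyPart] at h
  have h1 := Complex.ofReal_ne_zero.1 (left_ne_zero_of_mul h)
  have h2 := right_ne_zero_of_mul h1
  rw [spFreq_ofComplexProd] at h2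
  refine ⟨⟨?_, fun hi => ?_⟩, abs_le_of_psiDy_ne_zero hψsupp (left_ne_zero_of_mul h1)⟩
  · simpa using abs_le_of_psiDy_ne_zero hψsupp h2
  · simpa using le_abs_of_psiDy_ne_zero hψone hi h2

theorem tsum_dyPiece_dyPart (hψsmooth : ContDiff ℝ (⊤ : ℕ∞) ψ)
    (hψsupp : Function.support ψ ⊆ Set.Ioo (-2) 2)
    (hψone : ∀ r ∈ Set.Icc (-1 : ℝ) 1, ψ r = 1) (σ : ℝ) {q : SpaceTime → ℝ}
    (hq : Continuous q) (u : SchwartzMap SpaceTime ℂ) :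
    ∑' n : ℕ, (∑' l : ℕ, dyPiece σ (n, l)
        fun z => ‖dyPart ψ q u (n, l) (ofComplexProd z)‖ₑ) ^ 2 =
      ∑' n : ℕ, ENNReal.ofReal (((2 : ℝ) ^ n) ^ (2 * σ)) *
        (∑' l : ℕ, ENNReal.ofReal (((2 : ℝ) ^ l) ^ (5 / 12 : ℝ)) *
          eLpNorm (𝓕⁻ fun ζ => (psiDy ψ (2 ^ l) (q ζ) : ℂ) * 𝓕 (PN ψ (2 ^ n) u) ζ) 2
            volume) ^ 2 := by
  have h2 : (0 : ℝ) < 2 := two_pos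
  refine tsum_congr fun n => ?_
  have e : ENNReal.ofReal (((2 : ℝ) ^ n) ^ (2 * σ)) = ENNReal.ofReal (2 ^ (σ * n)) ^ 2 := by
    rw [← ENNReal.ofReal_pow (by positivity), ← Real.rpow_mul_natCast h2.le,
      ← Real.rpow_natCast_mul h2.le]
    congr 2
    push_cast
    ring
  rw [e, ← mul_pow, ← ENNReal.tsum_mul_left]
  congr 1
  refine tsum_congr fun l => ?_
  rw [dyPiece, l2_comp_ofComplexProd (continuous_dyPart hψsmooth.continuous hq u _).measurable,
    eLpNorm_fourierInv_psiDy_PN hψsmooth hψsupp hψone n _ hq, ← mul_assoc,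
    ← ENNReal.ofReal_mul (by positivity), ← Real.rpow_natCast_mul h2.le, ← Real.rpow_add h2]
  congr 3
  ring

end assembly

/-- Main trilinear estimate. -/
theorem main_trilinear_estimate (ψ : ℝ → ℝ) (hψsmooth : ContDiff ℝ (⊤ : ℕ∞) ψ)
    (hψeven : ∀ r, ψ (-r) = ψ r) (hψnonneg : ∀ r, 0 ≤ ψ r)
    (hψsupp : Function.support ψ ⊆ Set.Ioo (-2) 2)
    (hψone : ∀ r ∈ Set.Icc (-1 : ℝ) 1, ψ r = 1) :
    ∃ C : ℝ, 0 < C ∧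
      ∀ s : ℝ, (s = 1 ∨ s = -1) →
        ∀ v u₁ u₂ : SchwartzMap SpaceTime ℂ,
          ENNReal.ofReal ‖trilinI (𝓕 ⇑v) (𝓕 ⇑u₁) (𝓕 ⇑u₂)‖ ≤
            ENNReal.ofReal C * XSnorm1 ψ 0 (5 / 12) ⇑u₁ * XSnorm1 ψ 0 (5 / 12) ⇑u₂ *
              XWnorm1 ψ s (-(1 / 2)) (5 / 12) ⇑v := by
  set K : ℝ≥0∞ := ENNReal.ofReal (2 ^ (50 : ℝ)) * dyDecaySum ^ 2 with hK
  have hK_top : K ≠ ⊤ := ENNReal.mul_ne_top ENNReal.ofReal_ne_top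
    (ENNReal.pow_ne_top dyDecaySum_ne_top)
  refine ⟨K.toReal + 1, by positivity, fun s hs v u₁ u₂ => ?_⟩
  have hs' : |s| = 1 := by rcases hs with rfl | rfl <;> simp
  have hc := hψsmooth.continuous
  have qW : Continuous fun ζ : SpaceTime => tFreq ζ + s * spFreq ζ :=
    continuous_tFreq.add (continuous_const.mul continuous_spFreq)
  have qS : Continuous fun ζ : SpaceTime => tFreq ζ + spFreq ζ ^ 2 :=
    continuous_tFreq.add (continuous_spFreq.pow 2)
  have mS := measurePreserving_ofComplexProd.measurable
  have me (u : SchwartzMap SpaceTime ℂ) : Measurable fun ζ => ‖𝓕 (⇑u) ζ‖ₑ :=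
    (continuous_fourier_schwartz u).enorm.measurable
  have mp {q : SpaceTime → ℝ} (hq : Continuous q) (u : SchwartzMap SpaceTime ℂ) (i : ℕ × ℕ) :
      Measurable fun z => ‖dyPart ψ q u i (ofComplexProd z)‖ₑ :=
    (continuous_dyPart hc hq u i).enorm.measurable.comp mS
  have sS (u : SchwartzMap SpaceTime ℂ) (i : ℕ × ℕ) (z : ℂ × ℝ)
      (h : ‖dyPart ψ (fun ζ => tFreq ζ + spFreq ζ ^ 2) u i (ofComplexProd z)‖ₑ ≠ 0) :
      dyBand i.1 ‖z.1‖ ∧ |z.2 + ‖z.1‖ ^ 2| ≤ 2 * 2 ^ i.2 := by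
    simpa only [spFreq_ofComplexProd, tFreq_ofComplexProd] using
      dyBand_of_dyPart_ne_zero hψsupp hψone h
  have key := triForm_univ_le hs' (mp qW v) (mp qS u₁) (mp qS u₂)
    (fun z => enorm_fourier_le_tsum_dyPart hψone _ _ _)
    (fun z => enorm_fourier_le_tsum_dyPart hψone _ _ _)
    (fun z => enorm_fourier_le_tsum_dyPart hψone _ _ _)
    (fun i z h => by
      simpa only [spFreq_ofComplexProd, tFreq_ofComplexProd] using
        dyBand_of_dyPart_ne_zero hψsupp hψone h)
    (sS u₁) (sS u₂)
  rw [tsum_dyPiece_dyPart hψsmooth hψsupp hψone _ qW,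
    tsum_dyPiece_dyPart hψsmooth hψsupp hψone _ qS,
    tsum_dyPiece_dyPart hψsmooth hψsupp hψone _ qS] at key
  have sq_half (a : ℝ≥0∞) : (a ^ ((1 : ℝ) / 2)) ^ 2 = a := by
    rw [← ENNReal.rpow_natCast, ← ENNReal.rpow_mul]
    norm_num
  have hC : K ≤ ENNReal.ofReal (K.toReal + 1) := by
    rw [← ENNReal.ofReal_toReal hK_top, ENNReal.toReal_ofReal ENNReal.toReal_nonneg]
    exact ENNReal.ofReal_le_ofReal (by linarith)
  rw [ofReal_norm]
  calc _ ≤ _ := enorm_trilinI_le _ _ _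
    _ = _ := lintegral_lintegral_eq_triForm (me v) (me u₁) (me u₂)
    _ ≤ K * XSnorm1 ψ 0 (5 / 12) ⇑u₁ * XSnorm1 ψ 0 (5 / 12) ⇑u₂ *
          XWnorm1 ψ s (-(1 / 2)) (5 / 12) ⇑v := by
      refine ennreal_le_of_sq_le_sq (key.trans_eq ?_)
      simp only [← hK, mul_pow _ _ 2, XSnorm1, XWnorm1, sq_half, neg_div, SL, WL]
      ring
    _ ≤ _ := by gcongr
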